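/- Let n ≥ 2 and let (u,v) be a solution of Δu = u v², Δv = v u², u > 0, v > 0 on ℝⁿ satisfying the linear growth condition u(x) + v(x) ≤ C₀(1 + |x|) for some constant C₀ > 0. Then there exists a constant C > 0 such that for every x ∈ ℝⁿ with u(x) = v(x): (i) ∫_{∂B₁(x)} (u² + v²) ≤ C, and (ii) for every R > 0, sup_{B_R(x)} (u + v) ≤ C(1 + R). -/

import Mathlib

open MeasureTheory Metric
open scoped RealInnerProductSpace

noncomputable section

/-- The Laplacian of a function on Euclidean space, as the trace of the second derivative. -/
def lap {n : ℕ} (u : EuclideanSpace ℝ (Fin n) → ℝ) (x : EuclideanSpace ℝ (Fin n)) : ℝ :=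
  ∑ i : Fin n, iteratedFDeriv ℝ 2 u x (fun _ => EuclideanSpace.single i 1)

/-- A (positive classical) solution of the system Δu = u v², Δv = v u², u,v > 0 on ℝⁿ. -/
def IsSolution {n : ℕ} (u v : EuclideanSpace ℝ (Fin n) → ℝ) : Prop :=
  ContDiff ℝ (⊤ : ℕ∞) u ∧ ContDiff ℝ (⊤ : ℕ∞) v ∧ (∀ x, 0 < u x) ∧ (∀ x, 0 < v x) ∧
    (∀ x, lap u x = u x * v x ^ 2) ∧ (∀ x, lap v x = v x * u x ^ 2)

/-- The bulk energy ∫_{B_r(x)} (|∇u|² + |∇v|² + u²v²). -/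
def bulk {n : ℕ} (u v : EuclideanSpace ℝ (Fin n) → ℝ) (x : EuclideanSpace ℝ (Fin n)) (r : ℝ) :
    ℝ :=
  ∫ y in ball x r, (‖gradient u y‖ ^ 2 + ‖gradient v y‖ ^ 2 + (u y) ^ 2 * (v y) ^ 2)

/-- The boundary mass ∫_{∂B_r(x)} (u² + v²), w.r.t. the (n-1)-dimensional surface
(Hausdorff) measure on the sphere. -/
def bdry {n : ℕ} (u v : EuclideanSpace ℝ (Fin n) → ℝ) (x : EuclideanSpace ℝ (Fin n)) (r : ℝ) :
    ℝ :=
  ∫ y in sphere x r, ((u y) ^ 2 + (v y) ^ 2) ∂μH[(n : ℝ) - 1]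

/-- The Almgren frequency N(r; x). -/
def freq {n : ℕ} (u v : EuclideanSpace ℝ (Fin n) → ℝ) (x : EuclideanSpace ℝ (Fin n)) (r : ℝ) :
    ℝ :=
  r * bulk u v x r / bdry u v x r

namespace SegregationBounds

open ProbabilityTheory

/-- The Euclidean space in which the system is posed. -/
abbrev Eu (n : ℕ) := EuclideanSpace ℝ (Fin n)

/-- The standard Gaussian measure. -/
abbrev gm (n : ℕ) : Measure (Eu n) := stdGaussian (Eu n)

/-- The Lebesgue density of the standard Gaussian measure. -/
def gdens (n : ℕ) (y : Eu n) : ℝ := (2 * Real.pi) ^ (-(n / 2 : ℝ)) * Real.exp (-(1 / 2) * ‖y‖ ^ 2)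

lemma gdens_pos {n : ℕ} (y : Eu n) : 0 < gdens n y := by
  unfold gdens; positivity

lemma continuous_gdens {n : ℕ} : Continuous (gdens n) := by
  unfold gdens; fun_prop

lemma integral_gdens (n : ℕ) : ∫ y, gdens n y = 1 := by
  unfold gdens
  rw [integral_const_mul, GaussianFourier.integral_rexp_neg_mul_sq_norm (by norm_num)]
  rw [show Real.pi / (1 / 2) = 2 * Real.pi by ring, finrank_euclideanSpace_fin,
    ← Real.rpow_add (by positivity)]
  simp

lemma integrable_gdens (n : ℕ) : Integrable (gdens n) := by
  by_contra h
  have := integral_gdens n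
  rw [integral_undef h] at this
  exact zero_ne_one this

/-- The standard Gaussian measure is absolutely continuous with the explicit density. -/
theorem gm_eq_withDensity (n : ℕ) :
    gm n = volume.withDensity (fun y => ENNReal.ofReal (gdens n y)) := by
  have hfin : IsFiniteMeasure (volume.withDensity (fun y => ENNReal.ofReal (gdens n y))) :=
    isFiniteMeasure_withDensity_ofReal (integrable_gdens n).2
  refine Measure.ext_of_charFun ?_
  ext t
  rw [charFun_stdGaussian, charFun_apply, integral_withDensity_eq_integral_toReal_smul
    (by have := continuous_gdens (n := n); fun_prop) (by simp)]
  have h1 := GaussianFourier.integral_cexp_neg_mul_sq_norm_add (b := 1 / 2) (by norm_num)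
    Complex.I t
  have h2 : ∀ y : Eu n, (ENNReal.ofReal (gdens n y)).toReal • Complex.exp (⟪y, t⟫ * Complex.I)
      = ((2 * Real.pi) ^ (-(n / 2 : ℝ)) : ℝ) *
        Complex.exp (-(1 / 2) * ‖y‖ ^ 2 + Complex.I * ⟪t, y⟫) := by
    intro y
    rw [ENNReal.toReal_ofReal (gdens_pos y).le, gdens, Complex.exp_add, real_inner_comm,
      Complex.real_smul]
    push_cast
    rw [mul_comm Complex.I]
    ring
  simp_rw [h2]
  rw [integral_const_mul, h1, finrank_euclideanSpace_fin]
  have h3 : ((Real.pi : ℂ) / (1 / 2)) ^ ((n : ℂ) / 2) = (((2 * Real.pi) ^ (n / 2 : ℝ) : ℝ) : ℂ) := by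
    rw [Complex.ofReal_cpow (by positivity)]
    push_cast
    congr 1
    ring
  rw [h3, ← mul_assoc, ← Complex.ofReal_mul, ← Real.rpow_add (by positivity)]
  simp only [neg_add_cancel, Real.rpow_zero, Complex.ofReal_one, one_mul]
  congr 1
  rw [Complex.I_sq]
  ring

lemma integral_gm {n : ℕ} (f : Eu n → ℝ) : ∫ y, f y ∂(gm n) = ∫ y, gdens n y * f y := by
  rw [gm_eq_withDensity, integral_withDensity_eq_integral_toReal_smul
    (by have := continuous_gdens (n := n); fun_prop) (by simp)]
  simp [ENNReal.toReal_ofReal (gdens_pos _).le]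

lemma integrable_gm_iff {n : ℕ} {f : Eu n → ℝ} :
    Integrable f (gm n) ↔ Integrable (fun y => gdens n y * f y) := by
  rw [gm_eq_withDensity, integrable_withDensity_iff_integrable_smul'
    (by have := continuous_gdens (n := n); fun_prop) (by simp)]
  simp [ENNReal.toReal_ofReal (gdens_pos _).le]

/-- Functions of at most polynomial growth. -/
def Poly {n : ℕ} (f : Eu n → ℝ) : Prop := ∃ C : ℝ, ∃ k : ℕ, ∀ y, |f y| ≤ C * (1 + ‖y‖) ^ k

lemma integrable_one_add_norm_pow (n k : ℕ) : Integrable (fun y : Eu n => (1 + ‖y‖) ^ k) (gm n) := by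
  have h0 : MemLp (fun y : Eu n => y) ((max k 1 : ℕ) : ENNReal) (gm n) :=
    IsGaussian.memLp_id (gm n) _ (ENNReal.natCast_ne_top _)
  have h1 : MemLp (fun _ : Eu n => (1 : ℝ)) ((max k 1 : ℕ) : ENNReal) (gm n) := memLp_const 1
  have h2 := (h1.add h0.norm).integrable_norm_pow (by simp)
  simp only [Pi.add_apply] at h2
  refine h2.mono' (by fun_prop) (Filter.Eventually.of_forall fun y => ?_)
  have : (1:ℝ) ≤ 1 + ‖y‖ := by linarith [norm_nonneg y]
  rw [Real.norm_of_nonneg (by positivity), Real.norm_of_nonneg (by positivity)]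
  exact pow_le_pow_right₀ this (le_max_left _ _)

lemma Poly.integrable {n : ℕ} {f : Eu n → ℝ} (hf : Poly f)
    (hm : AEStronglyMeasurable f (gm n)) : Integrable f (gm n) := by
  obtain ⟨C, k, h⟩ := hf
  exact ((integrable_one_add_norm_pow n k).const_mul C).mono' hm
    (Filter.Eventually.of_forall fun y => h y)

lemma Poly.exists_pos {n : ℕ} {f : Eu n → ℝ} (hf : Poly f) :
    ∃ C : ℝ, 0 < C ∧ ∃ k : ℕ, ∀ y, |f y| ≤ C * (1 + ‖y‖) ^ k := by
  obtain ⟨C, k, h⟩ := hf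
  refine ⟨max C 1, by positivity, k, fun y => (h y).trans ?_⟩
  gcongr
  exact le_max_left _ _

lemma Poly.add {n : ℕ} {f g : Eu n → ℝ} (hf : Poly f) (hg : Poly g) :
    Poly (fun y => f y + g y) := by
  obtain ⟨C, hC, k, h⟩ := hf.exists_pos
  obtain ⟨D, hD, l, h'⟩ := hg.exists_pos
  refine ⟨C + D, k + l, fun y => ?_⟩
  have h1 : (1:ℝ) ≤ 1 + ‖y‖ := by linarith [norm_nonneg y]
  calc |f y + g y| ≤ |f y| + |g y| := abs_add_le _ _
    _ ≤ C * (1 + ‖y‖) ^ k + D * (1 + ‖y‖) ^ l := add_le_add (h y) (h' y)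
    _ ≤ C * (1 + ‖y‖) ^ (k + l) + D * (1 + ‖y‖) ^ (k + l) := by
      gcongr <;> first | exact h1 | omega
    _ = _ := by ring

lemma Poly.mul {n : ℕ} {f g : Eu n → ℝ} (hf : Poly f) (hg : Poly g) :
    Poly (fun y => f y * g y) := by
  obtain ⟨C, hC, k, h⟩ := hf.exists_pos
  obtain ⟨D, hD, l, h'⟩ := hg.exists_pos
  refine ⟨C * D, k + l, fun y => ?_⟩
  rw [abs_mul]
  calc |f y| * |g y| ≤ (C * (1 + ‖y‖) ^ k) * (D * (1 + ‖y‖) ^ l) :=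
        mul_le_mul (h y) (h' y) (abs_nonneg _) (by positivity)
    _ = _ := by ring

lemma Poly.mono {n : ℕ} {f g : Eu n → ℝ} (hg : Poly g) (h : ∀ y, |f y| ≤ |g y|) : Poly f := by
  obtain ⟨C, k, h'⟩ := hg
  exact ⟨C, k, fun y => (h y).trans (h' y)⟩

lemma Poly.const {n : ℕ} (c : ℝ) : Poly (fun _ : Eu n => c) := ⟨|c|, 0, fun y => by simp⟩

lemma Poly.const_mul {n : ℕ} {f : Eu n → ℝ} (hf : Poly f) (c : ℝ) : Poly (fun y => c * f y) :=
  (Poly.const c).mul hf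

lemma Poly.sub {n : ℕ} {f g : Eu n → ℝ} (hf : Poly f) (hg : Poly g) :
    Poly (fun y => f y - g y) := by
  obtain ⟨C, k, h⟩ := hf.add (hg.const_mul (-1))
  exact ⟨C, k, fun y => by simpa [sub_eq_add_neg] using h y⟩

lemma Poly.pow {n : ℕ} {f : Eu n → ℝ} (hf : Poly f) (k : ℕ) : Poly (fun y => f y ^ k) := by
  induction k with
  | zero => simpa using Poly.const 1
  | succ k ih => simpa only [pow_succ] using ih.mul hf

lemma Poly.sum {n : ℕ} {ι : Type*} {s : Finset ι} {f : ι → Eu n → ℝ} (hf : ∀ i ∈ s, Poly (f i)) :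
    Poly (fun y => ∑ i ∈ s, f i y) := by
  classical
  induction s using Finset.induction_on with
  | empty => simpa using Poly.const 0
  | insert i s hi ih =>
    simp only [Finset.sum_insert hi]
    exact (hf _ (Finset.mem_insert_self _ _)).add
      (ih fun j hj => hf j (Finset.mem_insert_of_mem hj))

lemma Poly.norm {n : ℕ} : Poly (fun y : Eu n => ‖y‖) :=
  ⟨1, 1, fun y => by simp⟩

lemma abs_coord_le {n : ℕ} (y : Eu n) (i : Fin n) : |y i| ≤ ‖y‖ := by
  simpa using PiLp.norm_apply_le y i

lemma Poly.coord {n : ℕ} (i : Fin n) : Poly (fun y : Eu n => y i) :=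
  Poly.norm.mono fun y => by simpa using abs_coord_le y i

/-- The vectors of the standard basis. -/
abbrev bv {n : ℕ} (i : Fin n) : Eu n := EuclideanSpace.single i 1

/-- Partial derivatives. -/
def pd {n : ℕ} (i : Fin n) (f : Eu n → ℝ) (y : Eu n) : ℝ := fderiv ℝ f y (bv i)

lemma hasFDerivAt_gdens {n : ℕ} (y : Eu n) :
    HasFDerivAt (gdens n) (-(gdens n y) • innerSL ℝ y) y := by
  unfold gdens
  have h : HasFDerivAt (fun y : Eu n => ‖y‖ ^ 2) (2 • innerSL ℝ y) y :=
    (hasStrictFDerivAt_norm_sq y).hasFDerivAt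
  refine ((h.const_mul (-(1 / 2))).exp.const_mul ((2 * Real.pi) ^ (-(n / 2 : ℝ)))).congr_fderiv ?_
  ext z
  simp
  ring

/-- **Gaussian integration by parts.** -/
theorem stein {n : ℕ} (i : Fin n) {f : Eu n → ℝ} (hf : Differentiable ℝ f) (hp : Poly f)
    (hp' : Poly (pd i f)) :
    ∫ y, pd i f y ∂(gm n) = ∫ y, y i * f y ∂(gm n) := by
  have hg : ∀ y, fderiv ℝ (gdens n) y (bv i) = -(gdens n y * y i) := by
    intro y
    rw [(hasFDerivAt_gdens y).fderiv]
    simp [EuclideanSpace.inner_single_right]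
  have m1 : AEStronglyMeasurable (pd i f) (gm n) := by
    unfold pd
    exact (measurable_fderiv_apply_const ℝ f _).aestronglyMeasurable
  have m2 : Continuous f := hf.continuous
  have i1 := integrable_gm_iff.1 (hp'.integrable m1)
  have i2 := integrable_gm_iff.1 (((Poly.coord i).mul hp).integrable (by fun_prop))
  have i3 := integrable_gm_iff.1 (hp.integrable m2.aestronglyMeasurable)
  have := integral_mul_fderiv_eq_neg_fderiv_mul_of_integrable (μ := volume) (f := gdens n)
    (g := f) (v := bv i) ?_ i1 i3 (fun x _ => (hasFDerivAt_gdens x).differentiableAt)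
    (fun x _ => hf x)
  · rw [integral_gm, integral_gm]
    refine this.trans ?_
    rw [← integral_neg]
    congr 1
    ext y
    rw [hg]
    ring
  · convert i2.neg using 1
    ext y
    simp only [hg, Pi.neg_apply]
    ring

/-- The Laplacian, as a sum of iterated partial derivatives. -/
def lapl {n : ℕ} (f : Eu n → ℝ) (y : Eu n) : ℝ := ∑ i, pd i (pd i f) y

/-- The Euler field applied to `f`. -/
def eul {n : ℕ} (f : Eu n → ℝ) (y : Eu n) : ℝ := ∑ i, y i * pd i f y

lemma _root_.Function.HasTemperateGrowth.contDiff {n : ℕ} {f : Eu n → ℝ} (hf : f.HasTemperateGrowth) : ContDiff ℝ (⊤ : ℕ∞) f := hf.1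

lemma _root_.Function.HasTemperateGrowth.differentiable {n : ℕ} {f : Eu n → ℝ} (hf : f.HasTemperateGrowth) : Differentiable ℝ f :=
  hf.1.differentiable (by simp)

lemma _root_.Function.HasTemperateGrowth.continuous {n : ℕ} {f : Eu n → ℝ} (hf : f.HasTemperateGrowth) : Continuous f := hf.1.continuous

lemma _root_.Function.HasTemperateGrowth.poly {n : ℕ} {f : Eu n → ℝ} (hf : f.HasTemperateGrowth) : Poly f := by
  obtain ⟨k, C, h⟩ := hf.2 0
  exact ⟨C, k, fun y => by simpa using h y⟩

lemma _root_.Function.HasTemperateGrowth.integrable {n : ℕ} {f : Eu n → ℝ} (hf : f.HasTemperateGrowth) : Integrable f (gm n) :=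
  hf.poly.integrable hf.continuous.aestronglyMeasurable

lemma contDiff_pd {n : ℕ} (i : Fin n) {f : Eu n → ℝ} (hf : ContDiff ℝ (⊤ : ℕ∞) f) :
    ContDiff ℝ (⊤ : ℕ∞) (pd i f) := by
  have h : ContDiff ℝ (⊤ : ℕ∞) (fderiv ℝ f) := hf.fderiv_right (by simp)
  exact h.clm_apply contDiff_const

lemma _root_.Function.HasTemperateGrowth.fderiv {n : ℕ} {f : Eu n → ℝ} (hf : f.HasTemperateGrowth) :
    (fderiv ℝ f).HasTemperateGrowth := by
  refine ⟨hf.1.fderiv_right (by simp), fun m => ?_⟩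
  obtain ⟨k, C, h⟩ := hf.2 (m + 1)
  exact ⟨k, C, fun x => by rw [norm_iteratedFDeriv_fderiv]; exact h x⟩

@[fun_prop]
lemma _root_.Function.HasTemperateGrowth.pd {n : ℕ} (i : Fin n) {f : Eu n → ℝ} (hf : f.HasTemperateGrowth) : (pd i f).HasTemperateGrowth :=
  Function.HasTemperateGrowth.comp (ContinuousLinearMap.hasTemperateGrowth
    (ContinuousLinearMap.apply ℝ ℝ (bv i))) hf.fderiv

@[fun_prop]
lemma _root_.Function.HasTemperateGrowth.coord {n : ℕ} (i : Fin n) : Function.HasTemperateGrowth (fun y : Eu n => y i) :=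
  ContinuousLinearMap.hasTemperateGrowth (EuclideanSpace.proj i : Eu n →L[ℝ] ℝ)

@[fun_prop]
lemma _root_.Function.HasTemperateGrowth.lapl {n : ℕ} {f : Eu n → ℝ} (hf : f.HasTemperateGrowth) : (lapl f).HasTemperateGrowth := by
  unfold SegregationBounds.lapl; fun_prop

@[fun_prop]
lemma _root_.Function.HasTemperateGrowth.eul {n : ℕ} {f : Eu n → ℝ} (hf : f.HasTemperateGrowth) : (eul f).HasTemperateGrowth := by
  unfold SegregationBounds.eul; fun_prop

lemma pd_add {n : ℕ} (i : Fin n) {f g : Eu n → ℝ} {y : Eu n} (hf : DifferentiableAt ℝ f y)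
    (hg : DifferentiableAt ℝ g y) : pd i (fun y => f y + g y) y = pd i f y + pd i g y := by
  simp [pd, fderiv_fun_add hf hg]

lemma pd_sub {n : ℕ} (i : Fin n) {f g : Eu n → ℝ} {y : Eu n} (hf : DifferentiableAt ℝ f y)
    (hg : DifferentiableAt ℝ g y) : pd i (fun y => f y - g y) y = pd i f y - pd i g y := by
  simp [pd, fderiv_fun_sub hf hg]

lemma pd_mul {n : ℕ} (i : Fin n) {f g : Eu n → ℝ} {y : Eu n} (hf : DifferentiableAt ℝ f y)
    (hg : DifferentiableAt ℝ g y) :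
    pd i (fun y => f y * g y) y = pd i f y * g y + f y * pd i g y := by
  simp [pd, fderiv_fun_mul hf hg]; ring

lemma pd_const {n : ℕ} (i : Fin n) (c : ℝ) (y : Eu n) : pd i (fun _ => c) y = 0 := by
  simp [pd]

lemma pd_const_mul {n : ℕ} (i : Fin n) {f : Eu n → ℝ} {y : Eu n} (hf : DifferentiableAt ℝ f y)
    (c : ℝ) : pd i (fun y => c * f y) y = c * pd i f y := by
  rw [pd_mul i (differentiableAt_const c) hf, pd_const]; ring

lemma pd_sq {n : ℕ} (i : Fin n) {f : Eu n → ℝ} {y : Eu n} (hf : DifferentiableAt ℝ f y) :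
    pd i (fun y => f y ^ 2) y = 2 * f y * pd i f y := by
  simp only [pow_two]
  rw [pd_mul i hf hf]; ring

lemma pd_sum {n : ℕ} (i : Fin n) {ι : Type*} {s : Finset ι} {f : ι → Eu n → ℝ} {y : Eu n}
    (hf : ∀ j ∈ s, DifferentiableAt ℝ (f j) y) :
    pd i (fun y => ∑ j ∈ s, f j y) y = ∑ j ∈ s, pd i (f j) y := by
  simp [pd, fderiv_fun_sum hf]

lemma pd_coord {n : ℕ} (i j : Fin n) (y : Eu n) :
    pd i (fun y => y j) y = if i = j then 1 else 0 := by
  have : HasFDerivAt (fun y : Eu n => y j) (EuclideanSpace.proj j : Eu n →L[ℝ] ℝ) y :=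
    (EuclideanSpace.proj j : Eu n →L[ℝ] ℝ).hasFDerivAt
  rw [pd, this.fderiv]
  simp [eq_comm]

lemma pd_comm {n : ℕ} (i j : Fin n) {f : Eu n → ℝ} (hf : ContDiff ℝ (⊤ : ℕ∞) f) (y : Eu n) :
    pd i (pd j f) y = pd j (pd i f) y := by
  have h : DifferentiableAt ℝ (fderiv ℝ f) y :=
    (hf.fderiv_right (m := (⊤ : ℕ∞)) (by simp)).differentiable (by simp) y
  have key : ∀ a b : Fin n, pd a (pd b f) y = fderiv ℝ (fderiv ℝ f) y (bv a) (bv b) := by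
    intro a b
    have := (h.hasFDerivAt.clm_apply (hasFDerivAt_const (bv b) y)).fderiv
    unfold pd
    rw [this]
    simp
  rw [key, key]
  have hs : IsSymmSndFDerivAt ℝ f y :=
    hf.contDiffAt.isSymmSndFDerivAt (by
      rw [minSmoothness_of_isRCLikeNormedField]
      exact WithTop.coe_le_coe.2 (le_top : (2 : ℕ∞) ≤ ⊤))
  exact hs _ _

lemma lap_eq_lapl {n : ℕ} {f : Eu n → ℝ} (hf : ContDiff ℝ (⊤ : ℕ∞) f) (y : Eu n) :
    lap f y = lapl f y := by
  have h : DifferentiableAt ℝ (fderiv ℝ f) y :=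
    (hf.fderiv_right (m := (⊤ : ℕ∞)) (by simp)).differentiable (by simp) y
  unfold lap lapl
  refine Finset.sum_congr rfl fun i _ => ?_
  rw [iteratedFDeriv_two_apply]
  have := (h.hasFDerivAt.clm_apply (hasFDerivAt_const (bv i) y)).fderiv
  unfold pd
  rw [this]
  simp

lemma hasFDerivAt_sum_pd {n : ℕ} {f : Eu n → ℝ} {y : Eu n} (h : Eu n) :
    fderiv ℝ f y h = ∑ i, h i * pd i f y := by
  conv_lhs => rw [← (EuclideanSpace.basisFun (Fin n) ℝ).sum_repr h]
  simp [pd, map_sum]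

lemma hasDerivAt_comp_line {n : ℕ} {f : Eu n → ℝ} (hf : Differentiable ℝ f) (x z : Eu n) (t : ℝ) :
    HasDerivAt (fun t : ℝ => f (x + t • z)) (∑ i, z i * pd i f (x + t • z)) t := by
  rw [← hasFDerivAt_sum_pd]
  have h2 : HasDerivAt (fun t : ℝ => x + t • z) z t := by
    simpa using ((hasDerivAt_id t).smul_const z).const_add x
  exact (hf _).hasFDerivAt.comp_hasDerivAt t h2

lemma pd_comp_affine {n : ℕ} (i : Fin n) {f : Eu n → ℝ} (hf : Differentiable ℝ f) (x : Eu n)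
    (r : ℝ) (y : Eu n) : pd i (fun y => f (x + r • y)) y = r * pd i f (x + r • y) := by
  have h2 : HasFDerivAt (fun y : Eu n => x + r • y) (r • ContinuousLinearMap.id ℝ (Eu n)) y :=
    ((hasFDerivAt_id y).const_smul r).const_add x
  have := ((hf (x + r • y)).hasFDerivAt.comp y h2).fderiv
  unfold pd
  rw [show (fun y => f (x + r • y)) = f ∘ (fun y => x + r • y) from rfl, this]
  simp

lemma lapl_comp_affine {n : ℕ} {f : Eu n → ℝ} (hf : ContDiff ℝ (⊤ : ℕ∞) f) (x : Eu n)
    (r : ℝ) (y : Eu n) : lapl (fun y => f (x + r • y)) y = r ^ 2 * lapl f (x + r • y) := by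
  unfold lapl
  rw [Finset.mul_sum]
  refine Finset.sum_congr rfl fun i _ => ?_
  have h1 := hf.differentiable (by simp)
  have h2 := (contDiff_pd i hf).differentiable (by simp)
  rw [show pd i (fun y => f (x + r • y)) = fun y => r * pd i f (x + r • y) from
    funext fun y => pd_comp_affine i h1 x r y, pd_const_mul, pd_comp_affine i h2]
  · ring
  · exact (h2 _).comp y (by fun_prop)

lemma lapl_sub {n : ℕ} {f g : Eu n → ℝ} (hf : ContDiff ℝ (⊤ : ℕ∞) f)
    (hg : ContDiff ℝ (⊤ : ℕ∞) g) (y : Eu n) :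
    lapl (fun y => f y - g y) y = lapl f y - lapl g y := by
  unfold lapl
  rw [← Finset.sum_sub_distrib]
  refine Finset.sum_congr rfl fun i _ => ?_
  have h1 := hf.differentiable (by simp)
  have h2 := hg.differentiable (by simp)
  rw [show pd i (fun y => f y - g y) = fun y => pd i f y - pd i g y from
    funext fun y => pd_sub i (h1 y) (h2 y), pd_sub]
  · exact (contDiff_pd i hf).differentiable (by simp) y
  · exact (contDiff_pd i hg).differentiable (by simp) y

lemma lapl_const_mul {n : ℕ} {f : Eu n → ℝ} (hf : ContDiff ℝ (⊤ : ℕ∞) f) (c : ℝ) (y : Eu n) :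
    lapl (fun y => c * f y) y = c * lapl f y := by
  unfold lapl
  rw [Finset.mul_sum]
  refine Finset.sum_congr rfl fun i _ => ?_
  have h1 := hf.differentiable (by simp)
  rw [show pd i (fun y => c * f y) = fun y => c * pd i f y from
    funext fun y => pd_const_mul i (h1 y) c, pd_const_mul]
  exact (contDiff_pd i hf).differentiable (by simp) y

lemma contDiff_coord {n : ℕ} (i : Fin n) : ContDiff ℝ (⊤ : ℕ∞) (fun y : Eu n => y i) :=
  (EuclideanSpace.proj i : Eu n →L[ℝ] ℝ).contDiff

lemma norm_sq_eq {n : ℕ} (y : Eu n) : ‖y‖ ^ 2 = ∑ i, y i ^ 2 := by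
  simp [EuclideanSpace.norm_sq_eq]

lemma pd_norm_sq {n : ℕ} (i : Fin n) (y : Eu n) : pd i (fun y => ‖y‖ ^ 2) y = 2 * y i := by
  have h : HasFDerivAt (fun y : Eu n => ‖y‖ ^ 2) (2 • innerSL ℝ y) y :=
    (hasStrictFDerivAt_norm_sq y).hasFDerivAt
  rw [pd, h.fderiv]
  simp [EuclideanSpace.inner_single_right]

lemma lapl_norm_sq {n : ℕ} (y : Eu n) : lapl (fun y => ‖y‖ ^ 2) y = 2 * n := by
  unfold lapl
  have : ∀ i : Fin n, pd i (pd i (fun y : Eu n => ‖y‖ ^ 2)) y = 2 := by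
    intro i
    rw [show pd i (fun y : Eu n => ‖y‖ ^ 2) = fun y => 2 * y i from
      funext fun y => pd_norm_sq i y, pd_const_mul _ ((contDiff_coord i).differentiable (by simp) y),
      pd_coord]
    simp
  simp [this]
  ring

/-- At an interior maximum the Laplacian is nonpositive. -/
lemma lapl_nonpos_of_isLocalMax {n : ℕ} {f : Eu n → ℝ} (hf : ContDiff ℝ (⊤ : ℕ∞) f) {y : Eu n}
    (hy : IsLocalMax f y) : lapl f y ≤ 0 := by
  refine Finset.sum_nonpos fun i _ => ?_
  by_contra! hpos
  have hd := hf.differentiable (by simp)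
  have hd' := (contDiff_pd i hf).differentiable (by simp)
  set φ : ℝ → ℝ := fun t => f (y + t • bv i)
  have h1 : ∀ t, HasDerivAt φ (pd i f (y + t • bv i)) t := by
    intro t
    have := hasDerivAt_comp_line hd y (bv i) t
    simpa [Pi.single_apply] using this
  have h2 : HasDerivAt (fun t : ℝ => pd i f (y + t • bv i)) (pd i (pd i f) y) 0 := by
    have := hasDerivAt_comp_line hd' y (bv i) 0
    simpa [Pi.single_apply] using this
  have hder : deriv φ = fun t : ℝ => pd i f (y + t • bv i) := funext fun t => (h1 t).deriv
  have hcont : Continuous (fun t : ℝ => y + t • bv i) := by fun_prop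
  have hmax : IsLocalMax φ 0 := by
    have : Filter.Tendsto (fun t : ℝ => y + t • bv i) (nhds 0) (nhds y) := by
      simpa using hcont.tendsto 0
    have h3 := this.eventually hy
    filter_upwards [h3] with t ht
    simpa [φ] using ht
  have hd0 : deriv φ 0 = 0 := hmax.deriv_eq_zero
  have hmin : IsLocalMin φ 0 :=
    isLocalMin_of_deriv_deriv_pos (by rw [hder, h2.deriv]; exact hpos) hd0 (h1 0).continuousAt
  have hconst : φ =ᶠ[nhds 0] fun _ => φ 0 := by
    filter_upwards [hmax, hmin] with t a b
    exact le_antisymm a b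
  have h5 : deriv (deriv φ) 0 = 0 := by
    have := hconst.deriv.deriv_eq
    simpa using this
  rw [hder, h2.deriv] at h5
  exact hpos.ne' h5

/-- The reflection `y ↦ y - 2 yᵢ eᵢ`. -/
def coordRefl {n : ℕ} (i : Fin n) : Eu n →L[ℝ] Eu n :=
  ContinuousLinearMap.id ℝ (Eu n) -
    (2 : ℝ) • (EuclideanSpace.proj i : Eu n →L[ℝ] ℝ).smulRight (bv i)

lemma coordRefl_apply {n : ℕ} (i : Fin n) (y : Eu n) :
    coordRefl i y = y - (2 * y i) • bv i := by
  simp [coordRefl, smul_smul, -EuclideanSpace.basisFun_apply]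

lemma norm_coordRefl {n : ℕ} (i : Fin n) (y : Eu n) : ‖coordRefl i y‖ = ‖y‖ := by
  have : ‖coordRefl i y‖ ^ 2 = ‖y‖ ^ 2 := by
    rw [norm_sq_eq, norm_sq_eq]
    refine Finset.sum_congr rfl fun j _ => ?_
    rw [coordRefl_apply]
    by_cases h : j = i
    · subst h; simp; ring
    · simp [h]
  exact (pow_left_inj₀ (norm_nonneg _) (norm_nonneg _) two_ne_zero).1 this

lemma pd_comp_coordRefl {n : ℕ} (i j : Fin n) {f : Eu n → ℝ} (hf : Differentiable ℝ f)
    (x y : Eu n) : pd j (fun y => f (x + coordRefl i y)) y =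
      (if j = i then -1 else 1) * pd j f (x + coordRefl i y) := by
  have h2 : HasFDerivAt (fun y : Eu n => x + coordRefl i y) (coordRefl i) y :=
    (coordRefl i).hasFDerivAt.const_add x
  have := ((hf (x + coordRefl i y)).hasFDerivAt.comp y h2).fderiv
  unfold pd
  rw [show (fun y => f (x + coordRefl i y)) = f ∘ (fun y => x + coordRefl i y) from rfl, this,
    ContinuousLinearMap.comp_apply, coordRefl_apply i (bv j)]
  by_cases h : j = i
  · subst h; simp; ring
  · simp [h, Ne.symm h]

lemma lapl_comp_coordRefl {n : ℕ} (i : Fin n) {f : Eu n → ℝ} (hf : ContDiff ℝ (⊤ : ℕ∞) f)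
    (x y : Eu n) : lapl (fun y => f (x + coordRefl i y)) y = lapl f (x + coordRefl i y) := by
  refine Finset.sum_congr rfl fun j _ => ?_
  have h1 := hf.differentiable (by simp)
  have h2 := (contDiff_pd j hf).differentiable (by simp)
  rw [show pd j (fun y => f (x + coordRefl i y)) = fun y =>
      (if j = i then -1 else 1) * pd j f (x + coordRefl i y) from
    funext fun y => pd_comp_coordRefl i j h1 x y, pd_const_mul, pd_comp_coordRefl i j h2]
  · split_ifs <;> ring
  · exact (h2 _).comp y (by fun_prop)

lemma lapl_coord {n : ℕ} (i : Fin n) (y : Eu n) : lapl (fun y => y i) y = 0 := by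
  refine Finset.sum_eq_zero fun j _ => ?_
  rw [show pd j (fun y : Eu n => y i) = fun _ => if j = i then 1 else 0 from
    funext fun y => pd_coord j i y, pd_const]

lemma lapl_coord_sq {n : ℕ} (i : Fin n) (y : Eu n) : lapl (fun y => y i ^ 2) y = 2 := by
  have hd := (contDiff_coord (n := n) i).differentiable (by simp)
  have : ∀ j : Fin n, pd j (pd j (fun y : Eu n => y i ^ 2)) y = if j = i then 2 else 0 := by
    intro j
    rw [show pd j (fun y : Eu n => y i ^ 2) = fun y => (if j = i then 2 else 0) * y i from
      funext fun y => by rw [pd_sq j (hd y), pd_coord]; split_ifs <;> ring,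
      pd_const_mul j (hd y), pd_coord]
    split_ifs <;> ring
  simp [lapl, this]

/-- A one-sided interior gradient bound for functions with bounded Laplacian, proved with a barrier
on a half ball. -/
lemma pd_le_of_bounded {n : ℕ} {u : Eu n → ℝ} (hu : ContDiff ℝ (⊤ : ℕ∞) u) (x : Eu n) {A F : ℝ}
    (hA : ∀ y, ‖y‖ ≤ 1 → |u (x + y)| ≤ A) (hF : ∀ y, ‖y‖ ≤ 1 → |lapl u (x + y)| ≤ F) (i : Fin n) :
    pd i u x ≤ 2 * A * n + F + 1 := by
  have hA0 : 0 ≤ A := (abs_nonneg _).trans (hA 0 (by simp))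
  have hF0 : 0 ≤ F := (abs_nonneg _).trans (hF 0 (by simp))
  set c : ℝ := 2 * A * n + F + 1
  have hc : 0 < c := by positivity
  set f : Eu n → ℝ := fun y => ((u (x + (1 : ℝ) • y) - u (x + coordRefl i y)) - 2 * A * ‖y‖ ^ 2)
    - (c * y i - c * y i ^ 2) with hf
  have s1 : ContDiff ℝ (⊤ : ℕ∞) (fun y : Eu n => u (x + (1 : ℝ) • y)) := hu.comp (by fun_prop)
  have s2 : ContDiff ℝ (⊤ : ℕ∞) (fun y : Eu n => u (x + coordRefl i y)) := hu.comp (by fun_prop)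
  have s3 : ContDiff ℝ (⊤ : ℕ∞) (fun y : Eu n => ‖y‖ ^ 2) := contDiff_norm_sq ℝ
  have s4 := contDiff_coord (n := n) i
  have s5 : ContDiff ℝ (⊤ : ℕ∞) (fun y : Eu n => y i ^ 2) := s4.pow 2
  have hfs : ContDiff ℝ (⊤ : ℕ∞) f := by
    exact ((s1.sub s2).sub (contDiff_const.mul s3)).sub
      ((contDiff_const.mul s4).sub (contDiff_const.mul s5))
  have hlap : ∀ y, ‖y‖ ≤ 1 → 0 < lapl f y := by
    intro y hy
    rw [hf, lapl_sub ((s1.sub s2).sub (contDiff_const.mul s3))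
      ((contDiff_const.mul s4).sub (contDiff_const.mul s5)),
      lapl_sub (s1.sub s2) (contDiff_const.mul s3), lapl_sub s1 s2, lapl_comp_affine hu,
      lapl_comp_coordRefl i hu, lapl_const_mul s3, lapl_norm_sq,
      lapl_sub (contDiff_const.mul s4) (contDiff_const.mul s5), lapl_const_mul s4,
      lapl_const_mul s5, lapl_coord, lapl_coord_sq]
    have h1 := abs_le.1 (hF y hy)
    have h2 := abs_le.1 (hF (coordRefl i y) (by rwa [norm_coordRefl]))
    simp only [one_smul, one_pow, one_mul]
    simp only [c]
    linarith [h1.1, h2.2]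
  set K : Set (Eu n) := closedBall 0 1 ∩ {y | 0 ≤ y i}
  have hK : IsCompact K := (isCompact_closedBall 0 1).inter_right
    (isClosed_le continuous_const s4.continuous)
  obtain ⟨z, hz, hmax⟩ := hK.exists_isMaxOn ⟨0, by simp [K]⟩ hfs.continuous.continuousOn
  have hz1 : ‖z‖ ≤ 1 := by simpa using hz.1
  have hzi : 0 ≤ z i := hz.2
  have hfz : f z ≤ 0 := by
    rcases hzi.eq_or_lt with h0 | h0
    · simp only [hf, one_smul, coordRefl_apply, ← h0]
      simp
      positivity
    rcases hz1.eq_or_lt with h1 | h1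
    · have a1 := abs_le.1 (hA z hz1)
      have a2 := abs_le.1 (hA (coordRefl i z) (by rwa [norm_coordRefl]))
      have a3 : z i ≤ 1 := (le_abs_self _).trans ((abs_coord_le z i).trans hz1)
      have a4 : 0 ≤ c * (z i * (1 - z i)) := by
        have : 0 ≤ 1 - z i := by linarith
        positivity
      simp only [hf, one_smul, h1]
      nlinarith [a1.2, a2.1]
    · exfalso
      have hloc : IsLocalMax f z := by
        have hopen : IsOpen (ball (0 : Eu n) 1 ∩ {y | 0 < y i}) :=
          isOpen_ball.inter (isOpen_lt continuous_const s4.continuous)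
        have hmem : ball (0 : Eu n) 1 ∩ {y | 0 < y i} ∈ nhds z :=
          hopen.mem_nhds ⟨by simpa using h1, h0⟩
        filter_upwards [hmem] with y hy
        exact hmax ⟨ball_subset_closedBall hy.1, show 0 ≤ y i from le_of_lt hy.2⟩
      exact absurd (lapl_nonpos_of_isLocalMax hfs hloc) (not_le.2 (hlap z hz1))
  have hline : ∀ t : ℝ, 0 ≤ t → t ≤ 1 →
      u (x + t • bv i) - u (x + t • (-bv i)) ≤ 2 * A * t ^ 2 + c * t - c * t ^ 2 := by
    intro t h0 h1
    have hmem : t • bv i ∈ K := by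
      refine ⟨?_, ?_⟩
      · simp [norm_smul, abs_of_nonneg h0, h1]
      · simp [h0]
    have := (hmax hmem).trans hfz
    have hr : coordRefl i (t • bv i) = t • (-bv i) := by
      rw [coordRefl_apply, smul_neg, sub_eq_iff_eq_add, ← sub_eq_neg_add, ← sub_smul]
      congr 1
      simp
      ring
    simp only [hf, hr, one_smul, norm_smul, PiLp.smul_apply] at this
    simp at this
    simp only [smul_neg]
    linarith
  have hd := hu.differentiable (by simp)
  have d1 : HasDerivAt (fun t : ℝ => u (x + t • bv i)) (pd i u x) 0 := by
    simpa [Pi.single_apply] using hasDerivAt_comp_line hd x (bv i) 0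
  have d2 : HasDerivAt (fun t : ℝ => u (x + t • (-bv i))) (-pd i u x) 0 := by
    simpa [Pi.single_apply] using hasDerivAt_comp_line hd x (-bv i) 0
  have d3 := (d1.sub d2).tendsto_slope_zero_right
  have d4 : Filter.Tendsto (fun t : ℝ => 2 * A * t + c - c * t) (nhdsWithin 0 (Set.Ioi 0))
      (nhds c) := by
    have : Continuous (fun t : ℝ => 2 * A * t + c - c * t) := by fun_prop
    have h := this.tendsto 0
    simp only [mul_zero, zero_add, sub_zero] at h
    exact h.mono_left nhdsWithin_le_nhds
  have hle := le_of_tendsto_of_tendsto d3 d4 (by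
    have : Set.Ioc (0 : ℝ) 1 ∈ nhdsWithin 0 (Set.Ioi 0) := Ioc_mem_nhdsGT one_pos
    filter_upwards [this] with t ht
    have h := hline t ht.1.le ht.2
    simp only [Pi.sub_apply, zero_add, zero_smul, add_zero, sub_self, sub_zero, smul_eq_mul]
    rw [inv_mul_le_iff₀ ht.1]
    linarith)
  linarith

lemma abs_pd_le_of_bounded {n : ℕ} {u : Eu n → ℝ} (hu : ContDiff ℝ (⊤ : ℕ∞) u) (x : Eu n)
    {A F : ℝ} (hA : ∀ y, ‖y‖ ≤ 1 → |u (x + y)| ≤ A)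
    (hF : ∀ y, ‖y‖ ≤ 1 → |lapl u (x + y)| ≤ F) (i : Fin n) :
    |pd i u x| ≤ 2 * A * n + F + 1 := by
  refine abs_le'.2 ⟨pd_le_of_bounded hu x hA hF i, ?_⟩
  have h := pd_le_of_bounded (u := fun y => (-1) * u y) (contDiff_const.mul hu) x (A := A) (F := F)
    (fun y hy => by simpa using hA y hy)
    (fun y hy => by rw [lapl_const_mul hu]; simpa using hF y hy) i
  rw [pd_const_mul i (hu.differentiable (by simp) x)] at h
  linarith

/-- Polynomial growth of all derivatives up to order `k`. -/
def PolyUpTo {n : ℕ} : ℕ → (Eu n → ℝ) → Prop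
  | 0, f => Poly f
  | k + 1, f => Poly f ∧ ∀ i, PolyUpTo k (pd i f)

lemma PolyUpTo.of_succ {n k : ℕ} {f : Eu n → ℝ} (h : PolyUpTo (k + 1) f) : PolyUpTo k f := by
  induction k generalizing f with
  | zero => exact h.1
  | succ k ih => exact ⟨h.1, fun i => ih (h.2 i)⟩

lemma PolyUpTo.add {n k : ℕ} {f g : Eu n → ℝ} (hf : ContDiff ℝ (⊤ : ℕ∞) f)
    (hg : ContDiff ℝ (⊤ : ℕ∞) g) (h : PolyUpTo k f) (h' : PolyUpTo k g) :
    PolyUpTo k (fun y => f y + g y) := by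
  induction k generalizing f g with
  | zero => exact Poly.add h h'
  | succ k ih =>
    refine ⟨h.1.add h'.1, fun i => ?_⟩
    rw [show pd i (fun y => f y + g y) = fun y => pd i f y + pd i g y from funext fun y =>
      pd_add i (hf.differentiable (by simp) y) (hg.differentiable (by simp) y)]
    exact ih (contDiff_pd i hf) (contDiff_pd i hg) (h.2 i) (h'.2 i)

lemma PolyUpTo.mul {n k : ℕ} {f g : Eu n → ℝ} (hf : ContDiff ℝ (⊤ : ℕ∞) f)
    (hg : ContDiff ℝ (⊤ : ℕ∞) g) (h : PolyUpTo k f) (h' : PolyUpTo k g) :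
    PolyUpTo k (fun y => f y * g y) := by
  induction k generalizing f g with
  | zero => exact Poly.mul h h'
  | succ k ih =>
    refine ⟨h.1.mul h'.1, fun i => ?_⟩
    rw [show pd i (fun y => f y * g y) = fun y => pd i f y * g y + f y * pd i g y from
      funext fun y =>
      pd_mul i (hf.differentiable (by simp) y) (hg.differentiable (by simp) y)]
    exact PolyUpTo.add ((contDiff_pd i hf).mul hg) (hf.mul (contDiff_pd i hg))
      (ih (contDiff_pd i hf) hg (h.2 i) h'.of_succ) (ih hf (contDiff_pd i hg) h.of_succ (h'.2 i))

lemma Poly.exists_bound_shift {n : ℕ} {f : Eu n → ℝ} (hf : Poly f) :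
    ∃ C : ℝ, ∃ k : ℕ, 0 < C ∧ ∀ x y, ‖y‖ ≤ 1 → |f (x + y)| ≤ C * (1 + ‖x‖) ^ k := by
  obtain ⟨C, hC, k, h⟩ := hf.exists_pos
  refine ⟨C * 2 ^ k, k, by positivity, fun x y hy => (h _).trans ?_⟩
  have h1 : 1 + ‖x + y‖ ≤ 2 * (1 + ‖x‖) := by linarith [norm_add_le x y, norm_nonneg x]
  rw [mul_assoc, ← mul_pow]
  gcongr

lemma poly_pd_of_poly_lapl {n : ℕ} {f : Eu n → ℝ} (hf : ContDiff ℝ (⊤ : ℕ∞) f) (h : Poly f)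
    (h' : Poly (lapl f)) (i : Fin n) : Poly (pd i f) := by
  obtain ⟨C, k, hC, hb⟩ := h.exists_bound_shift
  obtain ⟨D, l, hD, hb'⟩ := h'.exists_bound_shift
  refine ⟨2 * C * n + D + 1, k + l, fun x => ?_⟩
  refine (abs_pd_le_of_bounded hf x (fun y hy => hb x y hy) (fun y hy => hb' x y hy) i).trans ?_
  have h1 : (1 : ℝ) ≤ 1 + ‖x‖ := by linarith [norm_nonneg x]
  have e1 : (1 + ‖x‖) ^ k ≤ (1 + ‖x‖) ^ (k + l) := pow_le_pow_right₀ h1 (by omega)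
  have e2 : (1 + ‖x‖) ^ l ≤ (1 + ‖x‖) ^ (k + l) := pow_le_pow_right₀ h1 (by omega)
  have e3 : 1 ≤ (1 + ‖x‖) ^ (k + l) := one_le_pow₀ h1
  calc 2 * (C * (1 + ‖x‖) ^ k) * n + D * (1 + ‖x‖) ^ l + 1
      = 2 * C * n * (1 + ‖x‖) ^ k + D * (1 + ‖x‖) ^ l + 1 := by ring
    _ ≤ 2 * C * n * (1 + ‖x‖) ^ (k + l) + D * (1 + ‖x‖) ^ (k + l) + (1 + ‖x‖) ^ (k + l) := by
      gcongr
    _ = _ := by ring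

lemma pd_lapl {n : ℕ} (i : Fin n) {f : Eu n → ℝ} (hf : ContDiff ℝ (⊤ : ℕ∞) f) (y : Eu n) :
    pd i (lapl f) y = lapl (pd i f) y := by
  unfold lapl
  rw [pd_sum i fun j _ => (contDiff_pd j (contDiff_pd j hf)).differentiable (by simp) y]
  refine Finset.sum_congr rfl fun j _ => ?_
  rw [pd_comm i j (contDiff_pd j hf), show pd i (pd j f) = pd j (pd i f) from
    funext fun y => pd_comm i j hf y]

lemma PolyUpTo.succ_of_lapl {n k : ℕ} {f : Eu n → ℝ} (hf : ContDiff ℝ (⊤ : ℕ∞) f)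
    (h : PolyUpTo k f) (h' : PolyUpTo k (lapl f)) : PolyUpTo (k + 1) f := by
  induction k generalizing f with
  | zero => exact ⟨h, fun i => poly_pd_of_poly_lapl hf h h' i⟩
  | succ k ih =>
    refine ⟨h.1, fun i => ih (contDiff_pd i hf) (h.2 i) ?_⟩
    rw [show lapl (pd i f) = pd i (lapl f) from funext fun y => (pd_lapl i hf y).symm]
    exact h'.2 i

lemma fderiv_eq_sum_pd {n : ℕ} (f : Eu n → ℝ) :
    fderiv ℝ f = fun y => ∑ i, (ContinuousLinearMap.toSpanSingleton ℝ
      (EuclideanSpace.proj i : Eu n →L[ℝ] ℝ)) (pd i f y) := by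
  ext y h
  rw [hasFDerivAt_sum_pd]
  simp [mul_comm]

lemma PolyUpTo.iteratedFDeriv {n k : ℕ} {f : Eu n → ℝ} (hf : ContDiff ℝ (⊤ : ℕ∞) f)
    (h : PolyUpTo k f) : Poly (fun y => ‖iteratedFDeriv ℝ k f y‖) := by
  induction k generalizing f with
  | zero => exact Poly.mono h fun y => by simp
  | succ k ih =>
    have hc : ∀ i, ContDiff ℝ k (pd i f) := fun i => (contDiff_pd i hf).of_le (by
      exact_mod_cast le_top)
    have hsum : Poly (fun y => ∑ i, ‖ContinuousLinearMap.toSpanSingleton ℝ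
        (EuclideanSpace.proj i : Eu n →L[ℝ] ℝ)‖ * ‖_root_.iteratedFDeriv ℝ k (pd i f) y‖) :=
      Poly.sum fun i _ => (ih (contDiff_pd i hf) (h.2 i)).const_mul _
    refine hsum.mono fun y => ?_
    rw [abs_of_nonneg (norm_nonneg _), abs_of_nonneg (by positivity), ← norm_iteratedFDeriv_fderiv,
      fderiv_eq_sum_pd, iteratedFDeriv_sum (f := fun i y => (ContinuousLinearMap.toSpanSingleton ℝ
        (EuclideanSpace.proj i : Eu n →L[ℝ] ℝ)) (pd i f y)) fun i _ =>
        (ContinuousLinearMap.contDiff _).comp (hc i), Finset.sum_apply]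
    refine (norm_sum_le _ _).trans (Finset.sum_le_sum fun i _ => ?_)
    exact ContinuousLinearMap.norm_iteratedFDeriv_comp_left _ (hc i).contDiffAt le_rfl

lemma hasTemperateGrowth_of_polyUpTo {n : ℕ} {f : Eu n → ℝ} (hf : ContDiff ℝ (⊤ : ℕ∞) f)
    (h : ∀ k, PolyUpTo k f) : f.HasTemperateGrowth := by
  refine ⟨hf, fun k => ?_⟩
  obtain ⟨C, l, hC⟩ := (h k).iteratedFDeriv hf
  exact ⟨l, C, fun x => by simpa using hC x⟩

/-- Solutions of the system with polynomial growth have polynomially growing derivatives. -/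
theorem hasTemperateGrowth_of_system {n : ℕ} {u v : Eu n → ℝ} (hu : ContDiff ℝ (⊤ : ℕ∞) u)
    (hv : ContDiff ℝ (⊤ : ℕ∞) v) (hpu : Poly u) (hpv : Poly v)
    (h1 : ∀ y, lapl u y = u y * v y ^ 2) (h2 : ∀ y, lapl v y = v y * u y ^ 2) :
    u.HasTemperateGrowth ∧ v.HasTemperateGrowth := by
  have key : ∀ k, PolyUpTo k u ∧ PolyUpTo k v := by
    intro k
    induction k with
    | zero => exact ⟨hpu, hpv⟩
    | succ k ih =>
      refine ⟨PolyUpTo.succ_of_lapl hu ih.1 ?_, PolyUpTo.succ_of_lapl hv ih.2 ?_⟩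
      · rw [show lapl u = fun y => u y * (v y * v y) from funext fun y => by rw [h1]; ring]
        exact ih.1.mul hu (hv.mul hv) (ih.2.mul hv hv ih.2)
      · rw [show lapl v = fun y => v y * (u y * u y) from funext fun y => by rw [h2]; ring]
        exact ih.2.mul hv (hu.mul hu) (ih.1.mul hu hu ih.1)
  exact ⟨hasTemperateGrowth_of_polyUpTo hu fun k => (key k).1,
    hasTemperateGrowth_of_polyUpTo hv fun k => (key k).2⟩

/-- Polynomial growth on the product space. -/
def Poly2 {n : ℕ} (f : Eu n × Eu n → ℝ) : Prop :=
  ∃ C : ℝ, ∃ k : ℕ, ∀ p, |f p| ≤ C * ((1 + ‖p.1‖) ^ k * (1 + ‖p.2‖) ^ k)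

/-- The product of two standard Gaussian measures. -/
abbrev gm2 (n : ℕ) : Measure (Eu n × Eu n) := (gm n).prod (gm n)

lemma integrable_bound2 (n k : ℕ) (C : ℝ) :
    Integrable (fun p : Eu n × Eu n => C * ((1 + ‖p.1‖) ^ k * (1 + ‖p.2‖) ^ k)) (gm2 n) :=
  ((integrable_one_add_norm_pow n k).mul_prod (integrable_one_add_norm_pow n k)).const_mul C

lemma Poly2.integrable {n : ℕ} {f : Eu n × Eu n → ℝ} (hf : Poly2 f) (hm : Measurable f) :
    Integrable f (gm2 n) := by
  obtain ⟨C, k, h⟩ := hf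
  exact (integrable_bound2 n k C).mono' hm.aestronglyMeasurable (Filter.Eventually.of_forall h)

lemma one_add_norm_comb_le {n : ℕ} {a b : ℝ} (ha : |a| ≤ 1) (hb : |b| ≤ 1) (x y : Eu n) :
    1 + ‖a • x + b • y‖ ≤ (1 + ‖x‖) * (1 + ‖y‖) := by
  have h := norm_add_le (a • x) (b • y)
  rw [norm_smul, norm_smul, Real.norm_eq_abs, Real.norm_eq_abs] at h
  nlinarith [norm_nonneg x, norm_nonneg y, mul_nonneg (norm_nonneg x) (norm_nonneg y),
    mul_nonneg (sub_nonneg.2 ha) (norm_nonneg x), mul_nonneg (sub_nonneg.2 hb) (norm_nonneg y)]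

lemma Poly.comb {n : ℕ} {f : Eu n → ℝ} (hf : Poly f) {a b : ℝ} (ha : |a| ≤ 1) (hb : |b| ≤ 1) :
    Poly2 (fun p => f (a • p.1 + b • p.2)) := by
  obtain ⟨C, hC, k, h⟩ := hf.exists_pos
  refine ⟨C, k, fun p => (h _).trans ?_⟩
  rw [← mul_pow]
  gcongr
  exact one_add_norm_comb_le ha hb _ _

lemma Poly.fst {n : ℕ} {f : Eu n → ℝ} (hf : Poly f) : Poly2 (fun p => f p.1) := by
  simpa using hf.comb (a := 1) (b := 0) (by simp) (by simp)

lemma Poly.snd {n : ℕ} {f : Eu n → ℝ} (hf : Poly f) : Poly2 (fun p => f p.2) := by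
  simpa using hf.comb (a := 0) (b := 1) (by simp) (by simp)

lemma Poly2.exists_pos {n : ℕ} {f : Eu n × Eu n → ℝ} (hf : Poly2 f) :
    ∃ C : ℝ, 0 < C ∧ ∃ k : ℕ, ∀ p, |f p| ≤ C * ((1 + ‖p.1‖) ^ k * (1 + ‖p.2‖) ^ k) := by
  obtain ⟨C, k, h⟩ := hf
  refine ⟨max C 1, by positivity, k, fun y => (h y).trans ?_⟩
  gcongr
  exact le_max_left _ _

lemma Poly2.mul {n : ℕ} {f g : Eu n × Eu n → ℝ} (hf : Poly2 f) (hg : Poly2 g) :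
    Poly2 (fun p => f p * g p) := by
  obtain ⟨C, hC, k, h⟩ := hf.exists_pos
  obtain ⟨D, hD, l, h'⟩ := hg.exists_pos
  refine ⟨C * D, k + l, fun p => ?_⟩
  rw [abs_mul]
  calc |f p| * |g p| ≤ (C * ((1 + ‖p.1‖) ^ k * (1 + ‖p.2‖) ^ k)) *
        (D * ((1 + ‖p.1‖) ^ l * (1 + ‖p.2‖) ^ l)) :=
        mul_le_mul (h p) (h' p) (abs_nonneg _) (by positivity)
    _ = _ := by ring

lemma Poly2.add {n : ℕ} {f g : Eu n × Eu n → ℝ} (hf : Poly2 f) (hg : Poly2 g) :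
    Poly2 (fun p => f p + g p) := by
  obtain ⟨C, hC, k, h⟩ := hf.exists_pos
  obtain ⟨D, hD, l, h'⟩ := hg.exists_pos
  refine ⟨C + D, k + l, fun p => ?_⟩
  have h1 : (1:ℝ) ≤ 1 + ‖p.1‖ := by linarith [norm_nonneg p.1]
  have h2 : (1:ℝ) ≤ 1 + ‖p.2‖ := by linarith [norm_nonneg p.2]
  calc |f p + g p| ≤ |f p| + |g p| := abs_add_le _ _
    _ ≤ C * ((1 + ‖p.1‖) ^ k * (1 + ‖p.2‖) ^ k) + D * ((1 + ‖p.1‖) ^ l * (1 + ‖p.2‖) ^ l) :=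
      add_le_add (h p) (h' p)
    _ ≤ C * ((1 + ‖p.1‖) ^ (k + l) * (1 + ‖p.2‖) ^ (k + l)) +
        D * ((1 + ‖p.1‖) ^ (k + l) * (1 + ‖p.2‖) ^ (k + l)) := by
      gcongr <;> first | assumption | omega
    _ = _ := by ring

lemma Poly2.const_mul {n : ℕ} {f : Eu n × Eu n → ℝ} (hf : Poly2 f) (c : ℝ) :
    Poly2 (fun p => c * f p) := by
  obtain ⟨C, k, h⟩ := hf
  refine ⟨|c| * C, k, fun p => ?_⟩
  rw [abs_mul, mul_assoc]
  exact mul_le_mul_of_nonneg_left (h p) (abs_nonneg _)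

lemma Poly2.sub {n : ℕ} {f g : Eu n × Eu n → ℝ} (hf : Poly2 f) (hg : Poly2 g) :
    Poly2 (fun p => f p - g p) := by
  simpa [sub_eq_add_neg] using hf.add (hg.const_mul (-1))

/-- Rotation invariance of the product Gaussian measure. -/
lemma integral_rotation {n : ℕ} (θ : ℝ) {F : Eu n × Eu n → ℝ} (hF : Measurable F) :
    ∫ p, F (Real.cos θ • p.1 + Real.sin θ • p.2, -Real.sin θ • p.1 + Real.cos θ • p.2) ∂(gm2 n)
      = ∫ p, F p ∂(gm2 n) := by
  have h : (gm2 n).map (ContinuousLinearMap.rotation θ) = gm2 n :=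
    IsGaussian.map_rotation_eq_self_of_forall_strongDual_eq_zero (μ := gm n)
      (fun L => integral_strongDual_stdGaussian L) θ
  conv_rhs => rw [← h]
  rw [integral_map (by fun_prop) hF.aestronglyMeasurable]
  rfl

lemma integral_gm2_fst {n : ℕ} (f : Eu n → ℝ) : ∫ p, f p.1 ∂(gm2 n) = ∫ y, f y ∂(gm n) := by
  simpa using integral_fun_fst (μ := gm n) (ν := gm n) f

/-- The Ornstein-Uhlenbeck correlation `𝔼 f(X) f(X cos θ + Y sin θ)`. -/
def ouCorr {n : ℕ} (f : Eu n → ℝ) (θ : ℝ) : ℝ :=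
  ∫ p, f p.1 * f (Real.cos θ • p.1 + Real.sin θ • p.2) ∂(gm2 n)

lemma ouCorr_zero {n : ℕ} (f : Eu n → ℝ) : ouCorr f 0 = ∫ y, f y ^ 2 ∂(gm n) := by
  simp only [ouCorr, Real.cos_zero, Real.sin_zero, one_smul, zero_smul, add_zero]
  rw [← integral_gm2_fst]
  simp only [pow_two]

lemma ouCorr_pi_div_two {n : ℕ} (f : Eu n → ℝ) :
    ouCorr f (Real.pi / 2) = (∫ y, f y ∂(gm n)) ^ 2 := by
  simp only [ouCorr, Real.cos_pi_div_two, Real.sin_pi_div_two, one_smul, zero_smul, zero_add]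
  rw [integral_prod_mul, pow_two]

lemma integral_sq_sub_rotation {n : ℕ} {f : Eu n → ℝ} (hf : Poly f) (hm : Measurable f) (θ : ℝ) :
    ∫ p, (f p.1 - f (Real.cos θ • p.1 + Real.sin θ • p.2)) ^ 2 ∂(gm2 n)
      = 2 * (∫ y, f y ^ 2 ∂(gm n) - ouCorr f θ) := by
  have hc := Real.abs_cos_le_one θ
  have hs := Real.abs_sin_le_one θ
  have i1 : Integrable (fun p : Eu n × Eu n => f p.1 ^ 2) (gm2 n) :=
    (hf.pow 2).fst.integrable (by fun_prop)
  have i2 : Integrable (fun p : Eu n × Eu n => f (Real.cos θ • p.1 + Real.sin θ • p.2) ^ 2) (gm2 n) :=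
    ((hf.pow 2).comb hc hs).integrable (by fun_prop)
  have i3 : Integrable (fun p : Eu n × Eu n => f p.1 * f (Real.cos θ • p.1 + Real.sin θ • p.2))
    (gm2 n) := (hf.fst.mul (hf.comb hc hs)).integrable (by fun_prop)
  have e1 := integral_gm2_fst (n := n) (fun y => f y ^ 2)
  have e2 := integral_rotation (n := n) θ (F := fun p => f p.1 ^ 2) (by fun_prop)
  simp only at e2
  calc _ = ∫ p, ((f p.1 ^ 2 + f (Real.cos θ • p.1 + Real.sin θ • p.2) ^ 2) -
        2 * (f p.1 * f (Real.cos θ • p.1 + Real.sin θ • p.2))) ∂(gm2 n) := by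
        congr 1; ext p; ring
    _ = _ := by
      have i12 : Integrable (fun p : Eu n × Eu n =>
        f p.1 ^ 2 + f (Real.cos θ • p.1 + Real.sin θ • p.2) ^ 2) (gm2 n) := i1.add i2
      rw [integral_sub i12 (i3.const_mul 2), integral_add i1 i2, integral_const_mul, e2, e1,
        ouCorr]
      ring

lemma variance_le_ouCorr_add {n : ℕ} {f : Eu n → ℝ} (hf : Poly f) (hm : Measurable f) (θ : ℝ) :
    ∫ y, f y ^ 2 ∂(gm n) - (∫ y, f y ∂(gm n)) ^ 2 ≤
      2 * (∫ y, f y ^ 2 ∂(gm n) - ouCorr f θ) +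
      2 * (∫ y, f y ^ 2 ∂(gm n) - ouCorr f (Real.pi / 2 - θ)) := by
  have hc := Real.abs_cos_le_one θ
  have hs := Real.abs_sin_le_one θ
  have h1 := integral_sq_sub_rotation hf hm (Real.pi / 2)
  have h2 := integral_sq_sub_rotation hf hm θ
  have h3 := integral_sq_sub_rotation hf hm (Real.pi / 2 - θ)
  rw [ouCorr_pi_div_two] at h1
  simp only [Real.cos_pi_div_two, Real.sin_pi_div_two, one_smul, zero_smul, zero_add] at h1
  simp only [Real.cos_pi_div_two_sub, Real.sin_pi_div_two_sub] at h3
  have h4 := integral_rotation (n := n) θ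
    (F := fun p => (f p.1 - f (Real.sin θ • p.1 + Real.cos θ • p.2)) ^ 2) (by fun_prop)
  have h5 : ∀ p : Eu n × Eu n, Real.sin θ • (Real.cos θ • p.1 + Real.sin θ • p.2) +
      Real.cos θ • (-Real.sin θ • p.1 + Real.cos θ • p.2) = p.2 := by
    intro p
    have : (Real.sin θ * Real.sin θ + Real.cos θ * Real.cos θ) = 1 := by
      nlinarith [Real.sin_sq_add_cos_sq θ]
    calc _ = (Real.sin θ * Real.sin θ + Real.cos θ * Real.cos θ) • p.2 := by module
      _ = p.2 := by rw [this, one_smul]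
  simp only [h5] at h4
  rw [h3] at h4
  have hcomb := hf.comb hc hs
  have i2 : Integrable (fun p : Eu n × Eu n =>
      (f p.1 - f (Real.cos θ • p.1 + Real.sin θ • p.2)) ^ 2) (gm2 n) := by
    simp only [pow_two]
    exact ((hf.fst.sub hcomb).mul (hf.fst.sub hcomb)).integrable (by fun_prop)
  have i3 : Integrable (fun p : Eu n × Eu n =>
      (f (Real.cos θ • p.1 + Real.sin θ • p.2) - f p.2) ^ 2) (gm2 n) := by
    simp only [pow_two]
    exact ((hcomb.sub hf.snd).mul (hcomb.sub hf.snd)).integrable (by fun_prop)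
  have i1 : Integrable (fun p : Eu n × Eu n => (f p.1 - f p.2) ^ 2) (gm2 n) := by
    simp only [pow_two]
    exact ((hf.fst.sub hf.snd).mul (hf.fst.sub hf.snd)).integrable (by fun_prop)
  have hle : ∫ p, (f p.1 - f p.2) ^ 2 ∂(gm2 n) ≤
      ∫ p, (2 * (f p.1 - f (Real.cos θ • p.1 + Real.sin θ • p.2)) ^ 2 +
        2 * (f (Real.cos θ • p.1 + Real.sin θ • p.2) - f p.2) ^ 2) ∂(gm2 n) := by
    refine integral_mono i1 ((i2.const_mul 2).add (i3.const_mul 2)) fun p => ?_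
    simp only
    nlinarith [sq_nonneg ((f p.1 - f (Real.cos θ • p.1 + Real.sin θ • p.2)) -
      (f (Real.cos θ • p.1 + Real.sin θ • p.2) - f p.2))]
  rw [integral_add (i2.const_mul 2) (i3.const_mul 2), integral_const_mul, integral_const_mul, h1,
    h2, h4] at hle
  linarith

lemma measurable_pd {n : ℕ} (i : Fin n) (f : Eu n → ℝ) : Measurable (pd i f) :=
  measurable_fderiv_apply_const ℝ f _

lemma variance_nonneg' {n : ℕ} {f : Eu n → ℝ} (hf : Poly f) (hm : Measurable f) :
    (∫ y, f y ∂(gm n)) ^ 2 ≤ ∫ y, f y ^ 2 ∂(gm n) := by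
  have h1 := integral_sq_sub_rotation hf hm (Real.pi / 2)
  rw [ouCorr_pi_div_two] at h1
  have : 0 ≤ ∫ p, (f p.1 - f (Real.cos (Real.pi / 2) • p.1 + Real.sin (Real.pi / 2) • p.2)) ^ 2
    ∂(gm2 n) := integral_nonneg fun p => sq_nonneg _
  linarith

/-- Derivative of the correlation along rotations. -/
lemma hasDerivAt_ouCorr {n : ℕ} {h : Eu n → ℝ} (hd : Differentiable ℝ h) (hp : Poly h)
    (hp' : ∀ i, Poly (pd i h)) (θ : ℝ) :
    HasDerivAt (ouCorr h) (-Real.sin θ * ∑ i, ouCorr (pd i h) θ) θ := by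
  have hmh : Measurable h := hd.continuous.measurable
  have hmpd : ∀ i, Measurable (pd i h) := fun i => measurable_pd i h
  have hnorm : ∀ (θ : ℝ) (i : Fin n) (p : Eu n × Eu n),
      |(-Real.sin θ • p.1 + Real.cos θ • p.2) i| ≤ (1 + ‖p.1‖) * (1 + ‖p.2‖) := by
    intro θ i p
    have h1 := one_add_norm_comb_le (a := -Real.sin θ) (b := Real.cos θ)
      (by rw [abs_neg]; exact Real.abs_sin_le_one θ) (Real.abs_cos_le_one θ) p.1 p.2
    exact (abs_coord_le _ i).trans (by linarith)
  set F' : ℝ → Eu n × Eu n → ℝ := fun θ p => h p.1 * ∑ i, (-Real.sin θ • p.1 + Real.cos θ • p.2) i *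
    pd i h (Real.cos θ • p.1 + Real.sin θ • p.2) with hF'
  obtain ⟨C, hC, k, hb⟩ := hp.exists_pos
  have hsum : Poly (fun y => ∑ i, |pd i h y|) :=
    Poly.sum fun i _ => (hp' i).mono fun y => by simp
  obtain ⟨D, hD, l, hb'⟩ := hsum.exists_pos
  have hbound : ∀ (θ : ℝ) (p : Eu n × Eu n),
      |F' θ p| ≤ C * D * ((1 + ‖p.1‖) ^ (k + l + 1) * (1 + ‖p.2‖) ^ (k + l + 1)) := by
    intro θ p
    have a1 : (1 : ℝ) ≤ 1 + ‖p.1‖ := by linarith [norm_nonneg p.1]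
    have a2 : (1 : ℝ) ≤ 1 + ‖p.2‖ := by linarith [norm_nonneg p.2]
    have h1 : |∑ i, (-Real.sin θ • p.1 + Real.cos θ • p.2) i *
        pd i h (Real.cos θ • p.1 + Real.sin θ • p.2)| ≤
        ((1 + ‖p.1‖) * (1 + ‖p.2‖)) * (D * ((1 + ‖p.1‖) * (1 + ‖p.2‖)) ^ l) := by
      refine (Finset.abs_sum_le_sum_abs _ _).trans ?_
      calc _ ≤ ∑ i, ((1 + ‖p.1‖) * (1 + ‖p.2‖)) *
            |pd i h (Real.cos θ • p.1 + Real.sin θ • p.2)| := by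
            refine Finset.sum_le_sum fun i _ => ?_
            rw [abs_mul]
            exact mul_le_mul_of_nonneg_right (hnorm θ i p) (abs_nonneg _)
        _ = ((1 + ‖p.1‖) * (1 + ‖p.2‖)) * ∑ i,
            |pd i h (Real.cos θ • p.1 + Real.sin θ • p.2)| := by rw [Finset.mul_sum]
        _ ≤ _ := by
          gcongr
          refine ((le_abs_self _).trans (hb' _)).trans ?_
          gcongr
          exact one_add_norm_comb_le (Real.abs_cos_le_one θ) (Real.abs_sin_le_one θ) _ _
    rw [hF', abs_mul]
    calc _ ≤ (C * (1 + ‖p.1‖) ^ k) *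
          (((1 + ‖p.1‖) * (1 + ‖p.2‖)) * (D * ((1 + ‖p.1‖) * (1 + ‖p.2‖)) ^ l)) :=
          mul_le_mul (hb _) h1 (abs_nonneg _) (by positivity)
      _ = C * D * ((1 + ‖p.1‖) ^ (k + l + 1) * (1 + ‖p.2‖) ^ (l + 1)) := by
        rw [mul_pow]; ring
      _ ≤ _ := by
        gcongr
        omega
  have hmeas : ∀ θ, Measurable (F' θ) := by
    intro θ
    refine (hmh.comp measurable_fst).mul (Finset.measurable_sum _ fun i _ => ?_)
    refine Measurable.mul ?_ ((hmpd i).comp (by fun_prop))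
    have : Continuous (fun p : Eu n × Eu n => (-Real.sin θ • p.1 + Real.cos θ • p.2) i) := by
      fun_prop
    exact this.measurable
  have hder : HasDerivAt (ouCorr h) (∫ p, F' θ p ∂(gm2 n)) θ := by
    refine (hasDerivAt_integral_of_dominated_loc_of_deriv_le (s := Set.univ) Filter.univ_mem
      (F := fun θ (p : Eu n × Eu n) => h p.1 * h (Real.cos θ • p.1 + Real.sin θ • p.2)) (F' := F')
      (bound := fun p => C * D * ((1 + ‖p.1‖) ^ (k + l + 1) * (1 + ‖p.2‖) ^ (k + l + 1)))
      (Filter.Eventually.of_forall fun θ => ?_) ?_ (hmeas θ).aestronglyMeasurable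
      (Filter.Eventually.of_forall fun p θ _ => hbound θ p) (integrable_bound2 _ _ _)
      (Filter.Eventually.of_forall fun p θ _ => ?_)).2
    · exact Measurable.aestronglyMeasurable (by fun_prop)
    · exact (hp.fst.mul (hp.comb (Real.abs_cos_le_one θ) (Real.abs_sin_le_one θ))).integrable
        (by fun_prop)
    · refine HasDerivAt.const_mul _ ?_
      rw [← hasFDerivAt_sum_pd]
      have h2 : HasDerivAt (fun θ : ℝ => Real.cos θ • p.1 + Real.sin θ • p.2)
          (-Real.sin θ • p.1 + Real.cos θ • p.2) θ :=
        ((Real.hasDerivAt_cos θ).smul_const p.1).add ((Real.hasDerivAt_sin θ).smul_const p.2)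
      exact (hd _).hasFDerivAt.comp_hasDerivAt θ h2
  convert hder using 1
  set c := Real.cos θ with hc
  set s := Real.sin θ with hs
  have hc1 : |c| ≤ 1 := Real.abs_cos_le_one θ
  have hs1 : |-s| ≤ 1 := by rw [abs_neg]; exact Real.abs_sin_le_one θ
  have hinv : ∀ p : Eu n × Eu n, c • (c • p.1 + s • p.2) + (-s) • (-s • p.1 + c • p.2) = p.1 := by
    intro p
    have : c * c + s * s = 1 := by nlinarith [Real.sin_sq_add_cos_sq θ]
    calc _ = (c * c + s * s) • p.1 := by module
      _ = p.1 := by rw [this, one_smul]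
  have hmc : ∀ i : Fin n, Measurable (fun p : Eu n × Eu n => p.2 i) := fun i => by
    have : Continuous (fun p : Eu n × Eu n => p.2 i) := by fun_prop
    exact this.measurable
  have r1 := integral_rotation (n := n) θ
    (F := fun p => h (c • p.1 + (-s) • p.2) * ∑ i, p.2 i * pd i h p.1)
    ((hmh.comp (by fun_prop)).mul (Finset.measurable_sum _ fun i _ =>
      (hmc i).mul ((hmpd i).comp measurable_fst)))
  simp only [← hc, ← hs, hinv] at r1
  have r2 : ∀ i, ouCorr (pd i h) θ = ∫ p, pd i h p.1 * pd i h (c • p.1 + (-s) • p.2) ∂(gm2 n) := by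
    intro i
    have r2 := integral_rotation (n := n) θ
      (F := fun p => pd i h p.1 * pd i h (c • p.1 + (-s) • p.2))
      (((hmpd i).comp measurable_fst).mul ((hmpd i).comp (by fun_prop)))
    simp only [← hc, ← hs, hinv] at r2
    rw [← r2, ouCorr]
    congr 1; ext p; ring
  rw [hF']
  rw [r1]
  simp_rw [Finset.mul_sum]
  rw [integral_finsetSum]
  · refine Finset.sum_congr rfl fun i _ => ?_
    rw [r2, ← integral_const_mul, integral_prod, integral_prod]
    · congr 1; ext x
      have hst := stein i (f := fun z => h (c • x + (-s) • z)) (by fun_prop) ?_ ?_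
      · simp only [pd_comp_affine i hd] at hst
        have e1 : ∀ z : Eu n, -s * (pd i h x * pd i h (c • x + (-s) • z)) =
          pd i h x * (-s * pd i h (c • x + (-s) • z)) := fun z => by ring
        have e2 : ∀ z : Eu n, h (c • x + (-s) • z) * (z i * pd i h x) =
          pd i h x * (z i * h (c • x + (-s) • z)) := fun z => by ring
        simp only [e1, e2]
        rw [integral_const_mul, integral_const_mul (pd i h x), hst]
      · obtain ⟨C', k', h'⟩ := hp.comb hc1 hs1
        exact ⟨C' * (1 + ‖x‖) ^ k', k', fun y => (h' (x, y)).trans (by rw [mul_assoc])⟩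
      · obtain ⟨C', k', h'⟩ := ((hp' i).comb hc1 hs1).const_mul (-s)
        exact ⟨C' * (1 + ‖x‖) ^ k', k', fun y => by
          rw [pd_comp_affine i hd]
          exact (h' (x, y)).trans (by rw [mul_assoc])⟩
    · exact ((hp.comb hc1 hs1).mul ((Poly.coord i).snd.mul (hp' i).fst)).integrable
        ((hmh.comp (by fun_prop)).mul ((hmc i).mul ((hmpd i).comp measurable_fst)))
    · exact (((hp' i).fst.mul ((hp' i).comb hc1 hs1)).const_mul _).integrable
        ((((hmpd i).comp measurable_fst).mul ((hmpd i).comp (by fun_prop))).const_mul _)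
  · intro i _
    exact ((hp.comb hc1 hs1).mul ((Poly.coord i).snd.mul (hp' i).fst)).integrable
      ((hmh.comp (by fun_prop)).mul ((hmc i).mul ((hmpd i).comp measurable_fst)))

lemma ouCorr_le {n : ℕ} {f : Eu n → ℝ} (hf : Poly f) (hm : Measurable f) (θ : ℝ) :
    ouCorr f θ ≤ ∫ y, f y ^ 2 ∂(gm n) := by
  have h1 := integral_sq_sub_rotation hf hm θ
  have : 0 ≤ ∫ p, (f p.1 - f (Real.cos θ • p.1 + Real.sin θ • p.2)) ^ 2 ∂(gm2 n) :=
    integral_nonneg fun p => sq_nonneg _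
  linarith

/-- Quantitative Gaussian Poincaré inequality: the deficit controls the variance of the gradient. -/
theorem variance_gradient_le {n : ℕ} {h : Eu n → ℝ} (hd : Differentiable ℝ h) (hp : Poly h)
    (hp' : ∀ i, Poly (pd i h)) :
    ∑ i, ∫ y, pd i h y ^ 2 ∂(gm n) - ∑ i, (∫ y, pd i h y ∂(gm n)) ^ 2 ≤
      7 * (∑ i, ∫ y, pd i h y ^ 2 ∂(gm n) -
        (∫ y, h y ^ 2 ∂(gm n) - (∫ y, h y ∂(gm n)) ^ 2)) := by
  set V := ∑ i, ∫ y, pd i h y ^ 2 ∂(gm n) with hV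
  set B := ∑ i, (∫ y, pd i h y ∂(gm n)) ^ 2 with hB
  set A : ℝ → ℝ := fun θ => ∑ i, ouCorr (pd i h) θ with hA
  have hAV : ∀ θ, A θ ≤ V := fun θ =>
    Finset.sum_le_sum fun i _ => ouCorr_le (hp' i) (measurable_pd i h) θ
  have hvar : ∀ θ, V - B ≤ 2 * (V - A θ) + 2 * (V - A (Real.pi / 2 - θ)) := by
    intro θ
    rw [hV, hB, hA]
    simp only [← Finset.sum_sub_distrib, Finset.mul_sum, ← Finset.sum_add_distrib]
    exact Finset.sum_le_sum fun i _ => variance_le_ouCorr_add (hp' i) (measurable_pd i h) θ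
  have hBV : B ≤ V := Finset.sum_le_sum fun i _ => variance_nonneg' (hp' i) (measurable_pd i h)
  set K : ℝ → ℝ := fun θ => ouCorr h θ - ouCorr h (Real.pi / 2 - θ) +
    V * (Real.sin θ - Real.cos θ) + (V - B) / 2 * Real.cos θ with hK
  have hK' : ∀ θ, HasDerivAt K (-Real.sin θ * A θ - Real.cos θ * A (Real.pi / 2 - θ) +
      V * (Real.cos θ + Real.sin θ) - (V - B) / 2 * Real.sin θ) θ := by
    intro θ
    have h1 := hasDerivAt_ouCorr hd hp hp' θ
    have h2 := (hasDerivAt_ouCorr hd hp hp' (Real.pi / 2 - θ)).comp θ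
      ((hasDerivAt_id θ).const_sub (Real.pi / 2))
    have h3 := (((h1.sub h2).add
      (((Real.hasDerivAt_sin θ).sub (Real.hasDerivAt_cos θ)).const_mul V)).add
      ((Real.hasDerivAt_cos θ).const_mul ((V - B) / 2)))
    refine h3.congr_deriv ?_
    rw [Real.sin_pi_div_two_sub]
    simp only [hA]
    ring
  have hmono : MonotoneOn K (Set.Icc 0 (Real.pi / 4)) := by
    refine monotoneOn_of_deriv_nonneg (convex_Icc _ _)
      (fun θ _ => (hK' θ).continuousAt.continuousWithinAt)
      (fun θ _ => (hK' θ).differentiableAt.differentiableWithinAt) fun θ hθ => ?_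
    rw [interior_Icc] at hθ
    rw [(hK' θ).deriv]
    have hpi := Real.pi_pos
    have hs : 0 ≤ Real.sin θ := Real.sin_nonneg_of_nonneg_of_le_pi hθ.1.le (by linarith [hθ.2])
    have hsc : Real.sin θ ≤ Real.cos θ := by
      rw [← Real.sin_pi_div_two_sub]
      exact Real.sin_le_sin_of_le_of_le_pi_div_two (by linarith [hθ.1]) (by linarith [hθ.1])
        (by linarith [hθ.2])
    nlinarith [mul_nonneg hs (sub_nonneg.2 (hvar θ)),
      mul_nonneg (sub_nonneg.2 hsc) (sub_nonneg.2 (hAV (Real.pi / 2 - θ)))]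
  have hpi := Real.pi_pos
  have h04 := hmono (Set.left_mem_Icc.2 (by positivity)) (Set.right_mem_Icc.2 (by positivity))
    (by positivity : (0:ℝ) ≤ Real.pi / 4)
  have e : Real.pi / 2 - Real.pi / 4 = Real.pi / 4 := by ring
  simp only [hK, ouCorr_zero, sub_zero, ouCorr_pi_div_two, Real.sin_zero, Real.cos_zero, e,
    Real.sin_pi_div_four, Real.cos_pi_div_four, sub_self, mul_one, zero_sub] at h04
  have h2 : Real.sqrt 2 / 2 ≤ 5 / 7 := by
    have : Real.sqrt 2 ≤ 10 / 7 := by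
      rw [Real.sqrt_le_left (by norm_num)]; norm_num
    linarith
  nlinarith [mul_nonneg (sub_nonneg.2 h2) (sub_nonneg.2 hBV)]

/-- Gaussian Poincaré inequality. -/
theorem gaussian_poincare {n : ℕ} {h : Eu n → ℝ} (hd : Differentiable ℝ h) (hp : Poly h)
    (hp' : ∀ i, Poly (pd i h)) :
    ∫ y, h y ^ 2 ∂(gm n) ≤
      (∫ y, h y ∂(gm n)) ^ 2 + ∑ i, ∫ y, pd i h y ^ 2 ∂(gm n) := by
  have h1 := variance_gradient_le hd hp hp'
  have hBV : ∑ i, (∫ y, pd i h y ∂(gm n)) ^ 2 ≤ ∑ i, ∫ y, pd i h y ^ 2 ∂(gm n) :=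
    Finset.sum_le_sum fun i _ => variance_nonneg' (hp' i) (measurable_pd i h)
  linarith

/-- Functions almost saturating the Poincaré inequality are almost affine. -/
theorem poincare_stability {n : ℕ} {h : Eu n → ℝ} (hd : Differentiable ℝ h) (hp : Poly h)
    (hp' : ∀ i, Poly (pd i h)) (hmean : ∫ y, h y ∂(gm n) = 0) :
    ∫ y, (h y - ∑ i, (∫ z, pd i h z ∂(gm n)) * y i) ^ 2 ∂(gm n) ≤
      7 * (∑ i, ∫ y, pd i h y ^ 2 ∂(gm n) - ∫ y, h y ^ 2 ∂(gm n)) := by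
  set b : Fin n → ℝ := fun i => ∫ z, pd i h z ∂(gm n) with hb
  have hst : ∀ i, ∫ y, y i * h y ∂(gm n) = b i := fun i => (stein i hd hp (hp' i)).symm
  have hi1 : ∀ i, Integrable (fun y => b i * (y i * h y)) (gm n) := fun i =>
    (((Poly.coord i).mul hp).integrable
      (Continuous.aestronglyMeasurable (by have := hd.continuous; fun_prop))).const_mul _
  set l : Eu n → ℝ := fun y => ∑ i, b i * y i with hl
  have hlp : Poly l := Poly.sum fun i _ => (Poly.coord i).const_mul _
  have hlc : Continuous l := by fun_prop
  have hld : Differentiable ℝ l := by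
    intro y; rw [hl]; fun_prop
  have hpdl : ∀ i y, pd i l y = b i := by
    intro i y
    have hj : ∀ j, DifferentiableAt ℝ (fun y : Eu n => y j) y := fun j => by fun_prop
    rw [hl, pd_sum i fun j _ => (hj j).const_mul _]
    simp only [fun j => pd_const_mul i (hj j) (b j), pd_coord]
    simp
  have hl2 : ∫ y, l y ^ 2 ∂(gm n) = ∑ i, b i ^ 2 := by
    have e : ∀ y, l y ^ 2 = ∑ i, b i * (y i * l y) := fun y => by
      rw [pow_two]; nth_rewrite 1 [hl]; rw [Finset.sum_mul]
      exact Finset.sum_congr rfl fun i _ => by ring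
    simp only [e]
    rw [integral_finsetSum _ fun i _ => (((Poly.coord i).mul hlp).integrable
      (Continuous.aestronglyMeasurable (by fun_prop))).const_mul _]
    refine Finset.sum_congr rfl fun i _ => ?_
    rw [integral_const_mul, ← stein i hld hlp (by
      rw [show pd i l = fun _ => b i from funext (hpdl i)]; exact Poly.const _)]
    simp only [hpdl]
    simp [pow_two]
  have hlh : ∫ y, l y * h y ∂(gm n) = ∑ i, b i ^ 2 := by
    have e : ∀ y, l y * h y = ∑ i, b i * (y i * h y) := fun y => by
      simp only [hl]; rw [Finset.sum_mul]
      exact Finset.sum_congr rfl fun i _ => by ring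
    simp only [e]
    rw [integral_finsetSum _ fun i _ => hi1 i]
    refine Finset.sum_congr rfl fun i _ => ?_
    rw [integral_const_mul, hst, pow_two]
  have hc := hd.continuous
  have j1 : Integrable (fun y => h y ^ 2) (gm n) :=
    (hp.pow 2).integrable (Continuous.aestronglyMeasurable (by fun_prop))
  have j2 : Integrable (fun y => l y ^ 2) (gm n) :=
    (hlp.pow 2).integrable (Continuous.aestronglyMeasurable (by fun_prop))
  have j3 : Integrable (fun y => l y * h y) (gm n) :=
    (hlp.mul hp).integrable (Continuous.aestronglyMeasurable (by fun_prop))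
  have e : ∀ y, (h y - l y) ^ 2 = (h y ^ 2 + l y ^ 2) - 2 * (l y * h y) := fun y => by ring
  have j12 : Integrable (fun y => h y ^ 2 + l y ^ 2) (gm n) := j1.add j2
  have hfin := variance_gradient_le hd hp hp'
  change ∫ y, (h y - l y) ^ 2 ∂(gm n) ≤ _
  simp only [e]
  rw [integral_sub j12 (j3.const_mul 2), integral_add j1 j2, integral_const_mul, hl2, hlh]
  have hBV : ∑ i, b i ^ 2 ≤ ∑ i, ∫ y, pd i h y ^ 2 ∂(gm n) :=
    Finset.sum_le_sum fun i _ => variance_nonneg' (hp' i) (measurable_pd i h)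
  rw [hmean] at hfin
  linarith

/-! ### Static identities -/

/-- Inner product of the gradients. -/
def gdot {n : ℕ} (f g : Eu n → ℝ) (y : Eu n) : ℝ := ∑ i, pd i f y * pd i g y

/-- Gaussian `L²` mass. -/
def sq {n : ℕ} (f : Eu n → ℝ) : ℝ := ∫ y, f y ^ 2 ∂(gm n)

/-- Gaussian Dirichlet energy. -/
def dir {n : ℕ} (f : Eu n → ℝ) : ℝ := ∫ y, gdot f f y ∂(gm n)

/-- Gaussian mean of `f` times its Euler derivative. -/
def ue {n : ℕ} (f : Eu n → ℝ) : ℝ := ∫ y, f y * eul f y ∂(gm n)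

/-- Gaussian potential energy. -/
def pot {n : ℕ} (β : ℝ) (U V : Eu n → ℝ) : ℝ := β * ∫ y, U y ^ 2 * V y ^ 2 ∂(gm n)

/-- Positive tame solutions of `Δ U = β U V²`, `Δ V = β V U²`. -/
structure Sys {n : ℕ} (β : ℝ) (U V : Eu n → ℝ) : Prop where
  hU : U.HasTemperateGrowth
  hV : V.HasTemperateGrowth
  posU : ∀ y, 0 < U y
  posV : ∀ y, 0 < V y
  eqU : ∀ y, lapl U y = β * (U y * V y ^ 2)
  eqV : ∀ y, lapl V y = β * (V y * U y ^ 2)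
  hβ : 0 < β

lemma Sys.symm {n : ℕ} {β : ℝ} {U V : Eu n → ℝ} (h : Sys β U V) : Sys β V U :=
  ⟨h.hV, h.hU, h.posV, h.posU, h.eqV, h.eqU, h.hβ⟩

@[fun_prop]
lemma hasTemperateGrowth_gdot {n : ℕ} {f g : Eu n → ℝ} (hf : f.HasTemperateGrowth)
    (hg : g.HasTemperateGrowth) : (gdot f g).HasTemperateGrowth := by
  unfold gdot; fun_prop

@[fun_prop]
lemma hasTemperateGrowth_sq {n : ℕ} {f : Eu n → ℝ} (hf : f.HasTemperateGrowth) (k : ℕ) :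
    (fun y => f y ^ k).HasTemperateGrowth := by
  induction k with
  | zero => simp only [pow_zero]; fun_prop
  | succ k ih => simp only [pow_succ]; fun_prop

lemma gint_add {n : ℕ} {f g : Eu n → ℝ} (hf : f.HasTemperateGrowth) (hg : g.HasTemperateGrowth) :
    ∫ y, (f y + g y) ∂(gm n) = ∫ y, f y ∂(gm n) + ∫ y, g y ∂(gm n) :=
  integral_add hf.integrable hg.integrable

lemma gint_sub {n : ℕ} {f g : Eu n → ℝ} (hf : f.HasTemperateGrowth) (hg : g.HasTemperateGrowth) :
    ∫ y, (f y - g y) ∂(gm n) = ∫ y, f y ∂(gm n) - ∫ y, g y ∂(gm n) :=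
  integral_sub hf.integrable hg.integrable

lemma gint_sum {n : ℕ} {ι : Type*} {s : Finset ι} {f : ι → Eu n → ℝ}
    (hf : ∀ i ∈ s, (f i).HasTemperateGrowth) :
    ∫ y, ∑ i ∈ s, f i y ∂(gm n) = ∑ i ∈ s, ∫ y, f i y ∂(gm n) :=
  integral_finsetSum _ fun i hi => (hf i hi).integrable

lemma stein_mul {n : ℕ} (i : Fin n) {f : Eu n → ℝ} (hf : f.HasTemperateGrowth) :
    ∫ y, y i * f y ∂(gm n) = ∫ y, pd i f y ∂(gm n) :=
  (stein i hf.differentiable hf.poly (hf.pd i).poly).symm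

/-- Integration by parts for the Ornstein-Uhlenbeck operator. -/
lemma green {n : ℕ} {f g : Eu n → ℝ} (hf : f.HasTemperateGrowth) (hg : g.HasTemperateGrowth) :
    ∫ y, gdot f g y ∂(gm n) = ∫ y, f y * eul g y ∂(gm n) - ∫ y, f y * lapl g y ∂(gm n) := by
  have key : ∀ i, ∫ y, pd i f y * pd i g y ∂(gm n) =
      ∫ y, f y * (y i * pd i g y) ∂(gm n) - ∫ y, f y * pd i (pd i g) y ∂(gm n) := by
    intro i
    have h := stein_mul i (f := fun y => f y * pd i g y) (by fun_prop)
    have e : ∀ y, pd i (fun y => f y * pd i g y) y = pd i f y * pd i g y + f y * pd i (pd i g) y :=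
      fun y => pd_mul i (hf.differentiable y) ((hg.pd i).differentiable y)
    simp only [e] at h
    rw [gint_add (by fun_prop) (by fun_prop)] at h
    have e2 : ∀ y : Eu n, f y * (y i * pd i g y) = y i * (f y * pd i g y) := fun y => by ring
    simp only [e2]
    linarith
  unfold gdot eul lapl
  simp only [Finset.mul_sum]
  rw [gint_sum (fun i _ => by fun_prop), gint_sum (fun i _ => by fun_prop),
    gint_sum (fun i _ => by fun_prop), ← Finset.sum_sub_distrib]
  exact Finset.sum_congr rfl fun i _ => key i

lemma gdot_comm {n : ℕ} (f g : Eu n → ℝ) (y : Eu n) : gdot f g y = gdot g f y :=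
  Finset.sum_congr rfl fun _ _ => mul_comm _ _

lemma dir_eq_sum {n : ℕ} {f : Eu n → ℝ} (hf : f.HasTemperateGrowth) :
    dir f = ∑ i, ∫ y, pd i f y ^ 2 ∂(gm n) := by
  unfold dir gdot
  rw [gint_sum (fun i _ => by fun_prop)]
  simp only [pow_two]

lemma integral_eul {n : ℕ} {g : Eu n → ℝ} (hg : g.HasTemperateGrowth) :
    ∫ y, eul g y ∂(gm n) = ∫ y, ‖y‖ ^ 2 * g y ∂(gm n) - n * ∫ y, g y ∂(gm n) := by
  have key : ∀ i, ∫ y, y i * pd i g y ∂(gm n) =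
      ∫ y, y i ^ 2 * g y ∂(gm n) - ∫ y, g y ∂(gm n) := by
    intro i
    have h := stein_mul i (f := fun y => y i * g y) (by fun_prop)
    have e : ∀ y, pd i (fun y : Eu n => y i * g y) y = g y + y i * pd i g y := fun y => by
      rw [pd_mul i (by fun_prop) (hg.differentiable y), pd_coord, if_pos rfl, one_mul]
    simp only [e] at h
    rw [gint_add (by fun_prop) (by fun_prop)] at h
    have e2 : ∀ y : Eu n, y i ^ 2 * g y = y i * (y i * g y) := fun y => by ring
    simp only [e2]
    linarith
  unfold eul
  rw [gint_sum (fun i _ => by fun_prop)]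
  simp only [norm_sq_eq, Finset.sum_mul]
  rw [gint_sum (fun _ _ => by fun_prop), Finset.sum_congr rfl fun i _ => key i,
    Finset.sum_sub_distrib]
  simp

lemma pd_gdot {n : ℕ} (j : Fin n) {f : Eu n → ℝ} (hf : f.HasTemperateGrowth) (y : Eu n) :
    pd j (gdot f f) y = 2 * gdot f (pd j f) y := by
  unfold gdot
  rw [pd_sum j fun i _ => ((hf.pd i).differentiable y).fun_mul ((hf.pd i).differentiable y),
    Finset.mul_sum]
  refine Finset.sum_congr rfl fun i _ => ?_
  rw [pd_mul j ((hf.pd i).differentiable y) ((hf.pd i).differentiable y), pd_comm j i hf.1]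
  ring

lemma pd_eul {n : ℕ} (i : Fin n) {f : Eu n → ℝ} (hf : f.HasTemperateGrowth) (y : Eu n) :
    pd i (eul f) y = eul (pd i f) y + pd i f y := by
  unfold eul
  have hd : ∀ j, DifferentiableAt ℝ (pd j f) y := fun j => (hf.pd j).differentiable y
  rw [pd_sum i fun j _ => DifferentiableAt.fun_mul (by fun_prop) (hd j)]
  have e : ∀ j, pd i (fun y : Eu n => y j * pd j f y) y =
      y j * pd j (pd i f) y + if i = j then pd j f y else 0 := fun j => by
    rw [pd_mul i (by fun_prop) (hd j), pd_coord, pd_comm i j hf.1]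
    split_ifs <;> ring
  simp only [e, Finset.sum_add_distrib]
  simp

lemma eul_gdot {n : ℕ} {f : Eu n → ℝ} (hf : f.HasTemperateGrowth) (y : Eu n) :
    eul (gdot f f) y = 2 * gdot (eul f) f y - 2 * gdot f f y := by
  conv_lhs => unfold eul
  simp only [pd_gdot _ hf, gdot, pd_eul _ hf]
  simp only [eul, Finset.mul_sum, ← Finset.sum_sub_distrib]
  rw [Finset.sum_comm]
  refine Finset.sum_congr rfl fun i _ => ?_
  simp only [add_mul, mul_add, Finset.sum_mul, Finset.mul_sum]
  rw [add_sub_cancel_right]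
  refine Finset.sum_congr rfl fun j _ => ?_
  rw [pd_comm i j hf.1]; ring

lemma eul_mul {n : ℕ} {f g : Eu n → ℝ} (hf : f.HasTemperateGrowth) (hg : g.HasTemperateGrowth)
    (y : Eu n) : eul (fun y => f y * g y) y = eul f y * g y + f y * eul g y := by
  simp only [eul, Finset.sum_mul, Finset.mul_sum, ← Finset.sum_add_distrib]
  refine Finset.sum_congr rfl fun i _ => ?_
  rw [pd_mul i (hf.differentiable y) (hg.differentiable y)]; ring

lemma eul_sq {n : ℕ} {f : Eu n → ℝ} (hf : f.HasTemperateGrowth) (y : Eu n) :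
    eul (fun y => f y ^ 2) y = 2 * (f y * eul f y) := by
  simp only [pow_two]; rw [eul_mul hf hf]; ring

lemma eul_add {n : ℕ} {f g : Eu n → ℝ} (hf : f.HasTemperateGrowth) (hg : g.HasTemperateGrowth)
    (y : Eu n) : eul (fun y => f y + g y) y = eul f y + eul g y := by
  simp only [eul, ← Finset.sum_add_distrib]
  refine Finset.sum_congr rfl fun i _ => ?_
  rw [pd_add i (hf.differentiable y) (hg.differentiable y)]; ring

lemma eul_const_mul {n : ℕ} {f : Eu n → ℝ} (hf : f.HasTemperateGrowth) (c : ℝ)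
    (y : Eu n) : eul (fun y => c * f y) y = c * eul f y := by
  simp only [eul, Finset.mul_sum]
  refine Finset.sum_congr rfl fun i _ => ?_
  rw [pd_const_mul i (hf.differentiable y)]; ring

/-- The energy density. -/
def edens {n : ℕ} (β : ℝ) (U V : Eu n → ℝ) (y : Eu n) : ℝ :=
  gdot U U y + gdot V V y + β * (U y ^ 2 * V y ^ 2)

section Identities

variable {n : ℕ} {β : ℝ} {U V : Eu n → ℝ}

lemma Sys.tame_edens (h : Sys β U V) : (edens β U V).HasTemperateGrowth := by
  have := h.hU; have := h.hV
  unfold edens; fun_prop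

lemma Sys.integral_edens (h : Sys β U V) :
    ∫ y, edens β U V y ∂(gm n) = dir U + dir V + pot β U V := by
  have := h.hU; have := h.hV
  unfold edens dir pot
  rw [gint_add (by fun_prop) (by fun_prop), gint_add (by fun_prop) (by fun_prop),
    integral_const_mul]

lemma Sys.ue_eq (h : Sys β U V) : ue U = dir U + pot β U V := by
  have := h.hU; have := h.hV
  rw [dir, green h.hU h.hU, ue, pot]
  simp only [h.eqU]
  have e : ∀ y, U y * (β * (U y * V y ^ 2)) = β * (U y ^ 2 * V y ^ 2) := fun y => by ring
  simp only [e, integral_const_mul]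
  ring

lemma pot_comm : pot β U V = pot β V U := by
  unfold pot; simp only [mul_comm (U _ ^ 2)]

lemma Sys.pot_nonneg (h : Sys β U V) : 0 ≤ pot β U V :=
  mul_nonneg h.hβ.le (integral_nonneg fun y => by positivity)

lemma Sys.ueV_eq (h : Sys β U V) : ue V = dir V + pot β U V := by
  rw [pot_comm]; exact h.symm.ue_eq

lemma Sys.integral_eul_edens (h : Sys β U V) :
    ∫ y, eul (edens β U V) y ∂(gm n) = 2 * (sq (eul U) + sq (eul V)) - 2 * (dir U + dir V) := by
  have hU := h.hU; have hV := h.hV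
  have e : ∀ y, eul (edens β U V) y = ((2 * gdot (eul U) U y - 2 * gdot U U y) +
      (2 * gdot (eul V) V y - 2 * gdot V V y)) +
      (2 * (eul U y * (β * (U y * V y ^ 2))) + 2 * (eul V y * (β * (V y * U y ^ 2)))) := by
    intro y
    have := eul_add (f := fun y => gdot U U y + gdot V V y)
      (g := fun y => β * (U y ^ 2 * V y ^ 2)) (by fun_prop) (by fun_prop) y
    change eul (fun y => (gdot U U y + gdot V V y) + β * (U y ^ 2 * V y ^ 2)) y = _
    rw [this, eul_add (by fun_prop) (by fun_prop), eul_const_mul (by fun_prop),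
      eul_mul (by fun_prop) (by fun_prop), eul_sq hU, eul_sq hV, eul_gdot hU, eul_gdot hV]
    ring
  simp only [e]
  rw [gint_add (by fun_prop) (by fun_prop), gint_add (by fun_prop) (by fun_prop),
    gint_sub (by fun_prop) (by fun_prop), gint_sub (by fun_prop) (by fun_prop),
    gint_add (by fun_prop) (by fun_prop)]
  simp only [integral_const_mul (2 : ℝ)]
  rw [green (by fun_prop) hU, green (by fun_prop) hV]
  simp only [h.eqU, h.eqV, dir, sq, pow_two]
  ring

lemma Sys.integral_pd_edens (h : Sys β U V) (j : Fin n) :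
    ∫ y, y j * edens β U V y ∂(gm n) =
      2 * (∫ y, pd j U y * eul U y ∂(gm n) + ∫ y, pd j V y * eul V y ∂(gm n)) := by
  have hU := h.hU; have hV := h.hV
  rw [stein_mul j h.tame_edens]
  have e : ∀ y, pd j (edens β U V) y = (2 * gdot (pd j U) U y + 2 * gdot (pd j V) V y) +
      (2 * (pd j U y * (β * (U y * V y ^ 2))) + 2 * (pd j V y * (β * (V y * U y ^ 2)))) := by
    intro y
    have d1 := (hasTemperateGrowth_gdot hU hU).differentiable y
    have d2 := (hasTemperateGrowth_gdot hV hV).differentiable y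
    have dU := hU.differentiable y
    have dV := hV.differentiable y
    change pd j (fun y => (gdot U U y + gdot V V y) + β * (U y ^ 2 * V y ^ 2)) y = _
    rw [pd_add j (d1.fun_add d2) (((dU.fun_pow 2).fun_mul (dV.fun_pow 2)).const_mul β),
      pd_add j d1 d2, pd_const_mul j ((dU.fun_pow 2).fun_mul (dV.fun_pow 2)),
      pd_mul j (dU.fun_pow 2) (dV.fun_pow 2), pd_sq j dU,
      pd_sq j dV, pd_gdot j hU, pd_gdot j hV, gdot_comm U, gdot_comm V]
    ring
  simp only [e]
  rw [gint_add (by fun_prop) (by fun_prop), gint_add (by fun_prop) (by fun_prop),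
    gint_add (by fun_prop) (by fun_prop)]
  simp only [integral_const_mul (2 : ℝ)]
  rw [green (by fun_prop) hU, green (by fun_prop) hV]
  simp only [h.eqU, h.eqV]
  ring

lemma Sys.integral_coord_gdot (h : Sys β U V) (j : Fin n) :
    ∫ y, y j * gdot U U y ∂(gm n) + β * ∫ y, y j * (U y ^ 2 * V y ^ 2) ∂(gm n) =
      ∫ y, y j * (U y * eul U y) ∂(gm n) - 1 / 2 * ∫ y, y j * U y ^ 2 ∂(gm n) := by
  have hU := h.hU; have hV := h.hV
  have hg := green (f := fun y => y j * U y) (g := U) (by fun_prop) hU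
  have e : ∀ y, gdot (fun y => y j * U y) U y = y j * gdot U U y + U y * pd j U y := by
    intro y
    have : ∀ i, pd i (fun y => y j * U y) y = (if i = j then U y else 0) + y j * pd i U y :=
      fun i => by
        rw [pd_mul i (by fun_prop) (hU.differentiable y), pd_coord]; split_ifs <;> ring
    simp only [gdot, this, add_mul, Finset.sum_add_distrib, Finset.mul_sum]
    simp [mul_assoc, add_comm]
  have hs := stein_mul j (f := fun y => U y ^ 2) (by fun_prop)
  simp only [fun y => pd_sq j (hU.differentiable y), mul_assoc, integral_const_mul] at hs
  simp only [e, h.eqU] at hg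
  rw [gint_add (by fun_prop) (by fun_prop)] at hg
  have e2 : ∀ y, y j * U y * (β * (U y * V y ^ 2)) = β * (y j * (U y ^ 2 * V y ^ 2)) :=
    fun y => by ring
  simp only [e2, integral_const_mul, mul_assoc] at hg
  rw [hs]
  linarith

end Identities

/-! ### Dependence on the scale -/

/-- The rescaling `y ↦ f (x + r y)`. -/
def res {n : ℕ} (f : Eu n → ℝ) (x : Eu n) (r : ℝ) (y : Eu n) : ℝ := f (x + r • y)

/-- Total mass. -/
def Hs {n : ℕ} (U V : Eu n → ℝ) : ℝ := sq U + sq V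

/-- Total Dirichlet energy. -/
def Ds {n : ℕ} (U V : Eu n → ℝ) : ℝ := dir U + dir V

/-- Total pairing with the Euler derivative. -/
def Ss {n : ℕ} (U V : Eu n → ℝ) : ℝ := ue U + ue V

/-- Total mass of the Euler derivatives. -/
def Qs {n : ℕ} (U V : Eu n → ℝ) : ℝ := sq (eul U) + sq (eul V)

/-- Gaussian frequency. -/
def Ns {n : ℕ} (β : ℝ) (U V : Eu n → ℝ) : ℝ := (Ds U V + pot β U V) / Hs U V

/-- Half the logarithmic derivative of the frequency in the scale. -/
def dls {n : ℕ} (β : ℝ) (U V : Eu n → ℝ) : ℝ :=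
  (Qs U V * Hs U V - Ss U V ^ 2 + pot β U V * (Hs U V + Ss U V)) / Hs U V ^ 2

@[fun_prop]
lemma hasTemperateGrowth_res {n : ℕ} {f : Eu n → ℝ} (hf : f.HasTemperateGrowth) (x : Eu n) (r : ℝ) :
    (res f x r).HasTemperateGrowth := by
  have : Function.HasTemperateGrowth (fun y : Eu n => x + r • y) := by fun_prop
  exact hf.comp this

lemma eul_res {n : ℕ} {f : Eu n → ℝ} (hf : f.HasTemperateGrowth) (x : Eu n) (r : ℝ) (y : Eu n) :
    eul (res f x r) y = r * ∑ i, y i * pd i f (x + r • y) := by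
  unfold eul res
  rw [Finset.mul_sum]
  refine Finset.sum_congr rfl fun i _ => ?_
  rw [pd_comp_affine i hf.differentiable]; ring

lemma gdot_res {n : ℕ} {f : Eu n → ℝ} (hf : f.HasTemperateGrowth) (x : Eu n) (r : ℝ) (y : Eu n) :
    gdot (res f x r) (res f x r) y = r ^ 2 * gdot f f (x + r • y) := by
  unfold gdot res
  rw [Finset.mul_sum]
  refine Finset.sum_congr rfl fun i _ => ?_
  rw [pd_comp_affine i hf.differentiable]; ring

lemma Sys.res {n : ℕ} {u v : Eu n → ℝ} (h : Sys 1 u v) (x : Eu n) {r : ℝ} (hr : 0 < r) :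
    Sys (r ^ 2) (res u x r) (res v x r) where
  hU := hasTemperateGrowth_res h.hU x r
  hV := hasTemperateGrowth_res h.hV x r
  posU _ := h.posU _
  posV _ := h.posV _
  eqU y := by
    have := lapl_comp_affine h.hU.1 x r y
    rw [h.eqU, one_mul] at this
    exact this
  eqV y := by
    have := lapl_comp_affine h.hV.1 x r y
    rw [h.eqV, one_mul] at this
    exact this
  hβ := by positivity

lemma one_add_norm_affine_le {n : ℕ} (x y : Eu n) (r : ℝ) :
    1 + ‖x + r • y‖ ≤ (1 + ‖x‖ + |r|) * (1 + ‖y‖) := by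
  have h := norm_add_le x (r • y)
  rw [norm_smul, Real.norm_eq_abs] at h
  nlinarith [norm_nonneg x, norm_nonneg y, mul_nonneg (norm_nonneg x) (norm_nonneg y),
    abs_nonneg r]

/-- Gaussian averages at scale `r` are differentiable in `r`. -/
lemma hasDerivAt_average {n : ℕ} {g : Eu n → ℝ} (hg : g.HasTemperateGrowth) (x : Eu n) (r : ℝ) :
    HasDerivAt (fun r => ∫ y, g (x + r • y) ∂(gm n))
      (∫ y, ∑ i, y i * pd i g (x + r • y) ∂(gm n)) r := by
  have hsum : Poly (fun y => ∑ i, |pd i g y|) :=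
    Poly.sum fun i _ => (hg.pd i).poly.mono fun y => by simp
  obtain ⟨D, hD, l, hb⟩ := hsum.exists_pos
  have hx := norm_nonneg x
  refine (hasDerivAt_integral_of_dominated_loc_of_deriv_le (s := ball r 1) (ball_mem_nhds r one_pos)
      (F := fun r (y : Eu n) => g (x + r • y))
      (F' := fun r (y : Eu n) => ∑ i, y i * pd i g (x + r • y))
      (bound := fun y => D * (1 + ‖x‖ + (|r| + 1)) ^ l * (1 + ‖y‖) ^ (l + 1))
      (Filter.Eventually.of_forall fun r => ?_) ?_ ?_
      (Filter.Eventually.of_forall fun y s hs => ?_) ((integrable_one_add_norm_pow n _).const_mul _)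
      (Filter.Eventually.of_forall fun y s _ => ?_)).2
  · exact (hasTemperateGrowth_res hg x r).continuous.aestronglyMeasurable
  · exact (hasTemperateGrowth_res hg x r).integrable
  · have : Function.HasTemperateGrowth (fun y : Eu n => ∑ i, y i * SegregationBounds.res (pd i g) x r y) := by
      fun_prop
    exact this.continuous.aestronglyMeasurable
  · have hs' : |s| ≤ |r| + 1 := by
      have h1 : |s - r| < 1 := by simpa [Real.dist_eq] using hs
      have := abs_add_le (s - r) r
      rw [sub_add_cancel] at this
      linarith
    calc ‖∑ i, y i * pd i g (x + s • y)‖ ≤ ∑ i, (1 + ‖y‖) * |pd i g (x + s • y)| := by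
          refine (Finset.abs_sum_le_sum_abs _ _).trans (Finset.sum_le_sum fun i _ => ?_)
          rw [abs_mul]
          exact mul_le_mul_of_nonneg_right ((abs_coord_le y i).trans (by linarith)) (abs_nonneg _)
      _ = (1 + ‖y‖) * ∑ i, |pd i g (x + s • y)| := by rw [Finset.mul_sum]
      _ ≤ (1 + ‖y‖) * (D * ((1 + ‖x‖ + (|r| + 1)) * (1 + ‖y‖)) ^ l) := by
          gcongr
          refine ((le_abs_self _).trans (hb _)).trans ?_
          gcongr
          exact (one_add_norm_affine_le x y s).trans (by gcongr)
      _ = _ := by rw [mul_pow]; ring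
  · exact hasDerivAt_comp_line hg.differentiable x y s

lemma hasDerivAt_average_eul {n : ℕ} {g : Eu n → ℝ} (hg : g.HasTemperateGrowth) (x : Eu n) {r : ℝ}
    (hr : 0 < r) :
    HasDerivAt (fun r => ∫ y, g (x + r • y) ∂(gm n))
      ((∫ y, eul (res g x r) y ∂(gm n)) / r) r := by
  refine (hasDerivAt_average hg x r).congr_deriv ?_
  simp only [eul_res hg]
  rw [integral_const_mul]; field_simp

/-- Integrability-ready class: continuous functions of polynomial growth. -/
def CP {n : ℕ} (f : Eu n → ℝ) : Prop := Continuous f ∧ Poly f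

lemma CP.integrable {n : ℕ} {f : Eu n → ℝ} (hf : CP f) : Integrable f (gm n) :=
  hf.2.integrable hf.1.aestronglyMeasurable

lemma _root_.Function.HasTemperateGrowth.cp {n : ℕ} {f : Eu n → ℝ} (hf : f.HasTemperateGrowth) :
    CP f := ⟨hf.continuous, hf.poly⟩

section CP

variable {n : ℕ} {f g : Eu n → ℝ}

lemma CP.mul (hf : CP f) (hg : CP g) : CP (fun y => f y * g y) := ⟨hf.1.mul hg.1, hf.2.mul hg.2⟩
lemma CP.add (hf : CP f) (hg : CP g) : CP (fun y => f y + g y) := ⟨hf.1.add hg.1, hf.2.add hg.2⟩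
lemma CP.sub (hf : CP f) (hg : CP g) : CP (fun y => f y - g y) := ⟨hf.1.sub hg.1, hf.2.sub hg.2⟩
lemma CP.pow (hf : CP f) (k : ℕ) : CP (fun y => f y ^ k) := ⟨hf.1.pow k, hf.2.pow k⟩
lemma CP.const_mul (hf : CP f) (c : ℝ) : CP (fun y => c * f y) :=
  ⟨continuous_const.mul hf.1, hf.2.const_mul c⟩
lemma CP.const (c : ℝ) : CP (fun _ : Eu n => c) := ⟨continuous_const, Poly.const c⟩
lemma CP.abs (hf : CP f) : CP (fun y => |f y|) := ⟨hf.1.abs, hf.2.mono fun y => by simp⟩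
lemma CP.norm : CP (fun y : Eu n => ‖y‖) := ⟨continuous_norm, Poly.norm⟩
lemma CP.coord (i : Fin n) : CP (fun y : Eu n => y i) := (Function.HasTemperateGrowth.coord i).cp
lemma CP.sum {ι : Type*} {s : Finset ι} {f : ι → Eu n → ℝ} (hf : ∀ i ∈ s, CP (f i)) :
    CP (fun y => ∑ i ∈ s, f i y) :=
  ⟨continuous_finsetSum _ fun i hi => (hf i hi).1, Poly.sum fun i hi => (hf i hi).2⟩

lemma CP.integral_mono (hf : CP f) (hg : CP g) (h : ∀ y, f y ≤ g y) :
    ∫ y, f y ∂(gm n) ≤ ∫ y, g y ∂(gm n) :=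
  MeasureTheory.integral_mono hf.integrable hg.integrable h

lemma CP.integral_add (hf : CP f) (hg : CP g) :
    ∫ y, (f y + g y) ∂(gm n) = ∫ y, f y ∂(gm n) + ∫ y, g y ∂(gm n) :=
  MeasureTheory.integral_add hf.integrable hg.integrable

lemma CP.integral_sub (hf : CP f) (hg : CP g) :
    ∫ y, (f y - g y) ∂(gm n) = ∫ y, f y ∂(gm n) - ∫ y, g y ∂(gm n) :=
  MeasureTheory.integral_sub hf.integrable hg.integrable

/-- Cauchy-Schwarz inequality. -/
lemma CP.cauchy_schwarz (hf : CP f) (hg : CP g) :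
    (∫ y, f y * g y ∂(gm n)) ^ 2 ≤ sq f * sq g := by
  have key : ∀ t : ℝ, 0 ≤ sq g * (t * t) + (-2 * ∫ y, f y * g y ∂(gm n)) * t + sq f := by
    intro t
    have h0 : 0 ≤ ∫ y, (f y - t * g y) ^ 2 ∂(gm n) := integral_nonneg fun _ => sq_nonneg _
    have e : ∀ y, (f y - t * g y) ^ 2 = (f y ^ 2 - (2 * t) * (f y * g y)) + t ^ 2 * g y ^ 2 :=
      fun y => by ring
    simp only [e] at h0
    rw [((hf.pow 2).sub ((hf.mul hg).const_mul _)).integral_add ((hg.pow 2).const_mul _),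
      (hf.pow 2).integral_sub ((hf.mul hg).const_mul _), integral_const_mul,
      integral_const_mul] at h0
    unfold sq
    linarith
  have := discrim_le_zero key
  unfold discrim at this
  linarith

lemma sq_nonneg' (f : Eu n → ℝ) : 0 ≤ sq f := integral_nonneg fun _ => sq_nonneg _

lemma CP.abs_integral_mul_le (hf : CP f) (hg : CP g) :
    |∫ y, f y * g y ∂(gm n)| ≤ Real.sqrt (sq f) * Real.sqrt (sq g) := by
  rw [← Real.sqrt_mul (sq_nonneg' f)]
  exact Real.abs_le_sqrt (hf.cauchy_schwarz hg)

lemma CP.integral_sq_le (hf : CP f) : (∫ y, f y ∂(gm n)) ^ 2 ≤ sq f := by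
  have := hf.cauchy_schwarz (CP.const 1)
  simpa [sq] using this

lemma CP.integral_pos (hf : CP f) (h : ∀ y, 0 < f y) : 0 < ∫ y, f y ∂(gm n) := by
  rw [integral_pos_iff_support_of_nonneg (fun y => (h y).le) hf.integrable]
  have : Function.support f = Set.univ := by
    ext y; simp [(h y).ne']
  rw [this]; simp

end CP

section Static

variable {n : ℕ} {β : ℝ} {U V : Eu n → ℝ}

lemma Sys.sqU_pos (h : Sys β U V) : 0 < sq U :=
  (h.hU.cp.pow 2).integral_pos fun y => pow_pos (h.posU y) 2

lemma Sys.H_pos (h : Sys β U V) : 0 < Hs U V := add_pos h.sqU_pos h.symm.sqU_pos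

lemma dir_nonneg (f : Eu n → ℝ) : 0 ≤ dir f :=
  integral_nonneg fun _ => Finset.sum_nonneg fun _ _ => mul_self_nonneg _

lemma Sys.S_eq (h : Sys β U V) : Ss U V = Ds U V + 2 * pot β U V := by
  rw [Ss, Ds, h.ue_eq, h.ueV_eq]; ring

lemma Sys.S_nonneg (h : Sys β U V) : 0 ≤ Ss U V := by
  rw [h.S_eq, Ds]; linarith [dir_nonneg U, dir_nonneg V, h.pot_nonneg]

/-- Expansion of the defect of homogeneity. -/
lemma sq_eul_sub {f : Eu n → ℝ} (hf : f.HasTemperateGrowth) (t : ℝ) :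
    sq (fun y => eul f y - t * f y) = sq (eul f) - 2 * t * ue f + t ^ 2 * sq f := by
  unfold sq ue
  have e : ∀ y, (eul f y - t * f y) ^ 2 =
      (eul f y ^ 2 - (2 * t) * (f y * eul f y)) + t ^ 2 * f y ^ 2 := fun y => by ring
  simp only [e]
  rw [gint_add (by fun_prop) (by fun_prop), gint_sub (by fun_prop) (by fun_prop),
    integral_const_mul, integral_const_mul]

lemma Sys.S_sq_le (h : Sys β U V) : Ss U V ^ 2 ≤ Qs U V * Hs U V := by
  have h1 := sq_nonneg' (fun y => eul U y - (Ss U V / Hs U V) * U y)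
  have h2 := sq_nonneg' (fun y => eul V y - (Ss U V / Hs U V) * V y)
  rw [sq_eul_sub h.hU] at h1
  rw [sq_eul_sub h.hV] at h2
  have hH := h.H_pos
  have : 0 ≤ Qs U V - 2 * (Ss U V / Hs U V) * Ss U V + (Ss U V / Hs U V) ^ 2 * Hs U V := by
    unfold Qs Hs Ss at *
    linarith
  have e : Qs U V - 2 * (Ss U V / Hs U V) * Ss U V + (Ss U V / Hs U V) ^ 2 * Hs U V =
      (Qs U V * Hs U V - Ss U V ^ 2) / Hs U V := by field_simp; ring
  rw [e, le_div_iff₀ hH] at this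
  linarith

lemma Sys.pot_div_le_dls (h : Sys β U V) : pot β U V / Hs U V ≤ dls β U V := by
  have hH := h.H_pos
  rw [dls, div_le_div_iff₀ hH (by positivity)]
  nlinarith [h.S_sq_le, mul_nonneg h.pot_nonneg h.S_nonneg]

lemma Sys.dls_nonneg (h : Sys β U V) : 0 ≤ dls β U V :=
  (div_nonneg h.pot_nonneg h.H_pos.le).trans h.pot_div_le_dls

lemma Sys.Ns_nonneg (h : Sys β U V) : 0 ≤ Ns β U V :=
  div_nonneg (by unfold Ds; linarith [dir_nonneg U, dir_nonneg V, h.pot_nonneg]) h.H_pos.le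

end Static

/-! ### Monotonicity formulas -/

/-- Entire solutions of linear growth. -/
structure Ent {n : ℕ} (u v : Eu n → ℝ) : Prop extends Sys 1 u v where
  growth : ∃ M : ℝ, 0 < M ∧ ∀ y, u y + v y ≤ M * (1 + ‖y‖)

/-- Total mass at centre `x` and scale `r`. -/
def HH {n : ℕ} (u v : Eu n → ℝ) (x : Eu n) (r : ℝ) : ℝ := Hs (res u x r) (res v x r)

/-- Frequency at centre `x` and scale `r`. -/
def NN {n : ℕ} (u v : Eu n → ℝ) (x : Eu n) (r : ℝ) : ℝ := Ns (r ^ 2) (res u x r) (res v x r)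

/-- Half the scale derivative of the frequency at centre `x` and scale `r`. -/
def DL {n : ℕ} (u v : Eu n → ℝ) (x : Eu n) (r : ℝ) : ℝ := dls (r ^ 2) (res u x r) (res v x r)

/-- Logarithmic growth rate of the mass, halved. -/
def SS {n : ℕ} (u v : Eu n → ℝ) (x : Eu n) (r : ℝ) : ℝ := Ss (res u x r) (res v x r)

lemma Ent.symm {n : ℕ} {u v : Eu n → ℝ} (h : Ent u v) : Ent v u :=
  ⟨h.toSys.symm, by simpa only [add_comm] using h.growth⟩

lemma eq_sq_add_sq {n : ℕ} {f g : Eu n → ℝ} (hf : f.HasTemperateGrowth)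
    (hg : g.HasTemperateGrowth) : Hs f g = ∫ y, (f y ^ 2 + g y ^ 2) ∂(gm n) := by
  rw [Hs, sq, sq, gint_add (by fun_prop) (by fun_prop)]

lemma hasDerivAt_sq_res {n : ℕ} {f : Eu n → ℝ} (hf : f.HasTemperateGrowth) (x : Eu n) {r : ℝ}
    (hr : 0 < r) : HasDerivAt (fun r => sq (res f x r)) (2 * ue (res f x r) / r) r := by
  have h := hasDerivAt_average_eul (g := fun y => f y ^ 2) (by fun_prop) x hr
  refine h.congr_deriv ?_
  have : ∀ y, eul (res (fun y => f y ^ 2) x r) y = 2 * (res f x r y * eul (res f x r) y) :=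
    fun y => eul_sq (hasTemperateGrowth_res hf x r) y
  simp only [this]
  rw [integral_const_mul]; rfl

lemma continuous_sq_res {n : ℕ} {f : Eu n → ℝ} (hf : f.HasTemperateGrowth) (x : Eu n) :
    Continuous (fun r => sq (res f x r)) :=
  continuous_iff_continuousAt.2 fun r =>
    (hasDerivAt_average (g := fun y => f y ^ 2) (by fun_prop) x r).continuousAt

section Monotonicity

variable {n : ℕ} {u v : Eu n → ℝ} (x : Eu n)

lemma Sys.edens_res (h : Sys 1 u v) (r : ℝ) (y : Eu n) :
    edens (r ^ 2) (SegregationBounds.res u x r) (SegregationBounds.res v x r) y =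
      r ^ 2 * edens 1 u v (x + r • y) := by
  simp only [edens, gdot_res h.hU, gdot_res h.hV, SegregationBounds.res]; ring

lemma Sys.hasDerivAt_HH (h : Sys 1 u v) {r : ℝ} (hr : 0 < r) :
    HasDerivAt (HH u v x) (2 * SS u v x r / r) r := by
  refine ((hasDerivAt_sq_res h.hU x hr).add (hasDerivAt_sq_res h.hV x hr)).congr_deriv ?_
  simp only [SS, Ss]; ring

lemma Sys.HH_pos (h : Sys 1 u v) {r : ℝ} (hr : 0 < r) : 0 < HH u v x r := (h.res x hr).H_pos

lemma Sys.continuous_HH (h : Sys 1 u v) : Continuous (HH u v x) :=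
  (continuous_sq_res h.hU x).add (continuous_sq_res h.hV x)

lemma Sys.hasDerivAt_energy (h : Sys 1 u v) {r : ℝ} (hr : 0 < r) :
    HasDerivAt (fun r => r ^ 2 * ∫ y, edens 1 u v (x + r • y) ∂(gm n))
      ((2 * Qs (SegregationBounds.res u x r) (SegregationBounds.res v x r) +
        2 * pot (r ^ 2) (SegregationBounds.res u x r) (SegregationBounds.res v x r)) / r) r := by
  have h1 := (hasDerivAt_pow 2 r).mul (hasDerivAt_average_eul h.tame_edens x hr)
  refine h1.congr_deriv ?_
  have h2 := (h.res x hr).integral_eul_edens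
  have h3 := (h.res x hr).integral_edens
  have e : (edens (r ^ 2) (SegregationBounds.res u x r) (SegregationBounds.res v x r)) =
      fun y => r ^ 2 * SegregationBounds.res (edens 1 u v) x r y := funext fun y => h.edens_res x r y
  rw [e] at h2 h3
  have e2 := eul_const_mul (hasTemperateGrowth_res h.tame_edens x r) (r ^ 2)
  simp only [e2] at h2
  rw [integral_const_mul] at h2 h3
  have e3 : ∫ y, SegregationBounds.res (edens 1 u v) x r y ∂(gm n) =
    ∫ y, edens 1 u v (x + r • y) ∂(gm n) := rfl
  rw [e3] at h3
  rw [Qs]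
  field_simp
  push_cast
  linear_combination h2 + 2 * h3

lemma Sys.NN_eq (h : Sys 1 u v) {r : ℝ} (hr : 0 < r) :
    NN u v x r = r ^ 2 * (∫ y, edens 1 u v (x + r • y) ∂(gm n)) / HH u v x r := by
  have h3 := (h.res x hr).integral_edens
  simp only [h.edens_res x r] at h3
  rw [integral_const_mul] at h3
  rw [NN, Ns, Ds, ← h3]; rfl

lemma Sys.hasDerivAt_NN (h : Sys 1 u v) {r : ℝ} (hr : 0 < r) :
    HasDerivAt (NN u v x) (2 * DL u v x r / r) r := by
  have h1 := (h.hasDerivAt_energy x hr).div (h.hasDerivAt_HH x hr) (h.HH_pos x hr).ne'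
  refine (h1.congr_of_eventuallyEq ?_).congr_deriv ?_
  · filter_upwards [lt_mem_nhds hr] with s hs
    exact h.NN_eq x hs
  · have h3 := (h.res x hr).integral_edens
    simp only [h.edens_res x r] at h3
    rw [integral_const_mul] at h3
    have hS := (h.res x hr).S_eq
    have hH := h.HH_pos x hr
    rw [h3]
    simp only [DL, dls, SS]
    change _ = 2 * ((_ * HH u v x r - _ + _ * (HH u v x r + _)) / HH u v x r ^ 2) / r
    rw [Ds] at hS
    field_simp
    rw [hS]; ring

lemma Sys.SS_eq (h : Sys 1 u v) {r : ℝ} (hr : 0 < r) : SS u v x r =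
    NN u v x r * HH u v x r + pot (r ^ 2) (SegregationBounds.res u x r) (SegregationBounds.res v x r) := by
  have hH := h.HH_pos x hr
  rw [SS, (h.res x hr).S_eq, NN, Ns]
  change _ = (_ + _) / HH u v x r * _ + _
  field_simp; ring

lemma Sys.SS_ge (h : Sys 1 u v) {r : ℝ} (hr : 0 < r) : NN u v x r * HH u v x r ≤ SS u v x r := by
  rw [h.SS_eq x hr]; linarith [(h.res x hr).pot_nonneg]

lemma Sys.monotoneOn_HH (h : Sys 1 u v) : MonotoneOn (HH u v x) (Set.Ici 0) := by
  refine monotoneOn_of_deriv_nonneg (convex_Ici 0) (h.continuous_HH x).continuousOn ?_ ?_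
  · rw [interior_Ici]
    exact fun r hr => (h.hasDerivAt_HH x hr).differentiableAt.differentiableWithinAt
  · rw [interior_Ici]
    intro r hr
    rw [(h.hasDerivAt_HH x hr).deriv]
    have hr' : 0 < r := hr
    have := (h.res x hr).S_nonneg
    unfold SS
    positivity

lemma Sys.monotoneOn_NN (h : Sys 1 u v) : MonotoneOn (NN u v x) (Set.Ioi 0) := by
  refine monotoneOn_of_deriv_nonneg (convex_Ioi 0)
    (fun r hr => (h.hasDerivAt_NN x hr).continuousAt.continuousWithinAt) ?_ ?_
  · rw [interior_Ioi]
    exact fun r hr => (h.hasDerivAt_NN x hr).differentiableAt.differentiableWithinAt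
  · rw [interior_Ioi]
    intro r hr
    rw [(h.hasDerivAt_NN x hr).deriv]
    have hr' : 0 < r := hr
    have := (h.res x hr).dls_nonneg
    unfold DL
    positivity

lemma HH_zero : HH u v x 0 = u x ^ 2 + v x ^ 2 := by
  simp [HH, Hs, sq, res]

lemma Sys.sq_add_sq_le_HH (h : Sys 1 u v) {r : ℝ} (hr : 0 ≤ r) :
    u x ^ 2 + v x ^ 2 ≤ HH u v x r := by
  rw [← HH_zero]
  exact h.monotoneOn_HH x Set.self_mem_Ici hr hr

/-- Mass growth is at least `r ^ (2 * N)`. -/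
lemma Sys.monotoneOn_log_HH_sub (h : Sys 1 u v) {a : ℝ} (ha : 0 < a) :
    MonotoneOn (fun r => Real.log (HH u v x r) - 2 * NN u v x a * Real.log r) (Set.Ici a) := by
  have hd : ∀ r ∈ Set.Ici a, HasDerivAt
      (fun r => Real.log (HH u v x r) - 2 * NN u v x a * Real.log r)
      (2 * SS u v x r / r / HH u v x r - 2 * NN u v x a * r⁻¹) r := by
    intro r hr
    have hr0 : 0 < r := ha.trans_le hr
    exact ((h.hasDerivAt_HH x hr0).log (h.HH_pos x hr0).ne').sub
      ((Real.hasDerivAt_log hr0.ne').const_mul _)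
  refine monotoneOn_of_deriv_nonneg (convex_Ici a)
    (fun r hr => (hd r hr).continuousAt.continuousWithinAt) ?_ ?_
  · exact fun r hr => (hd r (interior_subset hr)).differentiableAt.differentiableWithinAt
  · intro r hr
    have hr1 := interior_subset hr
    have hr0 : 0 < r := ha.trans_le hr1
    rw [(hd r hr1).deriv]
    have h1 := h.SS_ge x hr0
    have hH := h.HH_pos x hr0
    have h2 := h.monotoneOn_NN x (Set.mem_Ioi.2 ha) (Set.mem_Ioi.2 hr0) hr1
    have e : 2 * SS u v x r / r / HH u v x r - 2 * NN u v x a * r⁻¹ =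
        2 * (SS u v x r - NN u v x a * HH u v x r) / (r * HH u v x r) := by
      field_simp
    rw [e]
    have : 0 ≤ SS u v x r - NN u v x a * HH u v x r := by nlinarith
    positivity

lemma Ent.exists_res_le (h : Ent u v) : ∃ M : ℝ, 0 < M ∧ ∀ r, 0 ≤ r → ∀ y : Eu n,
    res u x r y + res v x r y ≤ M * (1 + r) * (1 + ‖y‖) := by
  obtain ⟨M, hM, hg⟩ := h.growth
  have hx := norm_nonneg x
  refine ⟨M * (1 + ‖x‖), by positivity, fun r hr y => ?_⟩
  have h1 := hg (x + r • y)
  have h2 := one_add_norm_affine_le x y r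
  rw [abs_of_nonneg hr] at h2
  have hy := norm_nonneg y
  have h3 : 1 + ‖x‖ + r ≤ (1 + ‖x‖) * (1 + r) := by nlinarith
  have h4 : 1 + ‖x + r • y‖ ≤ (1 + ‖x‖) * (1 + r) * (1 + ‖y‖) :=
    h2.trans (mul_le_mul_of_nonneg_right h3 (by linarith))
  have h5 := mul_le_mul_of_nonneg_left h4 hM.le
  simp only [SegregationBounds.res]
  linarith

lemma Ent.HH_le (h : Ent u v) : ∃ K : ℝ, 0 < K ∧ ∀ r, 0 ≤ r →
    HH u v x r ≤ K * (1 + r) ^ 2 := by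
  obtain ⟨M, hM, hg⟩ := h.exists_res_le x
  have hw : CP (fun y : Eu n => (1 + ‖y‖) ^ 2) := ((CP.const 1).add CP.norm).pow 2
  have hJ : 0 < ∫ y : Eu n, (1 + ‖y‖) ^ 2 ∂(gm n) := hw.integral_pos fun y => by
    have := norm_nonneg y; positivity
  refine ⟨M ^ 2 * ∫ y : Eu n, (1 + ‖y‖) ^ 2 ∂(gm n), by positivity, fun r hr => ?_⟩
  have hU := hasTemperateGrowth_res h.hU x r
  have hV := hasTemperateGrowth_res h.hV x r
  have hm := CP.integral_mono ((hU.cp.pow 2).add (hV.cp.pow 2))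
    (hw.const_mul (M ^ 2 * (1 + r) ^ 2)) fun y => by
      have h1 := hg r hr y
      have h3 : 0 < SegregationBounds.res u x r y := h.posU _
      have h4 : 0 < SegregationBounds.res v x r y := h.posV _
      have h6 := pow_le_pow_left₀ (by positivity) h1 2
      rw [mul_pow, mul_pow] at h6
      nlinarith [mul_pos h3 h4]
  rw [integral_const_mul] at hm
  calc HH u v x r = _ := eq_sq_add_sq hU hV
    _ ≤ _ := hm
    _ = _ := by ring

/-- Linear growth bounds the frequency by one. -/
lemma Ent.NN_le_one (h : Ent u v) {a : ℝ} (ha : 0 < a) : NN u v x a ≤ 1 := by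
  by_contra! hN
  obtain ⟨K, hK, hb⟩ := h.HH_le x
  have hm := h.monotoneOn_log_HH_sub x ha
  set c := Real.log (HH u v x a) - 2 * NN u v x a * Real.log a with hc
  have key : ∀ r, max a 1 ≤ r → (2 * NN u v x a - 2) * Real.log r ≤ Real.log (4 * K) - c := by
    intro r hr
    have har : a ≤ r := (le_max_left _ _).trans hr
    have h1r : 1 ≤ r := (le_max_right _ _).trans hr
    have hr0 : 0 < r := by linarith
    have h1 := hm Set.self_mem_Ici har har
    simp only at h1
    have h2 : HH u v x r ≤ 4 * K * r ^ 2 := (hb r hr0.le).trans (by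
      have : (1 + r) ^ 2 ≤ 4 * r ^ 2 := by nlinarith
      nlinarith)
    have h3 := Real.log_le_log (h.HH_pos x hr0) h2
    rw [Real.log_mul (by positivity) (by positivity), Real.log_pow] at h3
    push_cast at h3
    linarith
  have ht : Filter.Tendsto (fun r => (2 * NN u v x a - 2) * Real.log r) Filter.atTop Filter.atTop :=
    Real.tendsto_log_atTop.const_mul_atTop (by linarith)
  obtain ⟨r, hr1, hr2⟩ := ((ht.eventually_gt_atTop (Real.log (4 * K) - c)).and
    (Filter.eventually_ge_atTop (max a 1))).exists
  linarith [key r hr2]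

lemma Ent.antitoneOn_log_HH (h : Ent u v) :
    AntitoneOn (fun r => Real.log (HH u v x r) - 2 * Real.log r - NN u v x r) (Set.Ioi 0) := by
  have hd : ∀ r ∈ Set.Ioi (0:ℝ), HasDerivAt
      (fun r => Real.log (HH u v x r) - 2 * Real.log r - NN u v x r)
      (2 * SS u v x r / r / HH u v x r - 2 * r⁻¹ - 2 * DL u v x r / r) r := by
    intro r hr
    have hr0 : 0 < r := hr
    exact (((h.hasDerivAt_HH x hr0).log (h.HH_pos x hr0).ne').sub
      ((Real.hasDerivAt_log hr0.ne').const_mul _)).sub (h.hasDerivAt_NN x hr0)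
  refine antitoneOn_of_deriv_nonpos (convex_Ioi 0)
    (fun r hr => (hd r hr).continuousAt.continuousWithinAt) ?_ ?_
  · exact fun r hr => (hd r (interior_subset hr)).differentiableAt.differentiableWithinAt
  · intro r hr
    have hr1 := interior_subset hr
    have hr0 : 0 < r := hr1
    rw [(hd r hr1).deriv]
    have hH := h.HH_pos x hr0
    have h1 := h.SS_eq x hr0
    have h2 := h.NN_le_one x hr0
    have h3 := (h.res x hr0).pot_div_le_dls
    change _ / HH u v x r ≤ DL u v x r at h3
    have e : 2 * SS u v x r / r / HH u v x r - 2 * r⁻¹ - 2 * DL u v x r / r =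
        2 * (NN u v x r - 1 + (pot (r ^ 2) (SegregationBounds.res u x r)
          (SegregationBounds.res v x r) / HH u v x r - DL u v x r)) / r := by
      rw [h1]; field_simp; ring
    rw [e]
    exact div_nonpos_of_nonpos_of_nonneg (by linarith) hr0.le

/-- Quadratic growth of the mass. -/
lemma Ent.HH_growth (h : Ent u v) {r s : ℝ} (hr : 0 < r) (hrs : r ≤ s) :
    HH u v x s ≤ Real.exp 1 * (s / r) ^ 2 * HH u v x r := by
  have hs : 0 < s := hr.trans_le hrs
  have h1 := h.antitoneOn_log_HH x hr hs hrs
  simp only at h1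
  have h2 := h.NN_le_one x hs
  have h3 := (h.res x hr).Ns_nonneg
  change 0 ≤ NN u v x r at h3
  have hHr := h.HH_pos x hr
  have hHs := h.HH_pos x hs
  rw [← Real.log_le_log_iff hHs (by positivity), Real.log_mul (by positivity) hHr.ne',
    Real.log_mul (by positivity) (by positivity), Real.log_exp, Real.log_pow,
    Real.log_div hs.ne' hr.ne']
  push_cast
  linarith

end Monotonicity

/-! ### Change of centre -/

lemma gdens_sqrt_two_smul_sub_le {n : ℕ} {a : Eu n} (ha : ‖a‖ ≤ 1) (y : Eu n) :
    gdens n (√2 • y - a) ≤ Real.exp (1 / 2) * gdens n y := by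
  have h1 : ‖√2 • y‖ ≤ ‖√2 • y - a‖ + ‖a‖ := by
    simpa using norm_add_le (√2 • y - a) a
  have h2 : ‖√2 • y‖ ^ 2 = 2 * ‖y‖ ^ 2 := by
    rw [norm_smul, mul_pow, Real.norm_of_nonneg (Real.sqrt_nonneg 2),
      Real.sq_sqrt (by norm_num)]
  have h3 : ‖y‖ ^ 2 - 1 ≤ ‖√2 • y - a‖ ^ 2 := by
    nlinarith [norm_nonneg (√2 • y), norm_nonneg (√2 • y - a), norm_nonneg a,
      sq_nonneg (‖√2 • y - a‖ - ‖a‖)]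
  unfold gdens
  rw [mul_left_comm, ← Real.exp_add]
  gcongr
  linarith

lemma integral_comp_le_of_norm_sub_le {n : ℕ} {w : Eu n → ℝ} (hw : w.HasTemperateGrowth)
    (hw0 : ∀ y, 0 ≤ w y) {x z : Eu n} {ρ : ℝ} (hρ : 0 < ρ) (hz : ‖z - x‖ ≤ ρ) :
    ∫ y, w (z + ρ • y) ∂(gm n) ≤
      √2 ^ n * Real.exp (1 / 2) * ∫ y, w (x + (√2 * ρ) • y) ∂(gm n) := by
  set a : Eu n := ρ⁻¹ • (z - x) with ha
  have ha1 : ‖a‖ ≤ 1 := by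
    rw [ha, norm_smul, Real.norm_of_nonneg (by positivity), ← div_eq_inv_mul]
    exact (div_le_one hρ).2 hz
  have hza : z = x + ρ • a := by
    rw [ha, smul_smul, mul_inv_cancel₀ hρ.ne', one_smul]; abel
  have e2 : (0:ℝ) < √2 := by positivity
  have h1 : ∫ y, gdens n (√2 • y - a) * w (x + (√2 * ρ) • y) =
      (√2 ^ n)⁻¹ * ∫ y, gdens n y * w (z + ρ • y) := by
    have h := Measure.integral_comp_smul (volume : Measure (Eu n))
      (fun y => gdens n (y - a) * w (x + ρ • y)) √2
    have h' := integral_sub_right_eq_self (μ := (volume : Measure (Eu n)))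
      (fun y => gdens n y * w (z + ρ • y)) a
    have e : ∀ y : Eu n, z + ρ • (y - a) = x + ρ • y := fun y => by
      rw [hza, smul_sub]; abel
    simp only [e] at h'
    rw [h', finrank_euclideanSpace_fin, abs_of_pos (by positivity), smul_eq_mul] at h
    simpa [smul_smul, mul_comm] using h
  have i1 := integrable_gm_iff.1
    (hasTemperateGrowth_res hw x (√2 * ρ)).integrable
  have hle : ∫ y, gdens n (√2 • y - a) * w (x + (√2 * ρ) • y) ≤
      ∫ y, Real.exp (1 / 2) * (gdens n y * w (x + (√2 * ρ) • y)) := by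
    refine integral_mono_of_nonneg (Filter.Eventually.of_forall fun y => ?_)
      (i1.const_mul _) (Filter.Eventually.of_forall fun y => ?_)
    · exact mul_nonneg (gdens_pos _).le (hw0 _)
    · calc _ ≤ _ := mul_le_mul_of_nonneg_right (gdens_sqrt_two_smul_sub_le ha1 y) (hw0 _)
        _ = _ := by ring
  rw [h1, integral_const_mul] at hle
  rw [integral_gm, integral_gm]
  have hp : (0:ℝ) < √2 ^ n := by positivity
  calc ∫ y, gdens n y * w (z + ρ • y)
      = √2 ^ n * ((√2 ^ n)⁻¹ * ∫ y, gdens n y * w (z + ρ • y)) := by field_simp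
    _ ≤ √2 ^ n * _ := mul_le_mul_of_nonneg_left hle hp.le
    _ = _ := by ring

/-- The mass at a nearby centre is controlled. -/
lemma exists_HH_le (n : ℕ) : ∃ K : ℝ, 1 ≤ K ∧ ∀ u v : Eu n → ℝ, Ent u v → ∀ x : Eu n, ∀ r : ℝ,
    0 < r → ∀ y : Eu n,
      HH u v (x + r • y) (r * (1 + ‖y‖)) ≤ K * HH u v x r * (1 + ‖y‖) ^ 2 := by
  have e2 : (1:ℝ) ≤ √2 := Real.one_le_sqrt.2 (by norm_num)
  refine ⟨√2 ^ n * Real.exp (1 / 2) * (Real.exp 1 * 2), ?_, fun u v h x r hr y => ?_⟩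
  · have h1 : (1:ℝ) ≤ √2 ^ n := one_le_pow₀ e2
    have h2 : (1:ℝ) ≤ Real.exp (1 / 2) := Real.one_le_exp (by norm_num)
    have h3 : (1:ℝ) ≤ Real.exp 1 := Real.one_le_exp (by norm_num)
    have := one_le_mul_of_one_le_of_one_le (one_le_mul_of_one_le_of_one_le h1 h2) 
      (one_le_mul_of_one_le_of_one_le h3 one_le_two)
    simpa using this
  · have hy := norm_nonneg y
    have hρ : 0 < r * (1 + ‖y‖) := by positivity
    have hw : Function.HasTemperateGrowth (fun z => u z ^ 2 + v z ^ 2) := by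
      have := h.hU; have := h.hV; fun_prop
    have h1 := integral_comp_le_of_norm_sub_le hw (fun z => by positivity) (x := x)
      (z := x + r • y) hρ (by
        rw [add_sub_cancel_left, norm_smul, Real.norm_of_nonneg hr.le]; nlinarith)
    have e : ∀ z ρ, HH u v z ρ = ∫ y, (u (z + ρ • y) ^ 2 + v (z + ρ • y) ^ 2) ∂(gm n) :=
      fun z ρ => eq_sq_add_sq (hasTemperateGrowth_res h.hU z ρ) (hasTemperateGrowth_res h.hV z ρ)
    rw [← e, ← e] at h1
    have h2 := h.HH_growth x (s := √2 * (r * (1 + ‖y‖))) hr (by nlinarith)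
    have e3 : (√2 * (r * (1 + ‖y‖)) / r) ^ 2 = 2 * (1 + ‖y‖) ^ 2 := by
      have : √2 * (r * (1 + ‖y‖)) / r = √2 * (1 + ‖y‖) := by field_simp
      rw [this, mul_pow, Real.sq_sqrt (by norm_num)]
    rw [e3] at h2
    calc _ ≤ _ := h1
      _ ≤ √2 ^ n * Real.exp (1 / 2) * _ := mul_le_mul_of_nonneg_left h2 (by positivity)
      _ = _ := by ring

lemma exists_sq_add_sq_le (n : ℕ) : ∃ K : ℝ, 1 ≤ K ∧ ∀ u v : Eu n → ℝ, Ent u v → ∀ x : Eu n,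
    ∀ r : ℝ, 0 < r → ∀ y : Eu n,
      u (x + r • y) ^ 2 + v (x + r • y) ^ 2 ≤ K * HH u v x r * (1 + ‖y‖) ^ 2 := by
  obtain ⟨K, hK, h⟩ := exists_HH_le n
  exact ⟨K, hK, fun u v huv x r hr y => (huv.sq_add_sq_le_HH _ (by positivity)).trans
    (h u v huv x r hr y)⟩

/-! ### Frequency at the segregation scale -/

lemma hasDerivAt_average_lapl {n : ℕ} {g : Eu n → ℝ} (hg : g.HasTemperateGrowth) (x : Eu n)
    (s : ℝ) : HasDerivAt (fun s => ∫ y, g (x + s • y) ∂(gm n))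
      (s * ∫ y, lapl g (x + s • y) ∂(gm n)) s := by
  refine (hasDerivAt_average hg x s).congr_deriv ?_
  have hp := fun i => hasTemperateGrowth_res (hg.pd i) x s
  have hp2 := fun i => hasTemperateGrowth_res ((hg.pd i).pd i) x s
  unfold lapl
  change ∫ y, ∑ i, y i * res (pd i g) x s y ∂(gm n) =
    s * ∫ y, ∑ i, res (pd i (pd i g)) x s y ∂(gm n)
  rw [gint_sum fun i _ => by have := hp i; fun_prop, gint_sum fun i _ => hp2 i, Finset.mul_sum]
  refine Finset.sum_congr rfl fun i _ => ?_
  rw [stein_mul i (hp i), ← integral_const_mul]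
  exact integral_congr_ae (Filter.Eventually.of_forall fun y =>
    pd_comp_affine i (hg.pd i).differentiable x s y)

section

variable {n : ℕ} {u v : Eu n → ℝ} (x : Eu n)

lemma Ent.lapl_sub_eq (h : Ent u v) (y : Eu n) :
    lapl (fun y => u y - v y) y = u y * v y * (v y - u y) := by
  rw [lapl_sub h.hU.contDiff h.hV.contDiff, h.eqU, h.eqV]; ring

/-- The mean of `u - v` around a point where `u = v`, as controlled by the interaction. -/
lemma Ent.abs_mean_sub_le (h : Ent u v) (hx : u x = v x) {r B : ℝ} (hr : 0 < r)
    (hB : ∀ ρ, 0 ≤ ρ → ρ ≤ r →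
      ρ * |∫ y, SegregationBounds.res (fun z => u z * v z * (v z - u z)) x ρ y ∂(gm n)| ≤ B) :
    |∫ y, (SegregationBounds.res u x r y - SegregationBounds.res v x r y) ∂(gm n)| ≤ B * r := by
  have hd : Function.HasTemperateGrowth (fun z => u z - v z) := by
    have := h.hU; have := h.hV; fun_prop
  have hf := fun s : ℝ => hasDerivAt_average_lapl hd x s
  simp only [h.lapl_sub_eq] at hf
  have hmv := Convex.norm_image_sub_le_of_norm_hasDerivWithin_le (s := Set.Icc 0 r) (x := 0) (y := r)
    (C := B) (fun s _ => (hf s).hasDerivWithinAt) (fun s hs => by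
      rw [norm_mul, Real.norm_of_nonneg hs.1]
      exact hB s hs.1 hs.2) (convex_Icc 0 r) ⟨le_rfl, hr.le⟩ ⟨hr.le, le_rfl⟩
  simpa [hx, SegregationBounds.res, abs_of_pos hr] using hmv

lemma sq_sub_le {U V : Eu n → ℝ} (hU : CP U) (hV : CP V) (h0 : ∀ y, 0 ≤ U y * V y) :
    sq (fun y => V y - U y) ≤ Hs U V := by
  have h1 := CP.integral_mono ((hV.sub hU).pow 2) ((hU.pow 2).add (hV.pow 2))
    fun y => by nlinarith [h0 y]
  rwa [CP.integral_add (hU.pow 2) (hV.pow 2)] at h1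

lemma Sys.pot_le {β : ℝ} {U V : Eu n → ℝ} (h : Sys β U V) : pot β U V ≤ Ns β U V * Hs U V := by
  rw [Ns, div_mul_cancel₀ _ h.H_pos.ne', Ds]
  linarith [dir_nonneg U, dir_nonneg V]

lemma Sys.Ds_le {β : ℝ} {U V : Eu n → ℝ} (h : Sys β U V) : Ds U V ≤ Ns β U V * Hs U V := by
  rw [Ns, div_mul_cancel₀ _ h.H_pos.ne']
  linarith [h.pot_nonneg]

lemma sq_le_of_tame {f : Eu n → ℝ} (hf : f.HasTemperateGrowth) :
    sq f ≤ (∫ y, f y ∂(gm n)) ^ 2 + dir f := by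
  have h := gaussian_poincare hf.differentiable hf.poly (fun i => (hf.pd i).poly)
  rwa [dir_eq_sum hf]

lemma dir_sub_le {U V : Eu n → ℝ} (hU : U.HasTemperateGrowth) (hV : V.HasTemperateGrowth) :
    dir (fun y => U y - V y) ≤ 2 * Ds U V := by
  have hUV : Function.HasTemperateGrowth (fun y => U y - V y) := by fun_prop
  have h := CP.integral_mono (hasTemperateGrowth_gdot hUV hUV).cp
    (((hasTemperateGrowth_gdot hU hU).cp.add (hasTemperateGrowth_gdot hV hV).cp).const_mul 2)
    fun y => by
      unfold gdot
      rw [← Finset.sum_add_distrib, Finset.mul_sum]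
      refine Finset.sum_le_sum fun i _ => ?_
      rw [pd_sub i hU.differentiable.differentiableAt hV.differentiable.differentiableAt]
      nlinarith [sq_nonneg (pd i U y + pd i V y)]
  rwa [integral_const_mul, CP.integral_add (hasTemperateGrowth_gdot hU hU).cp
    (hasTemperateGrowth_gdot hV hV).cp] at h

/-- At the segregation scale the frequency is bounded below. -/
lemma Ent.NN_ge (h : Ent u v) (hx : u x = v x) {r : ℝ} (hr : 0 < r) (hrH : r ^ 2 * HH u v x r = 1) :
    1 / 9 ≤ NN u v x r := by
  set N := NN u v x r with hN
  set H := HH u v x r with hH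
  have hN0 : 0 ≤ N := (h.res x hr).Ns_nonneg
  have hH0 : 0 < H := h.HH_pos x hr
  set m := √N with hm
  have hm0 : 0 ≤ m := Real.sqrt_nonneg _
  have hm2 : m ^ 2 = N := Real.sq_sqrt hN0
  have hB := h.abs_mean_sub_le x hx (B := m * H) hr fun ρ h0 hρ => by
    rcases h0.eq_or_lt with rfl | h0
    · simp only [zero_mul]; positivity
    have hs := h.res x h0
    have hU := hs.hU.cp
    have hV := hs.hV.cp
    have hpos : ∀ y, 0 ≤ SegregationBounds.res u x ρ y * SegregationBounds.res v x ρ y :=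
      fun y => (mul_pos (hs.posU y) (hs.posV y)).le
    have c := (hU.mul hV).cauchy_schwarz (hV.sub hU)
    have c1 := sq_sub_le hU hV hpos
    have c2 : ρ ^ 2 * sq (fun y => SegregationBounds.res u x ρ y * SegregationBounds.res v x ρ y) ≤
        N * HH u v x ρ := by
      have := hs.pot_le
      have e : pot (ρ ^ 2) (SegregationBounds.res u x ρ) (SegregationBounds.res v x ρ) =
          ρ ^ 2 * sq (fun y => SegregationBounds.res u x ρ y * SegregationBounds.res v x ρ y) := by
        simp only [pot, sq, mul_pow]
      rw [← e]
      refine this.trans (mul_le_mul_of_nonneg_right ?_ hs.H_pos.le)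
      exact h.monotoneOn_NN x h0 hr hρ
    have c3 : HH u v x ρ ≤ H := h.monotoneOn_HH x h0.le hr.le hρ
    have c4 := h.HH_pos x h0
    have c5 : (ρ * ∫ y, SegregationBounds.res (fun z => u z * v z * (v z - u z)) x ρ y ∂(gm n)) ^ 2
        ≤ (m * H) ^ 2 := by
      rw [mul_pow, mul_pow, hm2]
      calc _ ≤ _ := mul_le_mul_of_nonneg_left c (by positivity)
        _ = (ρ ^ 2 * sq (fun y => SegregationBounds.res u x ρ y * SegregationBounds.res v x ρ y)) *
          sq (fun y => SegregationBounds.res v x ρ y - SegregationBounds.res u x ρ y) := by ring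
        _ ≤ (N * H) * H := mul_le_mul (c2.trans (mul_le_mul_of_nonneg_left c3 hN0)) (c1.trans c3)
          (sq_nonneg' _) (by positivity)
        _ = _ := by ring
    have c6 := abs_le_of_sq_le_sq c5 (by positivity)
    rwa [abs_mul, abs_of_pos h0] at c6
  have hs := h.res x hr
  have hU := hs.hU
  have hV := hs.hV
  have p1 := sq_le_of_tame (f := fun y => SegregationBounds.res u x r y -
    SegregationBounds.res v x r y) (by fun_prop)
  have p2 := dir_sub_le hU hV
  have p3 := hs.Ds_le
  change _ ≤ N * H at p3
  have p4 : sq (fun y => SegregationBounds.res u x r y - SegregationBounds.res v x r y) =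
      H - 2 * ∫ y, SegregationBounds.res u x r y * SegregationBounds.res v x r y ∂(gm n) := by
    have e : ∀ y, (SegregationBounds.res u x r y - SegregationBounds.res v x r y) ^ 2 =
      (SegregationBounds.res u x r y ^ 2 + SegregationBounds.res v x r y ^ 2) -
        2 * (SegregationBounds.res u x r y * SegregationBounds.res v x r y) := fun y => by ring
    simp only [sq, e]
    rw [gint_sub (by fun_prop) (by fun_prop), integral_const_mul, hH, HH, eq_sq_add_sq hU hV]
  have p5 := (hU.cp.mul hV.cp).integral_sq_le
  have p6 := hs.pot_le
  change _ ≤ N * H at p6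
  have e : pot (r ^ 2) (SegregationBounds.res u x r) (SegregationBounds.res v x r) =
      r ^ 2 * sq (fun y => SegregationBounds.res u x r y * SegregationBounds.res v x r y) := by
    simp only [pot, sq, mul_pow]
  rw [e] at p6
  have p7 : ∫ y, SegregationBounds.res u x r y * SegregationBounds.res v x r y ∂(gm n) ≤ m * H := by
    refine (abs_le_of_sq_le_sq' (p5.trans ?_) (by positivity)).2
    calc sq (fun y => SegregationBounds.res u x r y * SegregationBounds.res v x r y)
        = H * (r ^ 2 * sq (fun y => SegregationBounds.res u x r y *
          SegregationBounds.res v x r y)) := by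
            linear_combination -(sq (fun y => SegregationBounds.res u x r y *
              SegregationBounds.res v x r y)) * hrH
      _ ≤ H * (N * H) := mul_le_mul_of_nonneg_left p6 hH0.le
      _ = _ := by rw [← hm2]; ring
  have p8 : (∫ y, (SegregationBounds.res u x r y - SegregationBounds.res v x r y) ∂(gm n)) ^ 2 ≤
      N * H := by
    have := sq_le_sq.2 (hB.trans (le_abs_self _))
    calc _ ≤ _ := this
      _ = m ^ 2 * H * (r ^ 2 * H) := by ring
      _ = _ := by rw [hrH, hm2, mul_one]
  have p9 : H * 1 ≤ H * (2 * m + 3 * m ^ 2) := by rw [hm2]; linarith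
  have p10 := le_of_mul_le_mul_left p9 hH0
  have : 1 / 3 ≤ m := by by_contra! hlt; nlinarith
  rw [← hm2]; nlinarith

/-- Beyond the segregation scale the mass grows at a definite rate. -/
lemma Ent.sq_le_mul_HH_pow (h : Ent u v) (hx : u x = v x) {a r : ℝ} (ha : 0 < a)
    (haH : a ^ 2 * HH u v x a = 1) (har : a ≤ r) : r ^ 2 ≤ a ^ 20 * HH u v x r ^ 9 := by
  have hr := ha.trans_le har
  have hHa := h.HH_pos x ha
  have hHr := h.HH_pos x hr
  have h1 := h.monotoneOn_log_HH_sub x ha Set.self_mem_Ici har har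
  simp only at h1
  have h2 := h.NN_ge x hx ha haH
  have h3 := congrArg Real.log haH
  rw [Real.log_mul (by positivity) hHa.ne', Real.log_pow, Real.log_one] at h3
  have h4 := Real.log_le_log ha har
  rw [← Real.log_le_log_iff (by positivity) (by positivity), Real.log_mul (by positivity)
    (by positivity), Real.log_pow, Real.log_pow, Real.log_pow]
  push_cast at *
  nlinarith [mul_le_mul_of_nonneg_right h2 (sub_nonneg.2 h4)]

/-- Every point has a segregation scale. -/
lemma Ent.exists_scale (h : Ent u v) : ∃ a : ℝ, 0 < a ∧ a ^ 2 * HH u v x a = 1 := by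
  have hw : 0 < u x ^ 2 + v x ^ 2 := by
    have := h.posU x; positivity
  set b := (√(u x ^ 2 + v x ^ 2))⁻¹ with hb
  have hb0 : 0 < b := by positivity
  have hb2 : b ^ 2 * (u x ^ 2 + v x ^ 2) = 1 := by
    rw [hb, inv_pow, Real.sq_sqrt hw.le, inv_mul_cancel₀ hw.ne']
  have hc : Continuous fun r => r ^ 2 * HH u v x r := by
    have := h.continuous_HH x; fun_prop
  have h1 : (1:ℝ) ∈ Set.Icc ((0:ℝ) ^ 2 * HH u v x 0) (b ^ 2 * HH u v x b) := by
    refine ⟨by simp, ?_⟩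
    rw [← hb2]
    exact mul_le_mul_of_nonneg_left (h.sq_add_sq_le_HH x hb0.le) (by positivity)
  obtain ⟨a, ha, hae⟩ := intermediate_value_Icc hb0.le hc.continuousOn h1
  refine ⟨a, lt_of_le_of_ne ha.1 ?_, hae⟩
  rintro rfl
  simp at hae

end

/-- Smallness of the solution on its free boundary. -/
lemma exists_sq_add_sq_le_of_eq (n : ℕ) : ∃ K : ℝ, 1 ≤ K ∧ ∀ u v : Eu n → ℝ, Ent u v →
    ∀ x : Eu n, ∀ r ℓ : ℝ, 0 < r → 1 ≤ ℓ → r ^ 2 * HH u v x r = ℓ ^ 120 → ∀ y : Eu n,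
      u (x + r • y) = v (x + r • y) →
      ℓ ^ 12 * (u (x + r • y) ^ 2 + v (x + r • y) ^ 2) ≤ K * HH u v x r * (1 + ‖y‖) ^ 2 := by
  obtain ⟨K, hK, hKH⟩ := exists_HH_le n
  refine ⟨K, hK, fun u v h x r ℓ hr hℓ hL y hy => ?_⟩
  have hH := hKH u v h x r hr y
  set z := x + r • y with hz
  set w := u z ^ 2 + v z ^ 2 with hw
  set H := HH u v x r with hHdef
  set G := K * H * (1 + ‖y‖) ^ 2 with hG
  have hw0 : 0 ≤ w := by positivity
  have hH0 : 0 < H := h.HH_pos x hr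
  have hy0 := norm_nonneg y
  have hHG : H ≤ G := by
    rw [hG, mul_assoc, mul_left_comm]
    exact le_mul_of_one_le_right hH0.le
      (one_le_mul_of_one_le_of_one_le hK (one_le_pow₀ (by linarith)))
  obtain ⟨a, ha, haH⟩ := h.exists_scale z
  have haw : a ^ 2 * w ≤ 1 := by
    rw [← haH]
    exact mul_le_mul_of_nonneg_left (h.sq_add_sq_le_HH z ha.le) (by positivity)
  have hrρ : r ≤ r * (1 + ‖y‖) := by nlinarith
  rcases le_total a (r * (1 + ‖y‖)) with hc | hc
  · have h1 := h.sq_le_mul_HH_pow z hy ha haH hc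
    have h2 : HH u v z (r * (1 + ‖y‖)) ^ 9 ≤ G ^ 9 :=
      pow_le_pow_left₀ (h.HH_pos z (by positivity)).le hH 9
    have h3 : r ^ 2 ≤ a ^ 20 * G ^ 9 :=
      (pow_le_pow_left₀ hr.le hrρ 2).trans (h1.trans (mul_le_mul_of_nonneg_left h2 (by positivity)))
    have h4 : (ℓ ^ 12 * w) ^ 10 ≤ G ^ 10 := by
      calc (ℓ ^ 12 * w) ^ 10 = ℓ ^ 120 * w ^ 10 := by ring
        _ = r ^ 2 * (H * w ^ 10) := by rw [← hL]; ring
        _ ≤ (a ^ 20 * G ^ 9) * (H * w ^ 10) := mul_le_mul_of_nonneg_right h3 (by positivity)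
        _ = (a ^ 2 * w) ^ 10 * (G ^ 9 * H) := by ring
        _ ≤ 1 * (G ^ 9 * G) := by
          refine mul_le_mul (pow_le_one₀ (by positivity) haw) ?_ (by positivity) zero_le_one
          exact mul_le_mul_of_nonneg_left hHG (by positivity)
        _ = _ := by ring
    exact (pow_le_pow_iff_left₀ (by positivity) (by positivity) (by norm_num)).1 h4
  · have h1 : r ^ 2 * w ≤ 1 := (mul_le_mul_of_nonneg_right
      (pow_le_pow_left₀ hr.le (hrρ.trans hc) 2) hw0).trans haw
    calc ℓ ^ 12 * w ≤ ℓ ^ 120 * w :=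
          mul_le_mul_of_nonneg_right (pow_le_pow_right₀ hℓ (by norm_num)) hw0
      _ = H * (r ^ 2 * w) := by rw [← hL]; ring
      _ ≤ H * 1 := mul_le_mul_of_nonneg_left h1 hH0.le
      _ ≤ G := by linarith

/-! ### Normalised solutions -/

section Scaling

variable {n : ℕ} {U V : Eu n → ℝ} {β : ℝ}

lemma sq_const_mul (f : Eu n → ℝ) (k : ℝ) : sq (fun y => k * f y) = k ^ 2 * sq f := by
  simp only [sq, mul_pow, integral_const_mul]

lemma dir_const_mul {f : Eu n → ℝ} (hf : f.HasTemperateGrowth) (k : ℝ) :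
    dir (fun y => k * f y) = k ^ 2 * dir f := by
  rw [dir, dir, ← integral_const_mul]
  refine integral_congr_ae (Filter.Eventually.of_forall fun y => ?_)
  simp only [gdot, Finset.mul_sum]
  refine Finset.sum_congr rfl fun i _ => ?_
  rw [pd_const_mul i hf.differentiable.differentiableAt]; ring

lemma sq_eul_const_mul {f : Eu n → ℝ} (hf : f.HasTemperateGrowth) (k : ℝ) :
    sq (eul (fun y => k * f y)) = k ^ 2 * sq (eul f) := by
  rw [← sq_const_mul]
  exact congrArg sq (funext fun y => eul_const_mul hf k y)

lemma ue_const_mul {f : Eu n → ℝ} (hf : f.HasTemperateGrowth) (k : ℝ) :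
    ue (fun y => k * f y) = k ^ 2 * ue f := by
  rw [ue, ue, ← integral_const_mul]
  refine integral_congr_ae (Filter.Eventually.of_forall fun y => ?_)
  simp only [eul_const_mul hf]; ring

lemma pot_const_mul {c k : ℝ} (hck : c * k = 1) :
    pot (β * c ^ 2) (fun y => k * U y) (fun y => k * V y) = k ^ 2 * pot β U V := by
  have e : ∀ y, (k * U y) ^ 2 * (k * V y) ^ 2 = k ^ 4 * (U y ^ 2 * V y ^ 2) := fun y => by ring
  simp only [pot, e, integral_const_mul]
  linear_combination (β * k ^ 2 * (∫ y, U y ^ 2 * V y ^ 2 ∂(gm n)) * (c * k + 1)) * hck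

lemma Sys.const_mul (h : Sys β U V) {c k : ℝ} (hk : 0 < k) (hck : c * k = 1) :
    Sys (β * c ^ 2) (fun y => k * U y) (fun y => k * V y) where
  hU := by have := h.hU; fun_prop
  hV := by have := h.hV; fun_prop
  posU y := mul_pos hk (h.posU y)
  posV y := mul_pos hk (h.posV y)
  eqU y := by
    rw [lapl_const_mul h.hU.contDiff, h.eqU]
    linear_combination -(k * β * U y * V y ^ 2 * (c * k + 1)) * hck
  eqV y := by
    rw [lapl_const_mul h.hV.contDiff, h.eqV]
    linear_combination -(k * β * V y * U y ^ 2 * (c * k + 1)) * hck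
  hβ := by
    have := h.hβ
    have : c ≠ 0 := by rintro rfl; simp at hck
    positivity

end Scaling

/-- Solutions of unit mass and frequency at most one, with coupling `ℓ ^ 120`. -/
structure Nrm {n : ℕ} (K ℓ : ℝ) (U V : Eu n → ℝ) : Prop extends Sys (ℓ ^ 120) U V where
  one_le_K : 1 ≤ K
  one_le : 1 ≤ ℓ
  mass : Hs U V = 1
  energy : Ds U V + pot (ℓ ^ 120) U V ≤ 1
  bound : ∀ y, U y ^ 2 + V y ^ 2 ≤ K * (1 + ‖y‖) ^ 2
  coincidence : ∀ y, U y = V y → ℓ ^ 12 * (U y ^ 2 + V y ^ 2) ≤ K * (1 + ‖y‖) ^ 2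

/-- The normalised rescaling of a solution. -/
lemma exists_nrm (n : ℕ) : ∃ K : ℝ, ∀ u v : Eu n → ℝ, Ent u v →
    ∀ x : Eu n, ∀ r ℓ k : ℝ, 0 < r → 1 ≤ ℓ → r ^ 2 * HH u v x r = ℓ ^ 120 → 0 < k →
      k ^ 2 * HH u v x r = 1 → Nrm K ℓ (fun y => k * res u x r y) (fun y => k * res v x r y) := by
  obtain ⟨K₁, hK₁, h₁⟩ := exists_sq_add_sq_le n
  obtain ⟨K₂, hK₂, h₂⟩ := exists_sq_add_sq_le_of_eq n
  refine ⟨max K₁ K₂, fun u v h x r ℓ k hr hℓ hL hk hkH => ?_⟩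
  have hs := h.res x hr
  have hck : k⁻¹ * k = 1 := inv_mul_cancel₀ hk.ne'
  have hβ : r ^ 2 * k⁻¹ ^ 2 = ℓ ^ 120 := by
    rw [← hL]; field_simp; linarith
  have hS := hs.const_mul hk hck
  have hP := pot_const_mul (n := n) (U := res u x r) (V := res v x r) (β := r ^ 2) hck
  rw [hβ] at hS hP
  refine ⟨hS, hK₁.trans (le_max_left _ _), hℓ, ?_, ?_, fun y => ?_, fun y hy => ?_⟩
  · rw [Hs, sq_const_mul, sq_const_mul, ← mul_add]; exact hkH
  · rw [hP, Ds, dir_const_mul hs.hU, dir_const_mul hs.hV, ← mul_add, ← mul_add]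
    have h1 := h.NN_le_one x hr
    rw [NN, Ns, div_le_one hs.H_pos] at h1
    calc _ ≤ k ^ 2 * HH u v x r := mul_le_mul_of_nonneg_left h1 (by positivity)
      _ = 1 := hkH
  · calc (k * res u x r y) ^ 2 + (k * res v x r y) ^ 2
        = k ^ 2 * (u (x + r • y) ^ 2 + v (x + r • y) ^ 2) := by simp only [res]; ring
      _ ≤ k ^ 2 * _ := mul_le_mul_of_nonneg_left (h₁ u v h x r hr y) (by positivity)
      _ = K₁ * (1 + ‖y‖) ^ 2 * (k ^ 2 * HH u v x r) := by ring
      _ ≤ _ := by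
        rw [hkH, mul_one]
        exact mul_le_mul_of_nonneg_right (le_max_left _ _) (by positivity)
  · have hy' : u (x + r • y) = v (x + r • y) := mul_left_cancel₀ hk.ne' hy
    calc ℓ ^ 12 * ((k * res u x r y) ^ 2 + (k * res v x r y) ^ 2)
        = k ^ 2 * (ℓ ^ 12 * (u (x + r • y) ^ 2 + v (x + r • y) ^ 2)) := by simp only [res]; ring
      _ ≤ k ^ 2 * _ := mul_le_mul_of_nonneg_left (h₂ u v h x r ℓ hr hℓ hL y hy') (by positivity)
      _ = K₂ * (1 + ‖y‖) ^ 2 * (k ^ 2 * HH u v x r) := by ring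
      _ ≤ _ := by
        rw [hkH, mul_one]
        exact mul_le_mul_of_nonneg_right (le_max_right _ _) (by positivity)

section Normalised

variable {n : ℕ} {K ℓ : ℝ} {U V : Eu n → ℝ}

lemma Nrm.symm (h : Nrm K ℓ U V) : Nrm K ℓ V U where
  toSys := h.toSys.symm
  one_le_K := h.one_le_K
  one_le := h.one_le
  mass := by rw [← h.mass, Hs, Hs, add_comm]
  energy := by
    have := h.energy
    rwa [pot_comm, Ds, add_comm (dir U)] at this
  bound y := by rw [add_comm]; exact h.bound y
  coincidence y hy := by rw [add_comm]; exact h.coincidence y hy.symm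

lemma Nrm.U_le (h : Nrm K ℓ U V) (y : Eu n) : U y ≤ K * (1 + ‖y‖) := by
  have h1 := h.bound y
  have h2 := h.one_le_K
  have hy := norm_nonneg y
  refine (abs_le_of_sq_le_sq' (a := U y) ?_ (by positivity)).2
  calc U y ^ 2 ≤ K * (1 + ‖y‖) ^ 2 := by nlinarith [sq_nonneg (V y)]
    _ ≤ K ^ 2 * (1 + ‖y‖) ^ 2 := mul_le_mul_of_nonneg_right (by nlinarith) (by positivity)
    _ = _ := by ring

lemma Nrm.U_le_of_eq (h : Nrm K ℓ U V) {y : Eu n} (hUV : U y = V y) :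
    ℓ ^ 6 * U y ≤ K * (1 + ‖y‖) := by
  have h1 := h.coincidence y hUV
  have h2 := h.one_le_K
  have hℓ := h.one_le
  have hy := norm_nonneg y
  refine (abs_le_of_sq_le_sq' ?_ (by positivity)).2
  calc (ℓ ^ 6 * U y) ^ 2 = ℓ ^ 12 * U y ^ 2 := by ring
    _ ≤ ℓ ^ 12 * (U y ^ 2 + V y ^ 2) :=
      mul_le_mul_of_nonneg_left (by linarith [sq_nonneg (V y)]) (by positivity)
    _ ≤ K * (1 + ‖y‖) ^ 2 := h1
    _ ≤ K ^ 2 * (1 + ‖y‖) ^ 2 := mul_le_mul_of_nonneg_right (by nlinarith) (by positivity)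
    _ = _ := by ring

/-- The smaller of the two functions is small. -/
lemma Nrm.V_le_of_le (h : Nrm K ℓ U V) {y : Eu n} (hVU : V y ≤ U y) :
    ℓ ^ 6 * V y ≤ (2 * K + 2 * n) * (1 + ‖y‖ ^ 2) := by
  by_contra! hlt
  have hK := h.one_le_K
  have hℓ := h.one_le
  have hn : (0:ℝ) ≤ n := Nat.cast_nonneg n
  set A : ℝ := (2 * K + 2 * n) / ℓ ^ 6 with hA
  have hA0 : 0 < A := by positivity
  have hAℓ : A * ℓ ^ 6 = 2 * K + 2 * n := by rw [hA]; field_simp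
  have hℓ6 : (1:ℝ) ≤ ℓ ^ 6 := one_le_pow₀ hℓ
  have hg1 : A < V y - A * ‖y‖ ^ 2 := by
    have : ℓ ^ 6 * (A * (1 + ‖y‖ ^ 2)) < ℓ ^ 6 * V y := by
      rw [← mul_assoc, mul_comm _ A, hAℓ]; exact hlt
    have := lt_of_mul_lt_mul_left this (by positivity)
    linarith
  set g : Eu n → ℝ := fun z => V z - A * ‖z‖ ^ 2 with hg
  have hgc : ContDiff ℝ (⊤ : ℕ∞) g :=
    h.hV.contDiff.sub (contDiff_const.mul (contDiff_norm_sq ℝ))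
  have hfar : ∀ z : Eu n, 1 + 2 * K / A ≤ ‖z‖ → g z ≤ A := by
    intro z hz
    have h1 := h.symm.U_le z
    have h2 : 2 * K ≤ A * ‖z‖ := by
      have : 2 * K / A ≤ ‖z‖ := by linarith
      rw [div_le_iff₀ hA0] at this; linarith
    have h3 : 1 ≤ ‖z‖ := by
      have : 0 ≤ 2 * K / A := by positivity
      linarith
    have : V z ≤ A * ‖z‖ ^ 2 := by nlinarith
    simp only [hg]; linarith
  set S := {z : Eu n | V z ≤ U z} ∩ closedBall 0 (1 + 2 * K / A) with hS
  have hSc : IsCompact S :=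
    (isCompact_closedBall _ _).inter_left (isClosed_le h.hV.continuous h.hU.continuous)
  have hyS : y ∈ S := by
    refine ⟨hVU, ?_⟩
    rw [mem_closedBall_zero_iff]
    by_contra! hc
    exact absurd (hfar y hc.le) (not_le.2 hg1)
  obtain ⟨z, hzS, hzmax⟩ := hSc.exists_isMaxOn ⟨y, hyS⟩ hgc.continuous.continuousOn
  have hgz : A < g z := hg1.trans_le (hzmax hyS)
  have hmaxU : ∀ w, V w ≤ U w → g w ≤ g z := by
    intro w hw
    by_cases hc : w ∈ closedBall (0 : Eu n) (1 + 2 * K / A)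
    · exact hzmax ⟨hw, hc⟩
    · rw [mem_closedBall_zero_iff, not_le] at hc
      exact (hfar w hc.le).trans hgz.le
  have hAz : A * (1 + ‖z‖ ^ 2) < V z := by simp only [hg] at hgz; linarith
  rcases (show V z ≤ U z from hzS.1).eq_or_lt with he | hlt'
  · have h1 := h.U_le_of_eq he.symm
    rw [← he] at h1
    have h2 : ℓ ^ 6 * (A * (1 + ‖z‖ ^ 2)) < ℓ ^ 6 * V z :=
      mul_lt_mul_of_pos_left hAz (by positivity)
    rw [← mul_assoc, mul_comm _ A, hAℓ] at h2
    nlinarith [norm_nonneg z, sq_nonneg (‖z‖ - 1)]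
  · have hloc : IsLocalMax g z := by
      have : ∀ᶠ w in nhds z, V w < U w :=
        (isOpen_lt h.hV.continuous h.hU.continuous).mem_nhds hlt'
      filter_upwards [this] with w hw using hmaxU w hw.le
    have h1 := lapl_nonpos_of_isLocalMax hgc hloc
    rw [hg, lapl_sub h.hV.contDiff (contDiff_const.mul (contDiff_norm_sq ℝ)),
      lapl_const_mul (contDiff_norm_sq ℝ), lapl_norm_sq, h.eqV] at h1
    have hVz : A < V z := by nlinarith [mul_nonneg hA0.le (sq_nonneg ‖z‖)]
    have h2 : A * A ^ 2 ≤ V z * U z ^ 2 := 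
      mul_le_mul hVz.le (pow_le_pow_left₀ hA0.le (hVz.le.trans hlt'.le) 2) (by positivity)
        (hA0.trans hVz).le
    have h3 : (A * ℓ ^ 6) ^ 2 ≤ ℓ ^ 120 * A ^ 2 := by
      rw [mul_pow, mul_comm, ← pow_mul]
      exact mul_le_mul_of_nonneg_right (pow_le_pow_right₀ hℓ (by norm_num)) (by positivity)
    rw [hAℓ] at h3
    have h4 : ℓ ^ 120 * (A * A ^ 2) ≤ ℓ ^ 120 * (V z * U z ^ 2) :=
      mul_le_mul_of_nonneg_left h2 (by positivity)
    have h5 : A * (2 * K + 2 * n) ^ 2 ≤ A * (2 * n) := by nlinarith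
    have h6 := le_of_mul_le_mul_left h5 hA0
    nlinarith

lemma Nrm.abs_lapl_le (h : Nrm K ℓ U V) (y : Eu n) :
    |lapl U y| ≤ ℓ ^ 114 * ((2 * K + 2 * n) * K ^ 2) * (1 + ‖y‖) ^ 4 := by
  have hK := h.one_le_K
  have hℓ := h.one_le
  have hy := norm_nonneg y
  have hn : (0:ℝ) ≤ n := Nat.cast_nonneg n
  have hU := h.posU y
  have hV := h.posV y
  have bU := h.U_le y
  have bV := h.symm.U_le y
  have ht : 1 + ‖y‖ ^ 2 ≤ (1 + ‖y‖) ^ 2 := by nlinarith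
  rw [h.eqU, abs_of_pos (by positivity)]
  have key : ∀ m b c : ℝ, 0 < m → 0 < b → 0 < c → ℓ ^ 6 * m ≤ (2 * K + 2 * n) * (1 + ‖y‖ ^ 2) →
      b ≤ K * (1 + ‖y‖) → c ≤ K * (1 + ‖y‖) →
      ℓ ^ 114 * (ℓ ^ 6 * m * (b * c)) ≤
        ℓ ^ 114 * ((2 * K + 2 * n) * K ^ 2) * (1 + ‖y‖) ^ 4 := by
    intro m b c hm hb hc h1 h2 h3
    rw [mul_assoc (ℓ ^ 114)]
    refine mul_le_mul_of_nonneg_left ?_ (by positivity)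
    calc ℓ ^ 6 * m * (b * c) ≤ ((2 * K + 2 * n) * (1 + ‖y‖) ^ 2) *
          ((K * (1 + ‖y‖)) * (K * (1 + ‖y‖))) := by
          refine mul_le_mul (h1.trans (mul_le_mul_of_nonneg_left ht (by positivity)))
            (mul_le_mul h2 h3 hc.le (by positivity)) (by positivity) (by positivity)
      _ = _ := by ring
  rcases le_total (V y) (U y) with hc | hc
  · have := key (V y) (U y) (V y) hV hU hV (h.V_le_of_le hc) bU bV
    linarith [show ℓ ^ 114 * (ℓ ^ 6 * V y * (U y * V y)) = ℓ ^ 120 * (U y * V y ^ 2) by ring]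
  · have := key (U y) (V y) (V y) hU hV hV (h.symm.V_le_of_le hc) bV bV
    linarith [show ℓ ^ 114 * (ℓ ^ 6 * U y * (V y * V y)) = ℓ ^ 120 * (U y * V y ^ 2) by ring]

end Normalised

lemma integral_res_pd {n : ℕ} {f : Eu n → ℝ} (hf : f.HasTemperateGrowth) (i : Fin n) (x : Eu n)
    (s : ℝ) : s * ∫ y, pd i f (x + s • y) ∂(gm n) = ∫ y, y i * res f x s y ∂(gm n) := by
  rw [stein_mul i (hasTemperateGrowth_res hf x s), ← integral_const_mul]
  exact integral_congr_ae (Filter.Eventually.of_forall fun y =>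
    (pd_comp_affine i hf.differentiable x s y).symm)

/-- Interpolation of the gradient between the function and its Laplacian. -/
lemma abs_pd_le_of_lapl {n : ℕ} {f : Eu n → ℝ} (hf : f.HasTemperateGrowth) {M F ρ : ℝ}
    (hρ : 0 < ρ) (hρ1 : ρ ≤ 1) (hM : ∀ y, |f y| ≤ M * (1 + ‖y‖) ^ 4)
    (hF : ∀ y, |lapl f y| ≤ F * (1 + ‖y‖) ^ 4) (i : Fin n) (y : Eu n) :
    |pd i f y| ≤ (M / ρ + F * ρ) * (∫ η : Eu n, ‖η‖ * (1 + ‖η‖) ^ 4 ∂(gm n)) * (1 + ‖y‖) ^ 4 := by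
  set J := ∫ η : Eu n, ‖η‖ * (1 + ‖η‖) ^ 4 ∂(gm n) with hJ
  have hw : CP (fun η : Eu n => ‖η‖ * (1 + ‖η‖) ^ 4) :=
    CP.norm.mul (((CP.const 1).add CP.norm).pow 4)
  have key : ∀ (g : Eu n → ℝ) (B s : ℝ), g.HasTemperateGrowth → 0 ≤ s → s ≤ 1 →
      (∀ y, |g y| ≤ B * (1 + ‖y‖) ^ 4) →
      |∫ η, η i * res g y s η ∂(gm n)| ≤ B * (1 + ‖y‖) ^ 4 * J := by
    intro g B s hg hs0 hs1 hB
    have hB0 : 0 ≤ B := by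
      have := (abs_nonneg _).trans (hB 0)
      simpa using this
    have hc : CP fun η : Eu n => η i * res g y s η := (CP.coord i).mul (hasTemperateGrowth_res hg y s).cp
    refine abs_integral_le_integral_abs.trans ?_
    rw [hJ, ← integral_const_mul]
    refine CP.integral_mono hc.abs (hw.const_mul _) fun η => ?_
    have h1 : 1 + ‖y + s • η‖ ≤ (1 + ‖y‖) * (1 + ‖η‖) := by
      have h2 := norm_add_le y (s • η)
      rw [norm_smul, Real.norm_of_nonneg hs0] at h2
      nlinarith [norm_nonneg y, norm_nonneg η, mul_le_mul_of_nonneg_right hs1 (norm_nonneg η),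
        mul_nonneg (norm_nonneg y) (norm_nonneg η)]
    have hη := norm_nonneg η
    have hy := norm_nonneg y
    rw [abs_mul]
    calc |η i| * |res g y s η| ≤ ‖η‖ * (B * ((1 + ‖y‖) * (1 + ‖η‖)) ^ 4) := by
          refine mul_le_mul (abs_coord_le η i) ((hB _).trans ?_) (abs_nonneg _) hη
          gcongr
      _ = _ := by ring
  have hd := fun s => hasDerivAt_average_lapl (hf.pd i) y s
  have hmv := Convex.norm_image_sub_le_of_norm_hasDerivWithin_le (s := Set.Icc 0 ρ) (x := 0) (y := ρ)
    (C := F * (1 + ‖y‖) ^ 4 * J) (fun s _ => (hd s).hasDerivWithinAt) (fun s hs => by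
      have e : ∀ η, lapl (pd i f) (y + s • η) = pd i (lapl f) (y + s • η) :=
        fun η => (pd_lapl i hf.contDiff _).symm
      simp only [e]
      rw [integral_res_pd hf.lapl]
      exact key _ _ s hf.lapl hs.1 (hs.2.trans hρ1) hF)
    (convex_Icc 0 ρ) ⟨le_rfl, hρ.le⟩ ⟨hρ.le, le_rfl⟩
  simp only [zero_smul, add_zero, integral_const, probReal_univ, one_smul, sub_zero,
    Real.norm_eq_abs, abs_of_pos hρ] at hmv
  have h1 := key f M ρ hf hρ.le hρ1 hM
  rw [← integral_res_pd hf, abs_mul, abs_of_pos hρ, mul_comm, ← le_div_iff₀ hρ] at h1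
  have h2 := abs_sub_abs_le_abs_sub (pd i f y) (∫ η, pd i f (y + ρ • η) ∂(gm n))
  rw [abs_sub_comm] at h2
  calc |pd i f y| ≤ M * (1 + ‖y‖) ^ 4 * J / ρ + F * (1 + ‖y‖) ^ 4 * J * ρ := by linarith
    _ = _ := by ring

/-- The gradient bound for normalised solutions. -/
lemma exists_grad_le (n : ℕ) (K : ℝ) : ∃ C : ℝ, 0 ≤ C ∧ ∀ (ℓ : ℝ) (U V : Eu n → ℝ), Nrm K ℓ U V →
    ∀ i y, |pd i U y| ≤ C * ℓ ^ 57 * (1 + ‖y‖) ^ 4 := by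
  set J := ∫ η : Eu n, ‖η‖ * (1 + ‖η‖) ^ 4 ∂(gm n) with hJ
  have hJ0 : 0 ≤ J := integral_nonneg fun η => by positivity
  refine ⟨(|K| + (2 * |K| + 2 * n) * K ^ 2) * J, by positivity, fun ℓ U V h i y => ?_⟩
  have hK := h.one_le_K
  rw [abs_of_pos (show 0 < K by linarith)]
  have hℓ := h.one_le
  have h57 : (1:ℝ) ≤ ℓ ^ 57 := one_le_pow₀ hℓ
  have h1 := abs_pd_le_of_lapl h.hU (M := K) (ρ := (ℓ ^ 57)⁻¹) (by positivity)
    (inv_le_one_of_one_le₀ h57) (fun y => by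
      have hy := norm_nonneg y
      rw [abs_of_pos (h.posU y)]
      refine (h.U_le y).trans (mul_le_mul_of_nonneg_left ?_ (by linarith))
      exact le_self_pow₀ (by linarith) (by norm_num)) h.abs_lapl_le i y
  refine h1.trans (le_of_eq ?_)
  rw [← hJ]
  field_simp

/-! ### Both components carry mass at the segregation scale -/

lemma Sys.monotoneOn_sqV {n : ℕ} {u v : Eu n → ℝ} (x : Eu n) (h : Sys 1 u v) :
    MonotoneOn (fun r => sq (SegregationBounds.res v x r)) (Set.Ici 0) := by
  refine monotoneOn_of_deriv_nonneg (convex_Ici 0) (continuous_sq_res h.hV x).continuousOn ?_ ?_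
  · rw [interior_Ici]
    exact fun r hr => (hasDerivAt_sq_res h.hV x hr).differentiableAt.differentiableWithinAt
  · rw [interior_Ici]
    intro r hr
    have hr0 : 0 < r := hr
    have hs := h.res x hr0
    rw [(hasDerivAt_sq_res h.hV x hr0).deriv, hs.ueV_eq]
    have := dir_nonneg (SegregationBounds.res v x r)
    have := hs.pot_nonneg
    positivity

lemma integral_sq_sq_le {n : ℕ} {f : Eu n → ℝ} (hf : CP f) (h0 : ∀ y, 0 ≤ f y) :
    sq f ^ 2 ≤ (∫ y, f y ∂(gm n)) * ∫ y, f y ^ 3 ∂(gm n) := by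
  have hs : CP (fun y => √(f y)) := by
    refine ⟨hf.1.sqrt, ((Poly.const 1).add hf.abs.2).mono fun y => ?_⟩
    have h1 := h0 y
    rw [abs_of_nonneg (Real.sqrt_nonneg _), abs_of_nonneg h1, abs_of_nonneg (by positivity)]
    exact Real.sqrt_le_iff.2 ⟨by positivity, by nlinarith⟩
  have h := hs.cauchy_schwarz (hs.mul hf)
  have e1 : ∀ y, √(f y) * (√(f y) * f y) = f y ^ 2 := fun y => by
    rw [← mul_assoc, Real.mul_self_sqrt (h0 y)]; ring
  have e2 : ∀ y, (√(f y) * f y) ^ 2 = f y ^ 3 := fun y => by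
    rw [mul_pow, Real.sq_sqrt (h0 y)]; ring
  simpa only [sq, e1, e2, Real.sq_sqrt (h0 _)] using h

lemma exists_le_sq_at_scale (n : ℕ) : ∃ c : ℝ, 0 < c ∧ ∀ u v : Eu n → ℝ, Ent u v → ∀ x : Eu n,
    u x = v x → ∀ a : ℝ, 0 < a → a ^ 2 * HH u v x a = 1 →
      c * HH u v x a ≤ sq (res v x a) := by
  obtain ⟨K, hK, hKw⟩ := exists_sq_add_sq_le n
  have hw : CP (fun η : Eu n => 1 + ‖η‖) := (CP.const 1).add CP.norm
  set J := ∫ η : Eu n, (1 + ‖η‖) ^ 4 ∂(gm n) with hJ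
  have hJ0 : 0 < J := (hw.pow 4).integral_pos fun η => by have := norm_nonneg η; positivity
  set C := (1 + K * √J) * (K ^ 3 * J) with hC
  have hC0 : 0 < C := by positivity
  refine ⟨min (1 / 2) (1 / (16 * C ^ 2)), by positivity, fun u v h x hx a ha haH => ?_⟩
  have hs := h.res x ha
  set H := HH u v x a with hH
  have hH0 : 0 < H := h.HH_pos x ha
  set s := √H with hsdef
  have hs2 : s ^ 2 = H := Real.sq_sqrt hH0.le
  have hs0 : 0 < s := by positivity
  have hV0 : 0 < sq (res v x a) := hs.symm.sqU_pos
  set B := √(sq (res v x a)) with hB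
  have hB2 : B ^ 2 = sq (res v x a) := Real.sq_sqrt hV0.le
  have hB0 : 0 < B := by positivity
  have hsJ : √J ^ 2 = J := Real.sq_sqrt hJ0.le
  have hbd : ∀ ρ, 0 ≤ ρ → ρ ≤ a → ∀ y, res u x ρ y ^ 2 + res v x ρ y ^ 2 ≤ K * H * (1 + ‖y‖) ^ 2 := by
    intro ρ h0 hρ y
    have h1 := hKw u v h x a ha ((ρ / a) • y)
    rw [smul_smul, mul_div_cancel₀ _ ha.ne', norm_smul, Real.norm_of_nonneg (by positivity)] at h1
    refine h1.trans ?_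
    have : ρ / a * ‖y‖ ≤ 1 * ‖y‖ :=
      mul_le_mul_of_nonneg_right ((div_le_one ha).2 hρ) (norm_nonneg y)
    gcongr
    linarith
  have h1 := h.abs_mean_sub_le x hx (B := a * (B * (K * H * √J))) ha fun ρ h0 hρ => by
    refine mul_le_mul hρ ?_ (abs_nonneg _) ha.le
    have hU := (hasTemperateGrowth_res h.hU x ρ).cp
    have hV := (hasTemperateGrowth_res h.hV x ρ).cp
    have c1 := hV.cauchy_schwarz (hU.mul (hV.sub hU))
    have c2 : sq (res v x ρ) ≤ sq (res v x a) := h.monotoneOn_sqV x h0 ha.le hρ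
    have c3 : sq (fun y => res u x ρ y * (res v x ρ y - res u x ρ y)) ≤ (K * H) ^ 2 * J := by
      rw [hJ, ← integral_const_mul]
      refine CP.integral_mono ((hU.mul (hV.sub hU)).pow 2) ((hw.pow 4).const_mul _) fun y => ?_
      have d1 := hbd ρ h0 hρ y
      have d2 : 0 < res u x ρ y := h.posU _
      have d3 : 0 < res v x ρ y := h.posV _
      have d4 : (res v x ρ y - res u x ρ y) ^ 2 ≤ res u x ρ y ^ 2 + res v x ρ y ^ 2 := by
        nlinarith [mul_pos d2 d3]
      have d5 : res u x ρ y ^ 2 ≤ res u x ρ y ^ 2 + res v x ρ y ^ 2 := by nlinarith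
      rw [mul_pow]
      calc _ ≤ (K * H * (1 + ‖y‖) ^ 2) * (K * H * (1 + ‖y‖) ^ 2) :=
            mul_le_mul (d5.trans d1) (d4.trans d1) (sq_nonneg _) (by positivity)
        _ = _ := by ring
    refine abs_le_of_sq_le_sq ?_ (by positivity)
    have e : ∀ y, res (fun z => u z * v z * (v z - u z)) x ρ y =
        res v x ρ y * (res u x ρ y * (res v x ρ y - res u x ρ y)) := fun y => by
      simp only [res]; ring
    simp only [e]
    calc _ ≤ _ := c1
      _ ≤ B ^ 2 * ((K * H) ^ 2 * J) := by
        rw [hB2]; exact mul_le_mul c2 c3 (sq_nonneg' _) hV0.le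
      _ = _ := by rw [mul_pow B, mul_pow (K * H), hsJ]
  have h2 : a * (B * (K * H * √J)) * a = K * √J * B := by
    calc _ = K * √J * B * (a ^ 2 * H) := by ring
      _ = _ := by rw [haH, mul_one]
  rw [h2, CP.integral_sub hs.hU.cp hs.hV.cp] at h1
  have h3 : ∫ y, res v x a y ∂(gm n) ≤ B :=
    (abs_le_of_sq_le_sq' (hs.hV.cp.integral_sq_le.trans_eq hB2.symm) hB0.le).2
  have h4 : ∫ y, res u x a y ∂(gm n) ≤ (1 + K * √J) * B := by
    have := (abs_le.1 h1).2; linarith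
  have h5 : ∫ y, res u x a y ^ 3 ∂(gm n) ≤ K ^ 3 * s ^ 3 * J := by
    rw [hJ, ← integral_const_mul]
    refine CP.integral_mono (hs.hU.cp.pow 3) ((hw.pow 4).const_mul _) fun y => ?_
    have hy := norm_nonneg y
    have d1 := hbd a ha.le le_rfl y
    have d2 : 0 < res u x a y := h.posU _
    have d3 : res u x a y ≤ K * s * (1 + ‖y‖) := by
      refine (abs_le_of_sq_le_sq' ?_ (by positivity)).2
      calc res u x a y ^ 2 ≤ K * H * (1 + ‖y‖) ^ 2 := by nlinarith [sq_nonneg (res v x a y)]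
        _ ≤ K ^ 2 * H * (1 + ‖y‖) ^ 2 := by gcongr; nlinarith
        _ = _ := by rw [← hs2]; ring
    calc res u x a y ^ 3 ≤ (K * s * (1 + ‖y‖)) ^ 3 := pow_le_pow_left₀ d2.le d3 3
      _ = K ^ 3 * s ^ 3 * (1 + ‖y‖) ^ 3 := by ring
      _ ≤ _ := mul_le_mul_of_nonneg_left (pow_le_pow_right₀ (by linarith) (by norm_num))
        (by positivity)
  have h6 := integral_sq_sq_le hs.hU.cp fun y => (hs.posU y).le
  have h7 : sq (res u x a) ^ 2 ≤ C * B * s ^ 3 := by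
    refine h6.trans ?_
    calc _ ≤ ((1 + K * √J) * B) * (K ^ 3 * s ^ 3 * J) :=
          mul_le_mul h4 h5 (integral_nonneg fun y => pow_nonneg (hs.posU y).le 3) (by positivity)
      _ = _ := by rw [hC]; ring
  have h8 : sq (res u x a) = H - B ^ 2 := by rw [hB2, hH, HH, Hs]; ring
  rw [← hB2]
  by_contra! hlt
  have h9 : B ^ 2 < 1 / 2 * H := hlt.trans_le (mul_le_mul_of_nonneg_right (min_le_left _ _) hH0.le)
  have h10 : B ^ 2 < 1 / (16 * C ^ 2) * H :=
    hlt.trans_le (mul_le_mul_of_nonneg_right (min_le_right _ _) hH0.le)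
  have h11 : (4 * C * B) ^ 2 < s ^ 2 := by
    rw [hs2]
    calc _ = 16 * C ^ 2 * B ^ 2 := by ring
      _ < 16 * C ^ 2 * (1 / (16 * C ^ 2) * H) := mul_lt_mul_of_pos_left h10 (by positivity)
      _ = H := by field_simp
  have h12 : 4 * C * B < s := lt_of_pow_lt_pow_left₀ 2 hs0.le h11
  have h13 : (1 / 2 * H) ^ 2 ≤ sq (res u x a) ^ 2 :=
    pow_le_pow_left₀ (by positivity) (by rw [h8]; linarith) 2
  have h14 : C * B * s ^ 3 < s / 4 * s ^ 3 := mul_lt_mul_of_pos_right (by linarith) (by positivity)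
  rw [← hs2] at h13
  nlinarith

/-! ### Disjointly supported truncations -/

lemma hasDerivAt_max_zero_sq (a : ℝ) :
    HasDerivAt (fun x : ℝ => max x 0 ^ 2) (2 * max a 0) a := by
  rw [hasDerivAt_iff_isLittleO]
  have h1 : (fun x : ℝ => max x 0 ^ 2 - max a 0 ^ 2 - (x - a) • (2 * max a 0)) =O[nhds a]
      fun x => ‖x - a‖ ^ 2 := by
    refine Asymptotics.IsBigO.of_bound 1 (Filter.Eventually.of_forall fun x => ?_)
    rw [one_mul, Real.norm_eq_abs, Real.norm_eq_abs, Real.norm_eq_abs, sq_abs, abs_pow, sq_abs,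
      smul_eq_mul, abs_le]
    rcases le_total x 0 with hx | hx <;> rcases le_total a 0 with ha | ha <;>
      simp only [max_eq_left, max_eq_right, hx, ha] <;> constructor <;>
      nlinarith [sq_nonneg (x - a)]
  exact h1.trans_isLittleO (Asymptotics.isLittleO_pow_sub_sub a (by norm_num))

lemma pd_comp_real {n : ℕ} (i : Fin n) {f : Eu n → ℝ} {φ : ℝ → ℝ} {φ' : ℝ} {y : Eu n}
    (hφ : HasDerivAt φ φ' (f y)) (hf : DifferentiableAt ℝ f y) :
    pd i (fun y => φ (f y)) y = φ' * pd i f y := by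
  have := (hφ.comp_hasFDerivAt y hf.hasFDerivAt).fderiv
  rw [pd, show (fun y => φ (f y)) = φ ∘ f from rfl, this]
  simp [pd]

/-- A smooth version of the positive part. -/
def trunc (s a : ℝ) : ℝ := √(max a 0 ^ 2 + s ^ 2) - s

/-- The derivative of `trunc s`. -/
def truncDeriv (s a : ℝ) : ℝ := max a 0 / √(max a 0 ^ 2 + s ^ 2)

section Trunc

variable {s : ℝ}

lemma sqrt_trunc_pos (hs : 0 < s) (a : ℝ) : 0 < √(max a 0 ^ 2 + s ^ 2) :=
  Real.sqrt_pos.2 (by positivity)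

lemma hasDerivAt_trunc (hs : 0 < s) (a : ℝ) : HasDerivAt (trunc s) (truncDeriv s a) a := by
  have h1 := (((hasDerivAt_max_zero_sq a).add_const (s ^ 2)).sqrt (by positivity)).sub_const s
  have e : truncDeriv s a = 2 * max a 0 / (2 * √(max a 0 ^ 2 + s ^ 2)) := by
    rw [truncDeriv, mul_div_mul_left _ _ two_ne_zero]
  rw [e]; exact h1

lemma continuous_truncDeriv (hs : 0 < s) : Continuous (truncDeriv s) := by
  unfold truncDeriv
  exact (by fun_prop : Continuous fun a : ℝ => max a 0).div (by fun_prop)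
    fun a => (sqrt_trunc_pos hs a).ne'

lemma truncDeriv_nonneg (hs : 0 < s) (a : ℝ) : 0 ≤ truncDeriv s a :=
  div_nonneg (le_max_right _ _) (sqrt_trunc_pos hs a).le

lemma truncDeriv_le_one (hs : 0 < s) (a : ℝ) : truncDeriv s a ≤ 1 := by
  rw [truncDeriv, div_le_one (sqrt_trunc_pos hs a)]
  exact Real.le_sqrt_of_sq_le (by nlinarith)

lemma truncDeriv_of_nonpos {a : ℝ} (ha : a ≤ 0) : truncDeriv s a = 0 := by
  simp [truncDeriv, max_eq_right ha]

lemma trunc_of_nonpos (hs : 0 < s) {a : ℝ} (ha : a ≤ 0) : trunc s a = 0 := by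
  simp [trunc, max_eq_right ha, Real.sqrt_sq hs.le]

lemma trunc_nonneg (s a : ℝ) : 0 ≤ trunc s a := by
  have : s ≤ √(max a 0 ^ 2 + s ^ 2) := Real.le_sqrt_of_sq_le (by nlinarith [sq_nonneg (max a 0)])
  unfold trunc; linarith

lemma trunc_le (hs : 0 < s) (a : ℝ) : trunc s a ≤ max a 0 := by
  have h0 : 0 ≤ max a 0 := le_max_right _ _
  have : √(max a 0 ^ 2 + s ^ 2) ≤ max a 0 + s :=
    Real.sqrt_le_iff.2 ⟨by positivity, by nlinarith⟩
  unfold trunc; linarith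

lemma le_trunc_add (s a : ℝ) : a ≤ trunc s a + s := by
  have : max a 0 ≤ √(max a 0 ^ 2 + s ^ 2) := Real.le_sqrt_of_sq_le (by nlinarith)
  unfold trunc; linarith [le_max_left a 0]

end Trunc

/-- The ratio controlling the truncations. -/
def cutRatio {n : ℕ} (ℓ : ℝ) (U : Eu n → ℝ) (y : Eu n) : ℝ := ℓ * U y / (1 + ‖y‖ ^ 2)

/-- The truncation supported where `U` is not small. -/
def cutTop {n : ℕ} (ℓ : ℝ) (U : Eu n → ℝ) (y : Eu n) : ℝ := trunc ℓ⁻¹ (U y - ℓ⁻¹ * (1 + ‖y‖ ^ 2))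

/-- The cut-off supported where `U` is small. -/
def cutFun {n : ℕ} (ℓ : ℝ) (U : Eu n → ℝ) (y : Eu n) : ℝ := max (1 - cutRatio ℓ U y ^ 2) 0 ^ 2

section Cut

variable {n : ℕ} {ℓ : ℝ} {U V : Eu n → ℝ}

lemma differentiable_one_add_norm_sq : Differentiable ℝ fun y : Eu n => 1 + ‖y‖ ^ 2 :=
  (contDiff_const.add (contDiff_norm_sq ℝ)).differentiable (n := 1) (by simp)

lemma differentiable_cutTop (hU : Differentiable ℝ U) (hℓ : 0 < ℓ) :
    Differentiable ℝ (cutTop ℓ U) := fun y =>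
  (hasDerivAt_trunc (inv_pos.2 hℓ) _).differentiableAt.comp y
    (hU.sub (differentiable_one_add_norm_sq.const_mul _) y)

lemma pd_cutTop (i : Fin n) (hU : Differentiable ℝ U) (hℓ : 0 < ℓ) (y : Eu n) :
    pd i (cutTop ℓ U) y =
      truncDeriv ℓ⁻¹ (U y - ℓ⁻¹ * (1 + ‖y‖ ^ 2)) * (pd i U y - ℓ⁻¹ * (2 * y i)) := by
  have hσ := differentiable_one_add_norm_sq (n := n)
  have h1 := pd_comp_real i (φ := trunc ℓ⁻¹) (f := fun y => U y - ℓ⁻¹ * (1 + ‖y‖ ^ 2)) (y := y)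
    (hasDerivAt_trunc (inv_pos.2 hℓ) _) ((hU.fun_sub (hσ.const_mul _)) y)
  rw [pd_sub i (hU y) ((hσ.const_mul _) y), pd_const_mul i (hσ y),
    pd_add i (by fun_prop) ((contDiff_norm_sq ℝ).differentiable (n := 1) (by simp) y), pd_const,
    pd_norm_sq, zero_add] at h1
  exact h1

lemma differentiable_cutRatio (hU : Differentiable ℝ U) : Differentiable ℝ (cutRatio ℓ U) := by
  unfold cutRatio
  simp only [div_eq_mul_inv]
  exact (hU.const_mul ℓ).fun_mul (differentiable_one_add_norm_sq.fun_inv fun y => by positivity)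

lemma pd_cutRatio (i : Fin n) (hU : Differentiable ℝ U) (y : Eu n) :
    pd i (cutRatio ℓ U) y =
      ℓ * pd i U y / (1 + ‖y‖ ^ 2) - 2 * ℓ * U y * y i / (1 + ‖y‖ ^ 2) ^ 2 := by
  have hσ : (1 + ‖y‖ ^ 2) ≠ 0 := by positivity
  have h1 : pd i (fun y => cutRatio ℓ U y * (1 + ‖y‖ ^ 2)) y = ℓ * pd i U y := by
    rw [← pd_const_mul i (hU y)]
    congr 1; ext y
    have : (1 + ‖y‖ ^ 2) ≠ 0 := by positivity
    rw [cutRatio, div_mul_cancel₀ _ this]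
  rw [pd_mul i (differentiable_cutRatio hU y) (differentiable_one_add_norm_sq y),
    pd_add i (by fun_prop) ((contDiff_norm_sq ℝ).differentiable (n := 1) (by simp) y), pd_const,
    pd_norm_sq, zero_add] at h1
  have h2 : cutRatio ℓ U y = ℓ * U y / (1 + ‖y‖ ^ 2) := rfl
  rw [h2] at h1
  field_simp at h1 ⊢
  linear_combination h1

lemma differentiable_cutFun (hU : Differentiable ℝ U) : Differentiable ℝ (cutFun ℓ U) := fun y =>
  (hasDerivAt_max_zero_sq _).differentiableAt.comp y
    ((differentiable_const _).sub ((differentiable_cutRatio hU).pow 2) y)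

lemma pd_cutFun (i : Fin n) (hU : Differentiable ℝ U) (y : Eu n) :
    pd i (cutFun ℓ U) y =
      -(4 * max (1 - cutRatio ℓ U y ^ 2) 0 * cutRatio ℓ U y * pd i (cutRatio ℓ U) y) := by
  have hT := differentiable_cutRatio (ℓ := ℓ) hU
  have h1 := pd_comp_real i (φ := fun x => max x 0 ^ 2) (f := fun y => 1 - cutRatio ℓ U y ^ 2)
    (y := y) (hasDerivAt_max_zero_sq _) (((differentiable_const _).fun_sub (hT.fun_pow 2)) y)
  rw [pd_sub i (by fun_prop) ((hT.fun_pow 2) y), pd_const, pd_sq i (hT y)] at h1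
  rw [show cutFun ℓ U = fun y => max (1 - cutRatio ℓ U y ^ 2) 0 ^ 2 from rfl, h1]
  ring

lemma cutFun_nonneg (y : Eu n) : 0 ≤ cutFun ℓ U y := sq_nonneg _

lemma cut_max_le_one (y : Eu n) : max (1 - cutRatio ℓ U y ^ 2) 0 ≤ 1 :=
  max_le (by nlinarith [sq_nonneg (cutRatio ℓ U y)]) zero_le_one

lemma cutFun_le_one (y : Eu n) : cutFun ℓ U y ≤ 1 :=
  pow_le_one₀ (le_max_right _ _) (cut_max_le_one y)

lemma cutFun_sq_ge (y : Eu n) : 1 - 4 * cutRatio ℓ U y ^ 2 ≤ cutFun ℓ U y ^ 2 := by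
  unfold cutFun
  set t := cutRatio ℓ U y ^ 2 with ht
  have h0 : 0 ≤ t := sq_nonneg _
  rcases le_total (1 - t) 0 with h | h
  · rw [max_eq_right h]; nlinarith
  · rw [max_eq_left h]; nlinarith [mul_nonneg h0 h0, sq_nonneg (t * (t - 2))]

lemma cut_disjoint (hℓ : 0 < ℓ) (y : Eu n) (hy : max (1 - cutRatio ℓ U y ^ 2) 0 ≠ 0) :
    U y - ℓ⁻¹ * (1 + ‖y‖ ^ 2) ≤ 0 := by
  by_contra! hc
  refine hy (max_eq_right ?_)
  have h1 : 1 ≤ cutRatio ℓ U y := by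
    rw [cutRatio, le_div_iff₀ (by positivity), one_mul]
    have : ℓ⁻¹ * (1 + ‖y‖ ^ 2) ≤ U y := by linarith
    calc 1 + ‖y‖ ^ 2 = ℓ * (ℓ⁻¹ * (1 + ‖y‖ ^ 2)) := by field_simp
      _ ≤ _ := mul_le_mul_of_nonneg_left this hℓ.le
  nlinarith

end Cut

/-- Truncations with disjoint supports, together with their quantitative properties. -/
structure Cut {n : ℕ} (C ℓ : ℝ) (U V F G : Eu n → ℝ) : Prop where
  diffF : Differentiable ℝ F
  diffG : Differentiable ℝ G
  cpF : CP F
  cpG : CP G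
  cp_pdF : ∀ i, CP (pd i F)
  cp_pdG : ∀ i, CP (pd i G)
  F_nonneg : ∀ y, 0 ≤ F y
  F_le : ∀ y, F y ≤ U y
  G_nonneg : ∀ y, 0 ≤ G y
  G_le : ∀ y, G y ≤ V y
  mul_eq : ∀ y, F y * G y = 0
  pd_mul_eq : ∀ i y, pd i F y * pd i G y = 0
  dirF : dir F ≤ dir U + C / ℓ
  sqF : sq U - C / ℓ ≤ sq F
  dirG : dir G ≤ dir V + C / ℓ * ue V
  sqG : sq V - C / ℓ * ue V ≤ sq G
  close : ∫ y, (1 + ‖y‖) * ((U y ^ 2 + V y ^ 2) - (F y ^ 2 + G y ^ 2)) ∂(gm n) ≤ C / ℓ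

lemma cp_one_add_norm_sq {n : ℕ} : CP fun y : Eu n => 1 + ‖y‖ ^ 2 := (CP.const 1).add (CP.norm.pow 2)

lemma CP.of_abs_le {n : ℕ} {f g : Eu n → ℝ} (hf : Continuous f) (hg : CP g)
    (h : ∀ y, |f y| ≤ g y) : CP f :=
  ⟨hf, hg.2.mono fun y => (h y).trans (le_abs_self _)⟩

lemma cp_gdot {n : ℕ} {f : Eu n → ℝ} (hf : ∀ i, CP (pd i f)) : CP (gdot f f) :=
  CP.sum fun i _ => (hf i).mul (hf i)

section CutExists

variable {n : ℕ} {K ℓ : ℝ} {U V : Eu n → ℝ}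

lemma cp_cutTop (h : Nrm K ℓ U V) : CP (cutTop ℓ U) := by
  have hℓ : 0 < ℓ := one_pos.trans_le h.one_le
  refine CP.of_abs_le (differentiable_cutTop h.hU.differentiable hℓ).continuous h.hU.cp fun y => ?_
  rw [abs_of_nonneg (show 0 ≤ cutTop ℓ U y from trunc_nonneg _ _)]
  refine (trunc_le (inv_pos.2 hℓ) _).trans (max_le ?_ (h.posU y).le)
  have : 0 ≤ ℓ⁻¹ * (1 + ‖y‖ ^ 2) := by positivity
  linarith

lemma cutTop_le (h : Nrm K ℓ U V) (y : Eu n) : cutTop ℓ U y ≤ U y := by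
  have hℓ : 0 < ℓ := one_pos.trans_le h.one_le
  refine (trunc_le (inv_pos.2 hℓ) _).trans (max_le ?_ (h.posU y).le)
  have : 0 ≤ ℓ⁻¹ * (1 + ‖y‖ ^ 2) := by positivity
  linarith

lemma cp_pd_cutTop (h : Nrm K ℓ U V) (i : Fin n) : CP (pd i (cutTop ℓ U)) := by
  have hℓ : 0 < ℓ := one_pos.trans_le h.one_le
  have e := funext (pd_cutTop i h.hU.differentiable hℓ)
  have c1 : CP fun y : Eu n => pd i U y - ℓ⁻¹ * (2 * y i) :=
    (h.hU.pd i).cp.sub (((CP.coord i).const_mul 2).const_mul _)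
  rw [e]
  refine CP.of_abs_le ?_ c1.abs fun y => ?_
  · exact ((continuous_truncDeriv (inv_pos.2 hℓ)).comp
      (h.hU.continuous.sub (cp_one_add_norm_sq.1.const_smul ℓ⁻¹))).mul c1.1
  · rw [abs_mul, abs_of_nonneg (truncDeriv_nonneg (inv_pos.2 hℓ) _)]
    exact mul_le_of_le_one_left (abs_nonneg _) (truncDeriv_le_one (inv_pos.2 hℓ) _)

lemma gdot_cutTop_le (h : Nrm K ℓ U V) (y : Eu n) :
    gdot (cutTop ℓ U) (cutTop ℓ U) y ≤ gdot U U y + ℓ⁻¹ * (2 * gdot U U y + 6 * ‖y‖ ^ 2) := by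
  have hℓ : 0 < ℓ := one_pos.trans_le h.one_le
  have hs : ℓ⁻¹ ≤ 1 := inv_le_one_of_one_le₀ h.one_le
  have hs0 : 0 < ℓ⁻¹ := inv_pos.2 hℓ
  rw [norm_sq_eq]
  simp only [gdot, Finset.mul_sum, ← Finset.sum_add_distrib]
  refine Finset.sum_le_sum fun i _ => ?_
  rw [pd_cutTop i h.hU.differentiable hℓ]
  have h0 := truncDeriv_nonneg hs0 (U y - ℓ⁻¹ * (1 + ‖y‖ ^ 2))
  have h1 := truncDeriv_le_one hs0 (U y - ℓ⁻¹ * (1 + ‖y‖ ^ 2))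
  set τ := truncDeriv ℓ⁻¹ (U y - ℓ⁻¹ * (1 + ‖y‖ ^ 2))
  set s := ℓ⁻¹
  set p := pd i U y
  have h2 : τ ^ 2 ≤ 1 := pow_le_one₀ h0 h1
  calc τ * (p - s * (2 * y i)) * (τ * (p - s * (2 * y i)))
      = τ ^ 2 * (p - s * (2 * y i)) ^ 2 := by ring
    _ ≤ 1 * (p - s * (2 * y i)) ^ 2 := mul_le_mul_of_nonneg_right h2 (sq_nonneg _)
    _ ≤ _ := by
      nlinarith [mul_nonneg hs0.le (sq_nonneg (p + y i)),
        mul_nonneg (mul_nonneg hs0.le (sub_nonneg.2 hs)) (sq_nonneg (y i))]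

lemma dir_cutTop_le (h : Nrm K ℓ U V) :
    dir (cutTop ℓ U) ≤ dir U + (2 + 6 * ∫ y : Eu n, ‖y‖ ^ 2 ∂(gm n)) / ℓ := by
  have hℓ : 0 < ℓ := one_pos.trans_le h.one_le
  have c1 : CP (gdot U U) := cp_gdot fun i => (h.hU.pd i).cp
  have c2 : CP fun y : Eu n => ‖y‖ ^ 2 := CP.norm.pow 2
  have h1 := CP.integral_mono (cp_gdot (cp_pd_cutTop h))
    (c1.add (((c1.const_mul 2).add (c2.const_mul 6)).const_mul ℓ⁻¹)) (gdot_cutTop_le h)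
  rw [CP.integral_add c1 (((c1.const_mul 2).add (c2.const_mul 6)).const_mul ℓ⁻¹),
    integral_const_mul, CP.integral_add (c1.const_mul 2) (c2.const_mul 6), integral_const_mul,
    integral_const_mul] at h1
  have h2 : dir U ≤ 1 := by
    have := h.energy
    have h3 := h.pot_nonneg
    have h4 := dir_nonneg V
    unfold Ds at this; linarith
  refine h1.trans ?_
  rw [div_eq_mul_inv, mul_comm _ ℓ⁻¹]
  exact add_le_add le_rfl (mul_le_mul_of_nonneg_left
    (add_le_add (by change 2 * dir U ≤ 2; linarith) le_rfl) (inv_pos.2 hℓ).le)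

lemma sq_sub_sq_cutTop_le (h : Nrm K ℓ U V) (y : Eu n) :
    U y ^ 2 - cutTop ℓ U y ^ 2 ≤ ℓ⁻¹ * (2 * K * ((2 + ‖y‖ ^ 2) * (1 + ‖y‖))) := by
  have hℓ : 0 < ℓ := one_pos.trans_le h.one_le
  have h1 := le_trunc_add ℓ⁻¹ (U y - ℓ⁻¹ * (1 + ‖y‖ ^ 2))
  have h2 : U y - cutTop ℓ U y ≤ ℓ⁻¹ * (2 + ‖y‖ ^ 2) := by unfold cutTop; linarith
  have h3 := cutTop_le h y
  have h4 : 0 ≤ cutTop ℓ U y := trunc_nonneg _ _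
  have h5 := h.U_le y
  calc U y ^ 2 - cutTop ℓ U y ^ 2 = (U y - cutTop ℓ U y) * (U y + cutTop ℓ U y) := by ring
    _ ≤ (ℓ⁻¹ * (2 + ‖y‖ ^ 2)) * (2 * (K * (1 + ‖y‖))) :=
      mul_le_mul h2 (by linarith) (by linarith [h.posU y]) (by positivity)
    _ = _ := by ring

lemma sq_cutTop_ge (h : Nrm K ℓ U V) :
    sq U - (2 * K * ∫ y : Eu n, (2 + ‖y‖ ^ 2) * (1 + ‖y‖) ∂(gm n)) / ℓ ≤ sq (cutTop ℓ U) := by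
  have c1 : CP fun y : Eu n => (2 + ‖y‖ ^ 2) * (1 + ‖y‖) :=
    ((CP.const 2).add (CP.norm.pow 2)).mul ((CP.const 1).add CP.norm)
  have hF := cp_cutTop h
  have h1 := CP.integral_mono ((h.hU.cp.pow 2).sub (hF.pow 2))
    ((c1.const_mul (2 * K)).const_mul ℓ⁻¹) (sq_sub_sq_cutTop_le h)
  rw [CP.integral_sub (h.hU.cp.pow 2) (hF.pow 2), integral_const_mul, integral_const_mul] at h1
  rw [div_eq_mul_inv, mul_comm _ ℓ⁻¹]
  unfold sq; linarith

lemma differentiable_mul_cutFun (h : Nrm K ℓ U V) :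
    Differentiable ℝ fun y => V y * cutFun ℓ U y :=
  h.hV.differentiable.fun_mul (differentiable_cutFun h.hU.differentiable)

lemma cp_mul_cutFun (h : Nrm K ℓ U V) : CP fun y => V y * cutFun ℓ U y := by
  refine CP.of_abs_le (differentiable_mul_cutFun h).continuous h.hV.cp fun y => ?_
  rw [abs_mul, abs_of_pos (h.posV y), abs_of_nonneg (cutFun_nonneg y)]
  exact mul_le_of_le_one_right (h.posV y).le (cutFun_le_one y)

lemma pd_mul_cutFun (h : Nrm K ℓ U V) (i : Fin n) (y : Eu n) :
    pd i (fun y => V y * cutFun ℓ U y) y =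
      pd i V y * cutFun ℓ U y + V y * pd i (cutFun ℓ U) y :=
  pd_mul i (h.hV.differentiable y) (differentiable_cutFun h.hU.differentiable y)

lemma cutRatio_nonneg (h : Nrm K ℓ U V) (y : Eu n) : 0 ≤ cutRatio ℓ U y := by
  have hℓ : 0 < ℓ := one_pos.trans_le h.one_le
  have := h.posU y
  unfold cutRatio; positivity

lemma cp_pd_cutRatio (h : Nrm K ℓ U V) (i : Fin n) : CP (pd i (cutRatio ℓ U)) := by
  have hℓ : 0 < ℓ := one_pos.trans_le h.one_le
  have e := funext (pd_cutRatio (ℓ := ℓ) i h.hU.differentiable)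
  rw [e]
  have hσ : Continuous fun y : Eu n => 1 + ‖y‖ ^ 2 := cp_one_add_norm_sq.1
  have c1 : CP fun y => ℓ * pd i U y := (h.hU.pd i).cp.const_mul ℓ
  have c2 : CP fun y => 2 * ℓ * U y * y i := (h.hU.cp.const_mul (2 * ℓ)).mul (CP.coord i)
  refine CP.sub (CP.of_abs_le (c1.1.div hσ fun y => by positivity) c1.abs fun y => ?_)
    (CP.of_abs_le (c2.1.div (hσ.pow 2) fun y => by positivity) c2.abs fun y => ?_)
  · rw [abs_div]
    exact div_le_self (abs_nonneg _) (by rw [abs_of_pos (by positivity)]; nlinarith [norm_nonneg y])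
  · rw [abs_div]
    exact div_le_self (abs_nonneg _) (by
      rw [abs_of_pos (by positivity)]
      exact one_le_pow₀ (by nlinarith [norm_nonneg y]))

lemma cut_mul_le_one (h : Nrm K ℓ U V) (y : Eu n) :
    max (1 - cutRatio ℓ U y ^ 2) 0 * cutRatio ℓ U y ≤ 1 := by
  have h0 := cutRatio_nonneg h y
  rcases le_total (1 - cutRatio ℓ U y ^ 2) 0 with hc | hc
  · rw [max_eq_right hc]; simp
  · have : cutRatio ℓ U y ≤ 1 := by nlinarith
    exact mul_le_one₀ (cut_max_le_one y) h0 this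

lemma cp_pd_cutFun (h : Nrm K ℓ U V) (i : Fin n) : CP (pd i (cutFun ℓ U)) := by
  have e := funext (pd_cutFun (ℓ := ℓ) i h.hU.differentiable)
  have c1 := cp_pd_cutRatio h i
  have c2 : Continuous (cutRatio ℓ U) := (differentiable_cutRatio h.hU.differentiable).continuous
  rw [e]
  refine CP.of_abs_le ?_ (c1.abs.const_mul 4) fun y => ?_
  · exact ((((continuous_const.sub (c2.pow 2)).max continuous_const).const_smul (4:ℝ)).mul
      c2 |>.mul c1.1).neg
  · have h1 := cut_mul_le_one h y
    have h2 := cutRatio_nonneg h y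
    have h3 : 0 ≤ max (1 - cutRatio ℓ U y ^ 2) 0 := le_max_right _ _
    rw [abs_neg, abs_mul, mul_assoc 4, abs_of_nonneg (mul_nonneg (by norm_num) (mul_nonneg h3 h2))]
    nlinarith [abs_nonneg (pd i (cutRatio ℓ U) y)]

lemma cp_pd_mul_cutFun (h : Nrm K ℓ U V) (i : Fin n) :
    CP (pd i fun y => V y * cutFun ℓ U y) := by
  rw [funext (pd_mul_cutFun h i)]
  refine ((h.hV.pd i).cp.mul ?_).add (h.hV.cp.mul (cp_pd_cutFun h i))
  exact CP.of_abs_le (differentiable_cutFun h.hU.differentiable).continuous (CP.const 1) fun y => by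
    rw [abs_of_nonneg (cutFun_nonneg y)]; exact cutFun_le_one y

/-- The gradient of the cut-off is controlled by the potential energy. -/
lemma mul_gdot_cutFun_le (h : Nrm K ℓ U V) {C : ℝ}
    (hC : ∀ i y, |pd i U y| ≤ C * ℓ ^ 57 * (1 + ‖y‖) ^ 4) (y : Eu n) :
    V y ^ 2 * gdot (cutFun ℓ U) (cutFun ℓ U) y ≤
      ℓ ^ 118 * ((512 * n * C ^ 2 + 128) * (U y ^ 2 * V y ^ 2)) := by
  have hℓ := h.one_le
  have hℓ0 : 0 < ℓ := one_pos.trans_le hℓ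
  have hσ : 0 < 1 + ‖y‖ ^ 2 := by positivity
  set σ := 1 + ‖y‖ ^ 2 with hσd
  have hσ1 : 1 ≤ σ := by rw [hσd]; nlinarith [norm_nonneg y]
  set q := max (1 - cutRatio ℓ U y ^ 2) 0 with hq
  set T := cutRatio ℓ U y with hT
  have hT0 : 0 ≤ T := cutRatio_nonneg h y
  have hq0 : 0 ≤ q := le_max_right _ _
  have hq1 : q ≤ 1 := cut_max_le_one y
  have hqT : q * T ≤ 1 := cut_mul_le_one h y
  have hTσ : T * σ = ℓ * U y := by rw [hT, cutRatio]; exact div_mul_cancel₀ _ hσ.ne'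
  have hw : (1 + ‖y‖) ^ 8 ≤ 16 * σ ^ 4 := by
    have : (1 + ‖y‖) ^ 2 ≤ 2 * σ := by rw [hσd]; nlinarith [sq_nonneg (‖y‖ - 1)]
    calc (1 + ‖y‖) ^ 8 = ((1 + ‖y‖) ^ 2) ^ 4 := by ring
      _ ≤ (2 * σ) ^ 4 := pow_le_pow_left₀ (by positivity) this 4
      _ = _ := by ring
  have key : ∀ i, pd i (cutFun ℓ U) y * pd i (cutFun ℓ U) y ≤
      ℓ ^ 118 * (512 * C ^ 2 * U y ^ 2) + 128 * ℓ ^ 2 * U y ^ 2 * (y i ^ 2 / σ ^ 4) := by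
    intro i
    rw [pd_cutFun i h.hU.differentiable, pd_cutRatio i h.hU.differentiable, ← hσd, ← hq, ← hT]
    set p := pd i U y
    have hp : p ^ 2 ≤ 16 * C ^ 2 * ℓ ^ 114 * σ ^ 4 := by
      rw [← sq_abs]
      calc |p| ^ 2 ≤ (C * ℓ ^ 57 * (1 + ‖y‖) ^ 4) ^ 2 := pow_le_pow_left₀ (abs_nonneg _) (hC i y) 2
        _ = C ^ 2 * ℓ ^ 114 * (1 + ‖y‖) ^ 8 := by ring
        _ ≤ C ^ 2 * ℓ ^ 114 * (16 * σ ^ 4) := mul_le_mul_of_nonneg_left hw (by positivity)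
        _ = _ := by ring
    have e1 : (q * T * (ℓ * p / σ)) ^ 2 ≤ ℓ ^ 118 * (16 * C ^ 2 * U y ^ 2) := by
      have : T = ℓ * U y / σ := by rw [eq_div_iff hσ.ne']; exact hTσ
      calc (q * T * (ℓ * p / σ)) ^ 2 = q ^ 2 * (T * (ℓ * p / σ)) ^ 2 := by ring
        _ ≤ 1 * (T * (ℓ * p / σ)) ^ 2 :=
          mul_le_mul_of_nonneg_right (pow_le_one₀ hq0 hq1) (sq_nonneg _)
        _ = ℓ ^ 4 * U y ^ 2 / σ ^ 4 * p ^ 2 := by rw [this]; field_simp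
        _ ≤ ℓ ^ 4 * U y ^ 2 / σ ^ 4 * (16 * C ^ 2 * ℓ ^ 114 * σ ^ 4) :=
          mul_le_mul_of_nonneg_left hp (by positivity)
        _ = _ := by field_simp
    have e2 : (q * T * (2 * ℓ * U y * y i / σ ^ 2)) ^ 2 ≤ 4 * ℓ ^ 2 * U y ^ 2 * (y i ^ 2 / σ ^ 4) := by
      calc _ = (q * T) ^ 2 * (2 * ℓ * U y * y i / σ ^ 2) ^ 2 := by ring
        _ ≤ 1 * (2 * ℓ * U y * y i / σ ^ 2) ^ 2 :=
          mul_le_mul_of_nonneg_right (pow_le_one₀ (by positivity) hqT) (sq_nonneg _)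
        _ = _ := by field_simp; ring
    calc _ = 16 * (q * T * (ℓ * p / σ) - q * T * (2 * ℓ * U y * y i / σ ^ 2)) ^ 2 := by ring
      _ ≤ 16 * (2 * (q * T * (ℓ * p / σ)) ^ 2 + 2 * (q * T * (2 * ℓ * U y * y i / σ ^ 2)) ^ 2) := by
        nlinarith [sq_nonneg (q * T * (ℓ * p / σ) + q * T * (2 * ℓ * U y * y i / σ ^ 2))]
      _ ≤ _ := by linarith
  have hsum : gdot (cutFun ℓ U) (cutFun ℓ U) y ≤ ℓ ^ 118 * ((512 * n * C ^ 2 + 128) * U y ^ 2) := by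
    have h1 : gdot (cutFun ℓ U) (cutFun ℓ U) y ≤ n * (ℓ ^ 118 * (512 * C ^ 2 * U y ^ 2)) +
        128 * ℓ ^ 2 * U y ^ 2 * (‖y‖ ^ 2 / σ ^ 4) := by
      rw [norm_sq_eq, Finset.sum_div, Finset.mul_sum]
      refine (Finset.sum_le_sum fun i _ => key i).trans_eq ?_
      rw [Finset.sum_add_distrib, Finset.sum_const, Finset.card_univ, Fintype.card_fin, nsmul_eq_mul]
    have h2 : ‖y‖ ^ 2 / σ ^ 4 ≤ 1 := by
      rw [div_le_one (by positivity)]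
      calc ‖y‖ ^ 2 ≤ σ := by rw [hσd]; linarith
        _ ≤ σ ^ 4 := le_self_pow₀ hσ1 (by norm_num)
    have h3 : ℓ ^ 2 ≤ ℓ ^ 118 := pow_le_pow_right₀ hℓ (by norm_num)
    calc _ ≤ _ := h1
      _ ≤ n * (ℓ ^ 118 * (512 * C ^ 2 * U y ^ 2)) + 128 * ℓ ^ 118 * U y ^ 2 * 1 := by
        refine add_le_add le_rfl (mul_le_mul ?_ h2 (by positivity) (by positivity))
        exact mul_le_mul_of_nonneg_right (by linarith) (sq_nonneg _)
      _ = _ := by ring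
  calc _ ≤ V y ^ 2 * (ℓ ^ 118 * ((512 * n * C ^ 2 + 128) * U y ^ 2)) :=
        mul_le_mul_of_nonneg_left hsum (sq_nonneg _)
    _ = _ := by ring

lemma gdot_mul_cutFun_le (h : Nrm K ℓ U V) (y : Eu n) :
    gdot (fun y => V y * cutFun ℓ U y) (fun y => V y * cutFun ℓ U y) y ≤
      (1 + ℓ⁻¹) * gdot V V y + 2 * ℓ * (V y ^ 2 * gdot (cutFun ℓ U) (cutFun ℓ U) y) := by
  have hℓ := h.one_le
  have hℓ0 : 0 < ℓ := one_pos.trans_le hℓ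
  simp only [gdot, Finset.mul_sum, ← Finset.sum_add_distrib]
  refine Finset.sum_le_sum fun i _ => ?_
  rw [pd_mul_cutFun h]
  set p := pd i V y
  set ψ := cutFun ℓ U y
  set d := V y * pd i (cutFun ℓ U) y
  have h0 : 0 ≤ ψ := cutFun_nonneg y
  have h1 : ψ ^ 2 ≤ 1 := pow_le_one₀ h0 (cutFun_le_one y)
  have h2 : ℓ⁻¹ * ℓ = 1 := inv_mul_cancel₀ hℓ0.ne'
  have h3 : 0 < ℓ⁻¹ := inv_pos.2 hℓ0
  have h4 : 2 * (p * ψ) * d ≤ ℓ⁻¹ * (p * ψ) ^ 2 + ℓ * d ^ 2 := by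
    have e : ℓ⁻¹ * (p * ψ) ^ 2 + ℓ * d ^ 2 - 2 * (p * ψ) * d = ℓ⁻¹ * (p * ψ - ℓ * d) ^ 2 := by
      field_simp; ring
    nlinarith [mul_nonneg h3.le (sq_nonneg (p * ψ - ℓ * d))]
  have h5 : (p * ψ) ^ 2 ≤ p ^ 2 := by
    rw [mul_pow]; exact mul_le_of_le_one_right (sq_nonneg _) h1
  have h6 : ℓ⁻¹ * (p * ψ) ^ 2 ≤ ℓ⁻¹ * p ^ 2 := mul_le_mul_of_nonneg_left h5 h3.le
  calc (p * ψ + d) * (p * ψ + d) = (p * ψ) ^ 2 + 2 * (p * ψ) * d + d ^ 2 := by ring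
    _ ≤ (1 + ℓ⁻¹) * p ^ 2 + 2 * ℓ * d ^ 2 := by
      nlinarith [mul_nonneg (sub_nonneg.2 hℓ) (sq_nonneg d)]
    _ = _ := by ring

lemma dir_mul_cutFun_le (h : Nrm K ℓ U V) {C : ℝ}
    (hC : ∀ i y, |pd i U y| ≤ C * ℓ ^ 57 * (1 + ‖y‖) ^ 4) :
    dir (fun y => V y * cutFun ℓ U y) ≤
      dir V + (1 + 2 * (512 * n * C ^ 2 + 128)) / ℓ * ue V := by
  have hℓ0 : 0 < ℓ := one_pos.trans_le h.one_le
  set B : ℝ := 512 * n * C ^ 2 + 128 with hB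
  have c1 : CP (gdot V V) := cp_gdot fun i => (h.hV.pd i).cp
  have c2 : CP fun y => U y ^ 2 * V y ^ 2 := (h.hU.cp.pow 2).mul (h.hV.cp.pow 2)
  have h1 := CP.integral_mono (cp_gdot (cp_pd_mul_cutFun h))
    ((c1.const_mul (1 + ℓ⁻¹)).add (c2.const_mul (2 * ℓ * (ℓ ^ 118 * B)))) fun y => by
      refine (gdot_mul_cutFun_le h y).trans (add_le_add le_rfl ?_)
      rw [mul_assoc (2 * ℓ), mul_assoc (ℓ ^ 118)]
      exact mul_le_mul_of_nonneg_left (mul_gdot_cutFun_le h hC y) (by positivity)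
  rw [CP.integral_add (c1.const_mul _) (c2.const_mul _), integral_const_mul, integral_const_mul] at h1
  have h2 : 2 * ℓ * (ℓ ^ 118 * B) * ∫ y, U y ^ 2 * V y ^ 2 ∂(gm n) =
      2 * B / ℓ * pot (ℓ ^ 120) U V := by
    unfold pot; field_simp
  rw [h2] at h1
  rw [h.ueV_eq]
  have hB0 : 0 ≤ B := by positivity
  have h3 : 0 ≤ 2 * B / ℓ * dir V := mul_nonneg (by positivity) (dir_nonneg V)
  have h4 : 0 ≤ ℓ⁻¹ * pot (ℓ ^ 120) U V := mul_nonneg (by positivity) h.pot_nonneg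
  have e : (1 + 2 * B) / ℓ = ℓ⁻¹ + 2 * B / ℓ := by rw [add_div, one_div]
  rw [e]
  have h5 : dir (fun y => V y * cutFun ℓ U y) ≤
    (1 + ℓ⁻¹) * dir V + 2 * B / ℓ * pot (ℓ ^ 120) U V := h1
  linarith

lemma sq_sub_sq_mul_cutFun_le (y : Eu n) :
    V y ^ 2 - (V y * cutFun ℓ U y) ^ 2 ≤ 4 * ℓ ^ 2 * (U y ^ 2 * V y ^ 2) / (1 + ‖y‖ ^ 2) ^ 2 := by
  have h1 := cutFun_sq_ge (ℓ := ℓ) (U := U) y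
  calc V y ^ 2 - (V y * cutFun ℓ U y) ^ 2 = V y ^ 2 * (1 - cutFun ℓ U y ^ 2) := by ring
    _ ≤ V y ^ 2 * (4 * cutRatio ℓ U y ^ 2) :=
      mul_le_mul_of_nonneg_left (by linarith) (sq_nonneg _)
    _ = _ := by rw [cutRatio]; field_simp

lemma integral_mul_le_pot_div (h : Nrm K ℓ U V) :
    ℓ ^ 2 * ∫ y, U y ^ 2 * V y ^ 2 ∂(gm n) ≤ pot (ℓ ^ 120) U V / ℓ := by
  have hℓ0 : 0 < ℓ := one_pos.trans_le h.one_le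
  have h0 : 0 ≤ ∫ y, U y ^ 2 * V y ^ 2 ∂(gm n) := integral_nonneg fun y => by positivity
  rw [le_div_iff₀ hℓ0, pot]
  calc _ = ℓ ^ 3 * ∫ y, U y ^ 2 * V y ^ 2 ∂(gm n) := by ring
    _ ≤ _ := mul_le_mul_of_nonneg_right (pow_le_pow_right₀ h.one_le (by norm_num)) h0

lemma sq_mul_cutFun_ge (h : Nrm K ℓ U V) :
    sq V - 4 / ℓ * ue V ≤ sq (fun y => V y * cutFun ℓ U y) := by
  have hℓ0 : 0 < ℓ := one_pos.trans_le h.one_le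
  have c2 : CP fun y => U y ^ 2 * V y ^ 2 := (h.hU.cp.pow 2).mul (h.hV.cp.pow 2)
  have hG := cp_mul_cutFun h
  have h1 := CP.integral_mono ((h.hV.cp.pow 2).sub (hG.pow 2)) (c2.const_mul (4 * ℓ ^ 2))
    fun y => (sq_sub_sq_mul_cutFun_le y).trans
      (div_le_self (by positivity) (one_le_pow₀ (by nlinarith [norm_nonneg y])))
  rw [CP.integral_sub (h.hV.cp.pow 2) (hG.pow 2), integral_const_mul] at h1
  have h2 := integral_mul_le_pot_div h
  have h3 : pot (ℓ ^ 120) U V / ℓ ≤ ue V / ℓ := by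
    rw [h.ueV_eq]
    exact div_le_div_of_nonneg_right (by linarith [dir_nonneg V]) hℓ0.le
  have e : 4 / ℓ * ue V = 4 * (ue V / ℓ) := by ring
  rw [e]
  unfold sq at *
  linarith

lemma cut_close (h : Nrm K ℓ U V) :
    ∫ y, (1 + ‖y‖) * ((U y ^ 2 + V y ^ 2) - (cutTop ℓ U y ^ 2 + (V y * cutFun ℓ U y) ^ 2)) ∂(gm n) ≤
      (2 * K * ∫ y : Eu n, (2 + ‖y‖ ^ 2) * (1 + ‖y‖) ^ 2 ∂(gm n) + 8) / ℓ := by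
  have hℓ0 : 0 < ℓ := one_pos.trans_le h.one_le
  have c1 : CP fun y : Eu n => (2 + ‖y‖ ^ 2) * (1 + ‖y‖) ^ 2 :=
    ((CP.const 2).add (CP.norm.pow 2)).mul (((CP.const 1).add CP.norm).pow 2)
  have c2 : CP fun y => U y ^ 2 * V y ^ 2 := (h.hU.cp.pow 2).mul (h.hV.cp.pow 2)
  have c3 := ((CP.const 1).add CP.norm).mul (((h.hU.cp.pow 2).add (h.hV.cp.pow 2)).sub
    (((cp_cutTop h).pow 2).add ((cp_mul_cutFun h).pow 2)))
  have h1 := CP.integral_mono c3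
    ((c1.const_mul (ℓ⁻¹ * (2 * K))).add (c2.const_mul (8 * ℓ ^ 2))) fun y => by
      have hy := norm_nonneg y
      have d1 := sq_sub_sq_cutTop_le h y
      have d2 := sq_sub_sq_mul_cutFun_le (ℓ := ℓ) (U := U) (V := V) y
      have d3 : (1 + ‖y‖) * (4 * ℓ ^ 2 * (U y ^ 2 * V y ^ 2) / (1 + ‖y‖ ^ 2) ^ 2) ≤
          8 * ℓ ^ 2 * (U y ^ 2 * V y ^ 2) := by
        rw [mul_div_assoc', div_le_iff₀ (by positivity)]
        have : 1 + ‖y‖ ≤ 2 * (1 + ‖y‖ ^ 2) ^ 2 := by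
          nlinarith [sq_nonneg (‖y‖ - 1), sq_nonneg (‖y‖ ^ 2)]
        calc _ ≤ (2 * (1 + ‖y‖ ^ 2) ^ 2) * (4 * ℓ ^ 2 * (U y ^ 2 * V y ^ 2)) :=
              mul_le_mul_of_nonneg_right this (by positivity)
          _ = _ := by ring
      calc _ = (1 + ‖y‖) * (U y ^ 2 - cutTop ℓ U y ^ 2) +
            (1 + ‖y‖) * (V y ^ 2 - (V y * cutFun ℓ U y) ^ 2) := by ring
        _ ≤ (1 + ‖y‖) * (ℓ⁻¹ * (2 * K * ((2 + ‖y‖ ^ 2) * (1 + ‖y‖)))) +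
            (1 + ‖y‖) * (4 * ℓ ^ 2 * (U y ^ 2 * V y ^ 2) / (1 + ‖y‖ ^ 2) ^ 2) :=
          add_le_add (mul_le_mul_of_nonneg_left d1 (by positivity))
            (mul_le_mul_of_nonneg_left d2 (by positivity))
        _ ≤ (1 + ‖y‖) * (ℓ⁻¹ * (2 * K * ((2 + ‖y‖ ^ 2) * (1 + ‖y‖)))) +
            8 * ℓ ^ 2 * (U y ^ 2 * V y ^ 2) := add_le_add le_rfl d3
        _ = _ := by ring
  rw [CP.integral_add (c1.const_mul _) (c2.const_mul _), integral_const_mul, integral_const_mul] at h1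
  have h2 := integral_mul_le_pot_div h
  have h3 : pot (ℓ ^ 120) U V / ℓ ≤ 1 / ℓ := by
    have := h.energy
    have h4 := dir_nonneg V
    have h5 := dir_nonneg U
    unfold Ds at this
    exact div_le_div_of_nonneg_right (by linarith) hℓ0.le
  refine h1.trans ?_
  rw [add_div, div_eq_mul_inv _ ℓ, div_eq_mul_inv _ ℓ]
  simp only [div_eq_mul_inv, one_mul] at h2 h3
  linarith

end CutExists

lemma exists_cut (n : ℕ) (K : ℝ) : ∃ C : ℝ, 0 ≤ C ∧ ∀ (ℓ : ℝ) (U V : Eu n → ℝ), Nrm K ℓ U V →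
    ∃ F G, Cut C ℓ U V F G := by
  obtain ⟨C₀, hC₀, hgrad⟩ := exists_grad_le n K
  set a := 2 + 6 * ∫ y : Eu n, ‖y‖ ^ 2 ∂(gm n) with ha
  set b := 2 * K * ∫ y : Eu n, (2 + ‖y‖ ^ 2) * (1 + ‖y‖) ∂(gm n) with hb
  set c := 1 + 2 * (512 * n * C₀ ^ 2 + 128) with hc
  set d := 2 * K * ∫ y : Eu n, (2 + ‖y‖ ^ 2) * (1 + ‖y‖) ^ 2 ∂(gm n) + 8 with hd
  refine ⟨|a| + |b| + |c| + 4 + |d|, by positivity, fun ℓ U V h =>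
    ⟨cutTop ℓ U, fun y => V y * cutFun ℓ U y, ?_⟩⟩
  have hℓ0 : 0 < ℓ := one_pos.trans_le h.one_le
  set C := |a| + |b| + |c| + 4 + |d| with hC
  have la := le_abs_self a
  have lb := le_abs_self b
  have lc := le_abs_self c
  have ld := le_abs_self d
  have na := abs_nonneg a
  have nb := abs_nonneg b
  have nc := abs_nonneg c
  have nd := abs_nonneg d
  have hS : 0 ≤ ue V := by rw [h.ueV_eq]; linarith [dir_nonneg V, h.pot_nonneg]
  have hle : ∀ t, t ≤ C → t / ℓ ≤ C / ℓ := fun t ht => div_le_div_of_nonneg_right ht hℓ0.le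
  have hdisj : ∀ y, U y - ℓ⁻¹ * (1 + ‖y‖ ^ 2) ≤ 0 ∨ max (1 - cutRatio ℓ U y ^ 2) 0 = 0 := fun y => by
    by_cases hy : max (1 - cutRatio ℓ U y ^ 2) 0 = 0
    · exact Or.inr hy
    · exact Or.inl (cut_disjoint hℓ0 y hy)
  exact
  { diffF := differentiable_cutTop h.hU.differentiable hℓ0
    diffG := differentiable_mul_cutFun h
    cpF := cp_cutTop h
    cpG := cp_mul_cutFun h
    cp_pdF := cp_pd_cutTop h
    cp_pdG := cp_pd_mul_cutFun h
    F_nonneg := fun y => trunc_nonneg _ _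
    F_le := cutTop_le h
    G_nonneg := fun y => mul_nonneg (h.posV y).le (cutFun_nonneg y)
    G_le := fun y => mul_le_of_le_one_right (h.posV y).le (cutFun_le_one y)
    mul_eq := fun y => by
      rcases hdisj y with hy | hy
      · rw [cutTop, trunc_of_nonpos (inv_pos.2 hℓ0) hy, zero_mul]
      · rw [cutFun, hy]; ring
    pd_mul_eq := fun i y => by
      rcases hdisj y with hy | hy
      · rw [pd_cutTop i h.hU.differentiable hℓ0, truncDeriv_of_nonpos hy]; ring
      · rw [pd_mul_cutFun h, pd_cutFun i h.hU.differentiable, cutFun, hy]; ring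
    dirF := (dir_cutTop_le h).trans (add_le_add le_rfl (hle _ (by linarith)))
    sqF := (sub_le_sub_left (hle _ (by linarith)) _).trans (sq_cutTop_ge h)
    dirG := (dir_mul_cutFun_le h (hgrad ℓ U V h)).trans
      (add_le_add le_rfl (mul_le_mul_of_nonneg_right (hle _ (by linarith)) hS))
    sqG := (sub_le_sub_left (mul_le_mul_of_nonneg_right (hle _ (by linarith)) hS) _).trans
      (sq_mul_cutFun_ge h)
    close := (cut_close h).trans (hle _ (by linarith)) }

/-! ### The deficit of the truncated difference -/

/-- The mean-zero combination of two truncations. -/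
def comb {n : ℕ} (F G : Eu n → ℝ) (y : Eu n) : ℝ :=
  (∫ z, G z ∂(gm n)) * F y - (∫ z, F z ∂(gm n)) * G y

/-- The Poincaré deficit. -/
def deficit {n : ℕ} (h : Eu n → ℝ) : ℝ := ∑ i, ∫ y, pd i h y ^ 2 ∂(gm n) - sq h

lemma cp_one_add_norm_pow (n k : ℕ) : CP fun y : Eu n => (1 + ‖y‖) ^ k :=
  ((CP.const 1).add CP.norm).pow k

section Comb

variable {n : ℕ} {K C ℓ : ℝ} {U V F G : Eu n → ℝ}

lemma Cut.differentiable_comb (hc : Cut C ℓ U V F G) : Differentiable ℝ (comb F G) :=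
  (hc.diffF.const_mul _).sub (hc.diffG.const_mul _)

lemma Cut.cp_comb (hc : Cut C ℓ U V F G) : CP (comb F G) :=
  (hc.cpF.const_mul _).sub (hc.cpG.const_mul _)

lemma Cut.pd_comb (hc : Cut C ℓ U V F G) (i : Fin n) (y : Eu n) :
    pd i (comb F G) y = (∫ z, G z ∂(gm n)) * pd i F y - (∫ z, F z ∂(gm n)) * pd i G y := by
  have h1 := pd_sub i (f := fun y => (∫ z, G z ∂(gm n)) * F y)
    (g := fun y => (∫ z, F z ∂(gm n)) * G y) (y := y) ((hc.diffF.const_mul _) y)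
    ((hc.diffG.const_mul _) y)
  rw [pd_const_mul i (hc.diffF y), pd_const_mul i (hc.diffG y)] at h1
  exact h1

lemma Cut.cp_pd_comb (hc : Cut C ℓ U V F G) (i : Fin n) : CP (pd i (comb F G)) := by
  rw [funext (hc.pd_comb i)]
  exact ((hc.cp_pdF i).const_mul _).sub ((hc.cp_pdG i).const_mul _)

lemma Cut.integral_comb (hc : Cut C ℓ U V F G) : ∫ y, comb F G y ∂(gm n) = 0 := by
  unfold comb
  rw [CP.integral_sub (hc.cpF.const_mul _) (hc.cpG.const_mul _), integral_const_mul,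
    integral_const_mul]
  ring

lemma Cut.sq_comb (hc : Cut C ℓ U V F G) :
    sq (comb F G) = (∫ z, G z ∂(gm n)) ^ 2 * sq F + (∫ z, F z ∂(gm n)) ^ 2 * sq G := by
  have e : ∀ y, comb F G y ^ 2 = (∫ z, G z ∂(gm n)) ^ 2 * F y ^ 2 +
      (∫ z, F z ∂(gm n)) ^ 2 * G y ^ 2 := fun y => by
    unfold comb
    linear_combination (-2 * (∫ z, G z ∂(gm n)) * (∫ z, F z ∂(gm n))) * hc.mul_eq y
  rw [sq]
  simp only [e]
  rw [CP.integral_add ((hc.cpF.pow 2).const_mul _) ((hc.cpG.pow 2).const_mul _),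
    integral_const_mul, integral_const_mul]
  rfl

lemma integral_gdot_self {f : Eu n → ℝ} (hf : ∀ i, CP (pd i f)) :
    dir f = ∑ i, ∫ y, pd i f y ^ 2 ∂(gm n) := by
  unfold dir gdot
  rw [integral_finsetSum _ fun i _ => ((hf i).mul (hf i)).integrable]
  simp only [pow_two]

lemma Cut.dir_comb (hc : Cut C ℓ U V F G) :
    ∑ i, ∫ y, pd i (comb F G) y ^ 2 ∂(gm n) =
      (∫ z, G z ∂(gm n)) ^ 2 * dir F + (∫ z, F z ∂(gm n)) ^ 2 * dir G := by
  rw [integral_gdot_self hc.cp_pdF, integral_gdot_self hc.cp_pdG, Finset.mul_sum, Finset.mul_sum,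
    ← Finset.sum_add_distrib]
  refine Finset.sum_congr rfl fun i _ => ?_
  have e : ∀ y, pd i (comb F G) y ^ 2 = (∫ z, G z ∂(gm n)) ^ 2 * pd i F y ^ 2 +
      (∫ z, F z ∂(gm n)) ^ 2 * pd i G y ^ 2 := fun y => by
    rw [hc.pd_comb]
    linear_combination (-2 * (∫ z, G z ∂(gm n)) * (∫ z, F z ∂(gm n))) * hc.pd_mul_eq i y
  simp only [e]
  rw [CP.integral_add (((hc.cp_pdF i).pow 2).const_mul _) (((hc.cp_pdG i).pow 2).const_mul _),
    integral_const_mul, integral_const_mul]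

lemma Cut.deficit_nonneg (hc : Cut C ℓ U V F G) : 0 ≤ deficit (comb F G) := by
  have h1 := gaussian_poincare hc.differentiable_comb hc.cp_comb.2 fun i => (hc.cp_pd_comb i).2
  rw [hc.integral_comb] at h1
  unfold deficit sq
  linarith

lemma Cut.deficit_le (hc : Cut C ℓ U V F G) (h : Nrm K ℓ U V) :
    deficit (comb F G) ≤ (∫ z, G z ∂(gm n)) ^ 2 * (dir U - sq U + 2 * C / ℓ) +
      (∫ z, F z ∂(gm n)) ^ 2 * (ue V - sq V - pot (ℓ ^ 120) U V + 2 * C / ℓ * ue V) := by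
  unfold deficit
  rw [hc.dir_comb, hc.sq_comb]
  have h1 := mul_le_mul_of_nonneg_left (sub_le_sub hc.dirF hc.sqF) (sq_nonneg (∫ z, G z ∂(gm n)))
  have h2 := mul_le_mul_of_nonneg_left (sub_le_sub hc.dirG hc.sqG) (sq_nonneg (∫ z, F z ∂(gm n)))
  have h3 := h.ueV_eq
  have e1 : 2 * C / ℓ = C / ℓ + C / ℓ := by ring
  rw [e1]
  have e2 : dir V = ue V - pot (ℓ ^ 120) U V := by linarith
  rw [e2] at h2
  linarith

lemma Cut.integral_F_nonneg (hc : Cut C ℓ U V F G) : 0 ≤ ∫ z, F z ∂(gm n) :=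
  integral_nonneg hc.F_nonneg

lemma Cut.integral_G_nonneg (hc : Cut C ℓ U V F G) : 0 ≤ ∫ z, G z ∂(gm n) :=
  integral_nonneg hc.G_nonneg

lemma sq_le_sq_of_le {f g : Eu n → ℝ} (hf : CP f) (hg : CP g) (h0 : ∀ y, 0 ≤ f y)
    (h : ∀ y, f y ≤ g y) : sq f ≤ sq g :=
  CP.integral_mono (hf.pow 2) (hg.pow 2) fun y => pow_le_pow_left₀ (h0 y) (h y) 2

lemma Cut.sqF_le (hc : Cut C ℓ U V F G) (h : Nrm K ℓ U V) : sq F ≤ sq U :=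
  sq_le_sq_of_le hc.cpF h.hU.cp hc.F_nonneg hc.F_le

lemma Cut.sqG_le (hc : Cut C ℓ U V F G) (h : Nrm K ℓ U V) : sq G ≤ sq V :=
  sq_le_sq_of_le hc.cpG h.hV.cp hc.G_nonneg hc.G_le

lemma Nrm.sqU_le_one (h : Nrm K ℓ U V) : sq U ≤ 1 := by
  have := h.mass
  unfold Hs at this; linarith [sq_nonneg' V]

lemma Nrm.integral_cube_le (h : Nrm K ℓ U V) {f : Eu n → ℝ} (hf : CP f) (h0 : ∀ y, 0 ≤ f y)
    (hU : ∀ y, f y ≤ U y) :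
    ∫ y, f y ^ 3 ∂(gm n) ≤ K ^ 3 * ∫ y : Eu n, (1 + ‖y‖) ^ 3 ∂(gm n) := by
  rw [← integral_const_mul]
  refine CP.integral_mono (hf.pow 3) ((cp_one_add_norm_pow n 3).const_mul _) fun y => ?_
  rw [← mul_pow]
  exact pow_le_pow_left₀ (h0 y) ((hU y).trans (h.U_le y)) 3

end Comb

/-- When one component carries little mass, its own frequency is almost at least one. -/
lemma exists_ue_ge (n : ℕ) (K : ℝ) : ∃ κ > 0, ∃ C : ℝ, 0 ≤ C ∧ ∀ (ℓ : ℝ) (U V : Eu n → ℝ),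
    Nrm K ℓ U V → sq V ≤ κ → (1 - C / ℓ) * sq V ≤ ue V := by
  obtain ⟨C, hC, hcut⟩ := exists_cut n K
  set M : ℝ := 1 + |K| ^ 3 * ∫ y : Eu n, (1 + ‖y‖) ^ 3 ∂(gm n) with hM
  have hM1 : 1 ≤ M := by
    have : 0 ≤ ∫ y : Eu n, (1 + ‖y‖) ^ 3 ∂(gm n) := integral_nonneg fun y => by positivity
    rw [hM]; nlinarith [mul_nonneg (pow_nonneg (abs_nonneg K) 3) this]
  refine ⟨1 / (32 * M ^ 2), by positivity, 128 * M ^ 2 * C, by positivity, fun ℓ U V h hκ => ?_⟩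
  obtain ⟨F, G, hc⟩ := hcut ℓ U V h
  have hℓ0 : 0 < ℓ := one_pos.trans_le h.one_le
  have hK := h.one_le_K
  rw [abs_of_pos (by linarith : 0 < K)] at hM
  set ω := C / ℓ with hω
  have hω0 : 0 ≤ ω := by positivity
  have hV0 := sq_nonneg' V
  have hP := h.pot_nonneg
  have hS0 : 0 ≤ ue V := by rw [h.ueV_eq]; linarith [dir_nonneg V]
  have e1 : 128 * M ^ 2 * C / ℓ = 128 * M ^ 2 * ω := by rw [hω]; ring
  rw [e1]
  have hM2 : 1 ≤ M ^ 2 := one_le_pow₀ hM1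
  by_cases hbig : 1 / 4 < ω
  · have : (1 - 128 * M ^ 2 * ω) ≤ 0 := by nlinarith
    exact (mul_nonpos_of_nonpos_of_nonneg this hV0).trans hS0
  push Not at hbig
  by_contra! hlt
  have hg : 0 < sq V - ue V := by
    have : 0 ≤ 128 * M ^ 2 * ω * sq V := by positivity
    linarith
  have hd := hc.deficit_nonneg.trans (hc.deficit_le h)
  set p := ∫ z, F z ∂(gm n) with hp
  set q := ∫ z, G z ∂(gm n) with hq
  have e2 : 2 * C / ℓ = 2 * ω := by rw [hω]; ring
  rw [e2] at hd
  have hmass := h.mass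
  have hen := h.energy
  have hueV := h.ueV_eq
  unfold Hs at hmass
  unfold Ds at hen
  have hp0 : 0 ≤ p := hc.integral_F_nonneg
  have hq2 : q ^ 2 ≤ sq V := hc.cpG.integral_sq_le.trans (hc.sqG_le h)
  have hp2 : p ^ 2 ≤ 1 := (hc.cpF.integral_sq_le.trans (hc.sqF_le h)).trans h.sqU_le_one
  have hκ4 : 1 / (32 * M ^ 2) ≤ 1 / 32 := by
    rw [div_le_div_iff₀ (by positivity) (by norm_num)]; linarith
  have hpl : 1 / (4 * M) ≤ p := by
    have h1 := integral_sq_sq_le hc.cpF hc.F_nonneg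
    have h2 := h.integral_cube_le hc.cpF hc.F_nonneg hc.F_le
    have h3 : 1 / 2 ≤ sq F := by
      have := hc.sqF
      rw [← hω] at this; linarith
    have h4 : (1 / 2) ^ 2 ≤ sq F ^ 2 := pow_le_pow_left₀ (by norm_num) h3 2
    rw [div_le_iff₀ (by positivity)]
    have h5 : p * ∫ y, F y ^ 3 ∂(gm n) ≤ p * M :=
      mul_le_mul_of_nonneg_left (h2.trans (by linarith)) hp0
    linarith
  have hpl2 : 1 / (16 * M ^ 2) ≤ p ^ 2 := by
    have := pow_le_pow_left₀ (by positivity) hpl 2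
    calc 1 / (16 * M ^ 2) = (1 / (4 * M)) ^ 2 := by field_simp; norm_num
      _ ≤ _ := this
  have hpq : 1 / (32 * M ^ 2) ≤ p ^ 2 - q ^ 2 := by
    have : 1 / (16 * M ^ 2) = 1 / (32 * M ^ 2) + 1 / (32 * M ^ 2) := by field_simp; norm_num
    linarith
  have h1 : q ^ 2 * (dir U - sq U + 2 * ω) ≤ q ^ 2 * (sq V - ue V + 2 * ω) :=
    mul_le_mul_of_nonneg_left (by linarith) (sq_nonneg q)
  have h2 : p ^ 2 * (ue V - sq V - pot (ℓ ^ 120) U V + 2 * ω * ue V) ≤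
      p ^ 2 * (ue V - sq V + 2 * ω * ue V) :=
    mul_le_mul_of_nonneg_left (by linarith) (sq_nonneg p)
  have h3 : q ^ 2 * (2 * ω) ≤ sq V * (2 * ω) := mul_le_mul_of_nonneg_right hq2 (by positivity)
  have h4 : p ^ 2 * (2 * ω * ue V) ≤ 1 * (2 * ω * sq V) :=
    mul_le_mul hp2 (mul_le_mul_of_nonneg_left (by linarith) (by positivity)) (by positivity)
      zero_le_one
  have h5 : (p ^ 2 - q ^ 2) * (sq V - ue V) ≤ 4 * ω * sq V := by linarith
  have h6 : 1 / (32 * M ^ 2) * (sq V - ue V) ≤ 4 * ω * sq V :=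
    (mul_le_mul_of_nonneg_right hpq hg.le).trans h5
  rw [div_mul_eq_mul_div, one_mul, div_le_iff₀ (by positivity)] at h6
  linarith

/-! ### First moments and the comparison of means -/

section Moment

variable {n : ℕ} {K ℓ : ℝ} {U V : Eu n → ℝ}

lemma Nrm.dls_eq (h : Nrm K ℓ U V) : dls (ℓ ^ 120) U V =
    Qs U V - Ss U V ^ 2 + pot (ℓ ^ 120) U V * (1 + Ss U V) := by
  rw [dls, h.mass]; ring

lemma Nrm.pot_le_dls (h : Nrm K ℓ U V) : pot (ℓ ^ 120) U V ≤ dls (ℓ ^ 120) U V := by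
  have := h.pot_div_le_dls
  rwa [h.mass, div_one] at this

lemma Nrm.S_le_two (h : Nrm K ℓ U V) : Ss U V ≤ 2 := by
  have h1 := h.S_eq
  have h2 := h.energy
  have h3 := h.pot_nonneg
  have h4 : 0 ≤ Ds U V := add_nonneg (dir_nonneg U) (dir_nonneg V)
  linarith

lemma Nrm.sq_defect_add_le (h : Nrm K ℓ U V) :
    sq (fun y => eul U y - Ss U V * U y) + sq (fun y => eul V y - Ss U V * V y) ≤
      dls (ℓ ^ 120) U V := by
  rw [sq_eul_sub h.hU, sq_eul_sub h.hV, h.dls_eq]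
  have hm := h.mass
  have h1 := mul_nonneg h.pot_nonneg (by linarith [h.S_nonneg] : 0 ≤ 1 + Ss U V)
  have e1 : ue U + ue V = Ss U V := rfl
  have e2 : sq (eul U) + sq (eul V) = Qs U V := rfl
  unfold Hs at hm
  have : sq (eul U) - 2 * Ss U V * ue U + Ss U V ^ 2 * sq U +
      (sq (eul V) - 2 * Ss U V * ue V + Ss U V ^ 2 * sq V) = Qs U V - Ss U V ^ 2 := by
    linear_combination e2 - 2 * Ss U V * e1 + Ss U V ^ 2 * hm
  linarith

lemma sq_pd_le_dir {f : Eu n → ℝ} (hf : f.HasTemperateGrowth) (j : Fin n) :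
    sq (pd j f) ≤ dir f := by
  rw [dir_eq_sum hf]
  exact Finset.single_le_sum (f := fun i => ∫ y, pd i f y ^ 2 ∂(gm n))
    (fun i _ => integral_nonneg fun _ => sq_nonneg _) (Finset.mem_univ j)

lemma sq_coord_mul_le {f : Eu n → ℝ} (hf : CP f) (h0 : ∀ y, 0 ≤ f y)
    (hK : ∀ y, f y ≤ K * (1 + ‖y‖)) (j : Fin n) :
    sq (fun y => y j * f y) ≤ K ^ 2 * ∫ y : Eu n, (1 + ‖y‖) ^ 4 ∂(gm n) := by
  rw [← integral_const_mul]
  refine CP.integral_mono (((CP.coord j).mul hf).pow 2) ((cp_one_add_norm_pow n 4).const_mul _)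
    fun y => ?_
  have h1 := pow_le_pow_left₀ (h0 y) (hK y) 2
  have h2 : (y j) ^ 2 ≤ (1 + ‖y‖) ^ 2 := by
    rw [← sq_abs (y j)]
    exact pow_le_pow_left₀ (abs_nonneg _) ((abs_coord_le y j).trans (by linarith)) 2
  calc (y j * f y) ^ 2 = (y j) ^ 2 * f y ^ 2 := by ring
    _ ≤ (1 + ‖y‖) ^ 2 * (K * (1 + ‖y‖)) ^ 2 := mul_le_mul h2 h1 (sq_nonneg _) (sq_nonneg _)
    _ = _ := by ring

lemma integral_pd_mul_self {f : Eu n → ℝ} (hf : f.HasTemperateGrowth) (j : Fin n) :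
    ∫ y, pd j f y * f y ∂(gm n) = 1 / 2 * ∫ y, y j * f y ^ 2 ∂(gm n) := by
  rw [stein_mul j (f := fun y => f y ^ 2) (by fun_prop), ← integral_const_mul]
  refine integral_congr_ae (.of_forall fun y => ?_)
  simp only
  rw [pd_sq j (hf.differentiable y)]; ring

lemma Sys.moment_identity {β : ℝ} (h : Sys β U V) (S : ℝ) (j : Fin n) :
    1 / 2 * (∫ y, y j * U y ^ 2 ∂(gm n) + ∫ y, y j * V y ^ 2 ∂(gm n)) =
      (∫ y, (y j * U y) * (eul U y - S * U y) ∂(gm n) +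
        ∫ y, (y j * V y) * (eul V y - S * V y) ∂(gm n)) -
      β * ∫ y, y j * (U y ^ 2 * V y ^ 2) ∂(gm n) -
      2 * (∫ y, pd j U y * (eul U y - S * U y) ∂(gm n) +
        ∫ y, pd j V y * (eul V y - S * V y) ∂(gm n)) := by
  have hU := h.hU; have hV := h.hV
  have a1 := h.integral_coord_gdot j
  have a2 := h.symm.integral_coord_gdot j
  have a3 := h.integral_pd_edens j
  have e0 : ∀ y, y j * edens β U V y = (y j * gdot U U y + y j * gdot V V y) +
      β * (y j * (U y ^ 2 * V y ^ 2)) := fun y => by unfold edens; ring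
  simp only [e0] at a3
  rw [gint_add (by fun_prop) (by fun_prop), gint_add (by fun_prop) (by fun_prop),
    integral_const_mul] at a3
  simp only [mul_comm (V _ ^ 2) (U _ ^ 2)] at a2
  have b : ∀ {f : Eu n → ℝ}, f.HasTemperateGrowth →
      ∫ y, (y j * f y) * (eul f y - S * f y) ∂(gm n) =
        ∫ y, y j * (f y * eul f y) ∂(gm n) - S * ∫ y, y j * f y ^ 2 ∂(gm n) := by
    intro f hf
    rw [← integral_const_mul, ← gint_sub (by fun_prop) (by fun_prop)]
    exact integral_congr_ae (.of_forall fun y => by simp only; ring)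
  have c : ∀ {f : Eu n → ℝ}, f.HasTemperateGrowth →
      ∫ y, pd j f y * (eul f y - S * f y) ∂(gm n) =
        ∫ y, pd j f y * eul f y ∂(gm n) - S * (1 / 2 * ∫ y, y j * f y ^ 2 ∂(gm n)) := by
    intro f hf
    rw [← integral_pd_mul_self hf j, ← integral_const_mul, ← gint_sub (by fun_prop) (by fun_prop)]
    exact integral_congr_ae (.of_forall fun y => by simp only; ring)
  rw [b hU, b hV, c hU, c hV]
  linarith

lemma Nrm.abs_integral_coord_pot_le (h : Nrm K ℓ U V) (hδ : dls (ℓ ^ 120) U V ≤ 1) (j : Fin n) :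
    |ℓ ^ 120 * ∫ y, y j * (U y ^ 2 * V y ^ 2) ∂(gm n)| ≤
      Real.sqrt (10 + n) * Real.sqrt (dls (ℓ ^ 120) U V) := by
  have hU := h.hU; have hV := h.hV
  have hβ := h.hβ
  set β := ℓ ^ 120 with hβd
  have h1 : sq (fun y => y j * (U y * V y)) * β ≤ 10 + n := by
    have i1 := h.integral_eul_edens
    rw [integral_eul h.tame_edens, h.integral_edens] at i1
    have i2 : sq (fun y => y j * (U y * V y)) * β ≤
        ∫ y, ‖y‖ ^ 2 * edens β U V y ∂(gm n) := by
      rw [mul_comm, sq, ← integral_const_mul]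
      have ht := h.tame_edens
      refine CP.integral_mono (Function.HasTemperateGrowth.cp (by fun_prop))
        ((CP.norm.pow 2).mul ht.cp) fun y => ?_
      have j1 : (y j) ^ 2 ≤ ‖y‖ ^ 2 := by
        rw [← sq_abs (y j)]
        exact pow_le_pow_left₀ (abs_nonneg _) (abs_coord_le y j) 2
      have j2 : β * (U y ^ 2 * V y ^ 2) ≤ edens β U V y := by
        have g1 : 0 ≤ gdot U U y := Finset.sum_nonneg fun _ _ => mul_self_nonneg _
        have g2 : 0 ≤ gdot V V y := Finset.sum_nonneg fun _ _ => mul_self_nonneg _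
        unfold edens; linarith
      calc β * (y j * (U y * V y)) ^ 2 = y j ^ 2 * (β * (U y ^ 2 * V y ^ 2)) := by ring
        _ ≤ _ := mul_le_mul j1 j2 (mul_nonneg hβ.le (by positivity)) (sq_nonneg _)
    have hd := h.dls_eq
    have hen := h.energy
    have hS2 := h.S_le_two
    have hS0 := h.S_nonneg
    have hP := h.pot_nonneg
    have hPS := mul_nonneg hP (by linarith : 0 ≤ 1 + Ss U V)
    have hQ : Qs U V ≤ 5 := by
      have := pow_le_pow_left₀ hS0 hS2 2
      linarith
    have hD : 0 ≤ Ds U V := add_nonneg (dir_nonneg U) (dir_nonneg V)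
    unfold Qs at hQ
    unfold Ds at hen hD
    have hn : (n : ℝ) * (dir U + dir V + pot β U V) ≤ n * 1 :=
      mul_le_mul_of_nonneg_left hen (Nat.cast_nonneg n)
    linarith
  have h2 := CP.cauchy_schwarz (f := fun y => y j * (U y * V y)) (g := fun y => U y * V y)
    (Function.HasTemperateGrowth.cp (by fun_prop)) (Function.HasTemperateGrowth.cp (by fun_prop))
  have e : ∀ y : Eu n, y j * (U y * V y) * (U y * V y) = y j * (U y ^ 2 * V y ^ 2) :=
    fun y => by ring
  simp only [e] at h2
  have h3 : β * sq (fun y => U y * V y) ≤ dls β U V := by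
    refine le_trans (le_of_eq ?_) h.pot_le_dls
    unfold sq pot; simp only [mul_pow, hβd]
  rw [← Real.sqrt_mul (by positivity)]
  refine Real.abs_le_sqrt ?_
  calc (β * ∫ y, y j * (U y ^ 2 * V y ^ 2) ∂(gm n)) ^ 2
      ≤ β ^ 2 * (sq (fun y => y j * (U y * V y)) * sq (fun y => U y * V y)) := by
        rw [mul_pow]; exact mul_le_mul_of_nonneg_left h2 (sq_nonneg _)
    _ = (sq (fun y => y j * (U y * V y)) * β) * (β * sq (fun y => U y * V y)) := by ring
    _ ≤ _ := mul_le_mul h1 h3 (mul_nonneg hβ.le (sq_nonneg' _)) (by positivity)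

/-- The first moments are controlled by the derivative of the frequency. -/
lemma exists_moment_le (n : ℕ) (K : ℝ) : ∃ C : ℝ, 0 ≤ C ∧ ∀ (ℓ : ℝ) (U V : Eu n → ℝ),
    Nrm K ℓ U V → dls (ℓ ^ 120) U V ≤ 1 → ∀ j,
      |∫ y, y j * U y ^ 2 ∂(gm n) + ∫ y, y j * V y ^ 2 ∂(gm n)| ≤
        C * Real.sqrt (dls (ℓ ^ 120) U V) := by
  set J : ℝ := K ^ 2 * ∫ y : Eu n, (1 + ‖y‖) ^ 4 ∂(gm n) with hJ
  refine ⟨4 * Real.sqrt J + 2 * Real.sqrt (10 + n) + 8, by positivity,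
    fun ℓ U V h hδ j => ?_⟩
  have hU := h.hU; have hV := h.hV
  have hid := h.moment_identity (Ss U V) j
  have hR := h.abs_integral_coord_pot_le hδ j
  have hdef := h.sq_defect_add_le
  have hen := h.energy
  have hP := h.pot_nonneg
  set δ := dls (ℓ ^ 120) U V with hδd
  set S := Ss U V
  have hεu : Real.sqrt (sq (fun y => eul U y - S * U y)) ≤ Real.sqrt δ :=
    Real.sqrt_le_sqrt (by linarith [sq_nonneg' (fun y => eul V y - S * V y)])
  have hεv : Real.sqrt (sq (fun y => eul V y - S * V y)) ≤ Real.sqrt δ :=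
    Real.sqrt_le_sqrt (by linarith [sq_nonneg' (fun y => eul U y - S * U y)])
  have hdU : Real.sqrt (sq (pd j U)) ≤ 1 := Real.sqrt_le_one.mpr
    ((sq_pd_le_dir hU j).trans (by unfold Ds at hen; linarith [dir_nonneg V]))
  have hdV : Real.sqrt (sq (pd j V)) ≤ 1 := Real.sqrt_le_one.mpr
    ((sq_pd_le_dir hV j).trans (by unfold Ds at hen; linarith [dir_nonneg U]))
  have hyU : Real.sqrt (sq (fun y => y j * U y)) ≤ Real.sqrt J :=
    Real.sqrt_le_sqrt (sq_coord_mul_le hU.cp (fun y => (h.posU y).le) h.U_le j)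
  have hyV : Real.sqrt (sq (fun y => y j * V y)) ≤ Real.sqrt J :=
    Real.sqrt_le_sqrt (sq_coord_mul_le hV.cp (fun y => (h.posV y).le) h.symm.U_le j)
  have b1 := (CP.abs_integral_mul_le (f := fun y => y j * U y) (g := fun y => eul U y - S * U y)
    (Function.HasTemperateGrowth.cp (by fun_prop))
    (Function.HasTemperateGrowth.cp (by fun_prop))).trans
    (mul_le_mul hyU hεu (Real.sqrt_nonneg _) (Real.sqrt_nonneg _))
  have b2 := (CP.abs_integral_mul_le (f := fun y => y j * V y) (g := fun y => eul V y - S * V y)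
    (Function.HasTemperateGrowth.cp (by fun_prop))
    (Function.HasTemperateGrowth.cp (by fun_prop))).trans
    (mul_le_mul hyV hεv (Real.sqrt_nonneg _) (Real.sqrt_nonneg _))
  have b3 := (CP.abs_integral_mul_le (f := pd j U) (g := fun y => eul U y - S * U y)
    (Function.HasTemperateGrowth.cp (by fun_prop))
    (Function.HasTemperateGrowth.cp (by fun_prop))).trans
    (mul_le_mul hdU hεu (Real.sqrt_nonneg _) zero_le_one)
  have b4 := (CP.abs_integral_mul_le (f := pd j V) (g := fun y => eul V y - S * V y)
    (Function.HasTemperateGrowth.cp (by fun_prop))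
    (Function.HasTemperateGrowth.cp (by fun_prop))).trans
    (mul_le_mul hdV hεv (Real.sqrt_nonneg _) zero_le_one)
  rw [abs_le] at b1 b2 b3 b4 hR ⊢
  constructor <;> linarith [b1.1, b1.2, b2.1, b2.2, b3.1, b3.2, b4.1, b4.2, hR.1, hR.2]

end Moment

/-- Odd functions have mean zero. -/
lemma integral_of_odd {n : ℕ} {f : Eu n → ℝ} (hf : ∀ y, f (-y) = -f y) :
    ∫ y, f y ∂(gm n) = 0 := by
  have h1 : ∫ y, f y ∂(gm n) = -∫ y, f y ∂(gm n) := by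
    conv_lhs => rw [integral_gm, ← integral_neg_eq_self]
    rw [integral_gm, ← integral_neg]
    refine integral_congr_ae (.of_forall fun y => ?_)
    simp only [hf, gdens, norm_neg]
    ring
  linarith

section Mean

variable {n : ℕ} {K C ℓ : ℝ} {U V F G : Eu n → ℝ}

/-- The linear part of the truncated difference. -/
def linPart {n : ℕ} (h : Eu n → ℝ) (y : Eu n) : ℝ := ∑ i, (∫ z, pd i h z ∂(gm n)) * y i

lemma cp_linPart (h : Eu n → ℝ) : CP (linPart h) :=
  CP.sum fun i _ => (CP.coord i).const_mul _

lemma integral_linPart_cube (h : Eu n → ℝ) : ∫ y, linPart h y ^ 3 ∂(gm n) = 0 := by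
  refine integral_of_odd fun y => ?_
  have : linPart h (-y) = -linPart h y := by
    simp only [linPart, PiLp.neg_apply, mul_neg, Finset.sum_neg_distrib]
  rw [this]; ring

lemma Cut.abs_integral_pd_comb_le (hc : Cut C ℓ U V F G) (h : Nrm K ℓ U V) (hω : C / ℓ ≤ 1) (i : Fin n) : |∫ z, pd i (comb F G) z ∂(gm n)| ≤ 2 := by
  refine abs_le_of_sq_le_sq ?_ (by norm_num)
  refine (hc.cp_pd_comb i).integral_sq_le.trans ?_
  have h1 : sq (pd i (comb F G)) ≤ ∑ i, ∫ y, pd i (comb F G) y ^ 2 ∂(gm n) :=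
    Finset.single_le_sum (f := fun i => ∫ y, pd i (comb F G) y ^ 2 ∂(gm n))
      (fun i _ => integral_nonneg fun _ => sq_nonneg _) (Finset.mem_univ i)
  rw [hc.dir_comb] at h1
  have hp : (∫ z, F z ∂(gm n)) ^ 2 ≤ 1 :=
    (hc.cpF.integral_sq_le.trans (hc.sqF_le h)).trans h.sqU_le_one
  have hq : (∫ z, G z ∂(gm n)) ^ 2 ≤ 1 :=
    (hc.cpG.integral_sq_le.trans (hc.sqG_le h)).trans h.symm.sqU_le_one
  have h2 := mul_le_mul_of_nonneg_right hq (dir_nonneg F)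
  have h3 := mul_le_mul_of_nonneg_right hp (dir_nonneg G)
  have h4 := hc.dirF
  have h5 := hc.dirG
  have h6 := h.energy
  have h7 := h.S_le_two
  have h8 := h.pot_nonneg
  have hu : 0 ≤ ue U := by rw [h.ue_eq]; linarith [dir_nonneg U]
  have hv : 0 ≤ ue V := by rw [h.ueV_eq]; linarith [dir_nonneg V]
  unfold Ss at h7
  unfold Ds at h6
  have h9 : C / ℓ * ue V ≤ 1 * 2 := mul_le_mul hω (by linarith) hv zero_le_one
  linarith

lemma Cut.abs_linPart_le (hc : Cut C ℓ U V F G) (h : Nrm K ℓ U V) (hω : C / ℓ ≤ 1) (y : Eu n) : |linPart (comb F G) y| ≤ 2 * n * (1 + ‖y‖) := by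
  refine (Finset.abs_sum_le_sum_abs _ _).trans ?_
  have : ∀ i ∈ Finset.univ, |(∫ z, pd i (comb F G) z ∂(gm n)) * y i| ≤ 2 * (1 + ‖y‖) := by
    intro i _
    rw [abs_mul]
    exact mul_le_mul (hc.abs_integral_pd_comb_le h hω i)
      ((abs_coord_le y i).trans (by linarith)) (abs_nonneg _) (by norm_num)
  refine (Finset.sum_le_card_nsmul _ _ _ this).trans (le_of_eq ?_)
  simp; ring

lemma Cut.abs_comb_le (hc : Cut C ℓ U V F G) (h : Nrm K ℓ U V) (y : Eu n) :
    |comb F G y| ≤ 2 * K * (1 + ‖y‖) := by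
  have hp : ∫ z, F z ∂(gm n) ≤ 1 := by
    refine le_of_sq_le_sq ?_ zero_le_one
    rw [one_pow]
    exact (hc.cpF.integral_sq_le.trans (hc.sqF_le h)).trans h.sqU_le_one
  have hq : ∫ z, G z ∂(gm n) ≤ 1 := by
    refine le_of_sq_le_sq ?_ zero_le_one
    rw [one_pow]
    exact (hc.cpG.integral_sq_le.trans (hc.sqG_le h)).trans h.symm.sqU_le_one
  have h1 := mul_le_mul hq ((hc.F_le y).trans (h.U_le y)) (hc.F_nonneg y) zero_le_one
  have h2 := mul_le_mul hp ((hc.G_le y).trans (h.symm.U_le y)) (hc.G_nonneg y) zero_le_one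
  have h3 := mul_nonneg hc.integral_G_nonneg (hc.F_nonneg y)
  have h4 := mul_nonneg hc.integral_F_nonneg (hc.G_nonneg y)
  unfold comb
  rw [abs_le]
  constructor <;> linarith

lemma Cut.sq_comb_sub_linPart_le (hc : Cut C ℓ U V F G) :
    sq (fun y => comb F G y - linPart (comb F G) y) ≤ 7 * deficit (comb F G) :=
  poincare_stability hc.differentiable_comb hc.cp_comb.2 (fun i => (hc.cp_pd_comb i).2)
    hc.integral_comb

/-- The cubic comparison of the truncations. -/
lemma Cut.abs_integral_comb_cube_le (hc : Cut C ℓ U V F G) (h : Nrm K ℓ U V) (hω : C / ℓ ≤ 1) :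
    |(∫ z, G z ∂(gm n)) ^ 3 * ∫ y, F y ^ 3 ∂(gm n) -
        (∫ z, F z ∂(gm n)) ^ 3 * ∫ y, G y ^ 3 ∂(gm n)| ≤
      Real.sqrt (7 * deficit (comb F G)) *
        (6 * (K ^ 2 + n ^ 2) * Real.sqrt (∫ y : Eu n, (1 + ‖y‖) ^ 4 ∂(gm n))) := by
  set f := comb F G with hf
  set l := linPart f with hl
  have hfc : CP f := hc.cp_comb
  have hlc : CP l := cp_linPart f
  have e1 : ∫ y, f y ^ 3 ∂(gm n) = (∫ z, G z ∂(gm n)) ^ 3 * ∫ y, F y ^ 3 ∂(gm n) -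
        (∫ z, F z ∂(gm n)) ^ 3 * ∫ y, G y ^ 3 ∂(gm n) := by
    rw [← integral_const_mul, ← integral_const_mul,
      ← CP.integral_sub ((hc.cpF.pow 3).const_mul _) ((hc.cpG.pow 3).const_mul _)]
    refine integral_congr_ae (.of_forall fun y => ?_)
    simp only [hf, comb]
    linear_combination (-3 * (∫ z, G z ∂(gm n)) ^ 2 * (∫ z, F z ∂(gm n)) * F y +
      3 * (∫ z, G z ∂(gm n)) * (∫ z, F z ∂(gm n)) ^ 2 * G y) * hc.mul_eq y
  have hg : CP fun y => f y ^ 2 + f y * l y + l y ^ 2 :=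
    ((hfc.pow 2).add (hfc.mul hlc)).add (hlc.pow 2)
  have e2 : ∫ y, f y ^ 3 ∂(gm n) =
      ∫ y, (f y - l y) * (f y ^ 2 + f y * l y + l y ^ 2) ∂(gm n) := by
    have : ∀ y, (f y - l y) * (f y ^ 2 + f y * l y + l y ^ 2) = f y ^ 3 - l y ^ 3 :=
      fun y => by ring
    simp only [this]
    rw [CP.integral_sub (hfc.pow 3) (hlc.pow 3), hl, integral_linPart_cube, sub_zero]
  rw [← e1, e2]
  refine (CP.abs_integral_mul_le (hfc.sub hlc) hg).trans ?_
  refine mul_le_mul (Real.sqrt_le_sqrt hc.sq_comb_sub_linPart_le) ?_ (Real.sqrt_nonneg _)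
    (Real.sqrt_nonneg _)
  have hb : sq (fun y => f y ^ 2 + f y * l y + l y ^ 2) ≤
      (6 * (K ^ 2 + n ^ 2)) ^ 2 * ∫ y : Eu n, (1 + ‖y‖) ^ 4 ∂(gm n) := by
    rw [← integral_const_mul]
    refine CP.integral_mono (hg.pow 2) ((cp_one_add_norm_pow n 4).const_mul _) fun y => ?_
    have b1 := sq_le_sq' (abs_le.1 (hc.abs_comb_le h y)).1 (abs_le.1 (hc.abs_comb_le h y)).2
    have b2 := sq_le_sq' (abs_le.1 (hc.abs_linPart_le h hω y)).1
      (abs_le.1 (hc.abs_linPart_le h hω y)).2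
    have b0 : 0 ≤ f y ^ 2 + f y * l y + l y ^ 2 := by
      nlinarith [sq_nonneg (f y + l y), sq_nonneg (f y), sq_nonneg (l y)]
    have b3 : f y ^ 2 + f y * l y + l y ^ 2 ≤ 6 * (K ^ 2 + n ^ 2) * (1 + ‖y‖) ^ 2 := by
      have : f y * l y ≤ (f y ^ 2 + l y ^ 2) / 2 := by nlinarith [sq_nonneg (f y - l y)]
      linarith
    calc (f y ^ 2 + f y * l y + l y ^ 2) ^ 2 ≤ (6 * (K ^ 2 + n ^ 2) * (1 + ‖y‖) ^ 2) ^ 2 :=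
          pow_le_pow_left₀ b0 b3 2
      _ = _ := by ring
  refine (Real.sqrt_le_sqrt hb).trans (le_of_eq ?_)
  rw [Real.sqrt_mul (sq_nonneg _), Real.sqrt_sq (by positivity)]

/-- The linear comparison of the truncations. -/
lemma Cut.abs_integral_comb_sq_le (hc : Cut C ℓ U V F G) (h : Nrm K ℓ U V) (hω : C / ℓ ≤ 1) {m : ℝ} (hm : ∀ j,
      |∫ y, y j * U y ^ 2 ∂(gm n) + ∫ y, y j * V y ^ 2 ∂(gm n)| ≤ m) :
    |(∫ z, G z ∂(gm n)) * ∫ y, F y ^ 3 ∂(gm n) -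
        (∫ z, F z ∂(gm n)) * ∫ y, G y ^ 3 ∂(gm n)| ≤
      Real.sqrt (7 * deficit (comb F G)) *
        (K * Real.sqrt (∫ y : Eu n, (1 + ‖y‖) ^ 4 ∂(gm n))) + 2 * n * (C / ℓ) + 2 * n * m := by
  set f := comb F G with hf
  set l := linPart f with hl
  have hfc : CP f := hc.cp_comb
  have hlc : CP l := cp_linPart f
  have hU := h.hU.cp
  have hV := h.hV.cp
  have hw : CP fun y => F y ^ 2 + G y ^ 2 := (hc.cpF.pow 2).add (hc.cpG.pow 2)
  have hw' : CP fun y => U y ^ 2 + V y ^ 2 := (hU.pow 2).add (hV.pow 2)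
  have hwle : ∀ y, F y ^ 2 + G y ^ 2 ≤ U y ^ 2 + V y ^ 2 := fun y =>
    add_le_add (pow_le_pow_left₀ (hc.F_nonneg y) (hc.F_le y) 2)
      (pow_le_pow_left₀ (hc.G_nonneg y) (hc.G_le y) 2)
  have e1 : ∫ y, f y * (F y ^ 2 + G y ^ 2) ∂(gm n) =
      (∫ z, G z ∂(gm n)) * ∫ y, F y ^ 3 ∂(gm n) -
        (∫ z, F z ∂(gm n)) * ∫ y, G y ^ 3 ∂(gm n) := by
    rw [← integral_const_mul, ← integral_const_mul,
      ← CP.integral_sub ((hc.cpF.pow 3).const_mul _) ((hc.cpG.pow 3).const_mul _)]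
    refine integral_congr_ae (.of_forall fun y => ?_)
    simp only [hf, comb]
    linear_combination ((∫ z, G z ∂(gm n)) * G y - (∫ z, F z ∂(gm n)) * F y) * hc.mul_eq y
  have e2 : ∫ y, f y * (F y ^ 2 + G y ^ 2) ∂(gm n) =
      ∫ y, (f y - l y) * (F y ^ 2 + G y ^ 2) ∂(gm n) -
        ∫ y, l y * ((U y ^ 2 + V y ^ 2) - (F y ^ 2 + G y ^ 2)) ∂(gm n) +
        ∫ y, l y * (U y ^ 2 + V y ^ 2) ∂(gm n) := by
    rw [← CP.integral_sub ((hfc.sub hlc).mul hw) (hlc.mul (hw'.sub hw)),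
      ← CP.integral_add (((hfc.sub hlc).mul hw).sub (hlc.mul (hw'.sub hw))) (hlc.mul hw')]
    exact integral_congr_ae (.of_forall fun y => by simp only; ring)
  have t1 : |∫ y, (f y - l y) * (F y ^ 2 + G y ^ 2) ∂(gm n)| ≤
      Real.sqrt (7 * deficit f) * (K * Real.sqrt (∫ y : Eu n, (1 + ‖y‖) ^ 4 ∂(gm n))) := by
    refine (CP.abs_integral_mul_le (hfc.sub hlc) hw).trans ?_
    refine mul_le_mul (Real.sqrt_le_sqrt hc.sq_comb_sub_linPart_le) ?_ (Real.sqrt_nonneg _)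
      (Real.sqrt_nonneg _)
    have hb : sq (fun y => F y ^ 2 + G y ^ 2) ≤ K ^ 2 * ∫ y : Eu n, (1 + ‖y‖) ^ 4 ∂(gm n) := by
      rw [← integral_const_mul]
      refine CP.integral_mono (hw.pow 2) ((cp_one_add_norm_pow n 4).const_mul _) fun y => ?_
      calc (F y ^ 2 + G y ^ 2) ^ 2 ≤ (K * (1 + ‖y‖) ^ 2) ^ 2 :=
            pow_le_pow_left₀ (by positivity) ((hwle y).trans (h.bound y)) 2
        _ = _ := by ring
    refine (Real.sqrt_le_sqrt hb).trans (le_of_eq ?_)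
    rw [Real.sqrt_mul (sq_nonneg _), Real.sqrt_sq (by linarith [h.one_le_K])]
  have t2 : |∫ y, l y * ((U y ^ 2 + V y ^ 2) - (F y ^ 2 + G y ^ 2)) ∂(gm n)| ≤
      2 * n * (C / ℓ) := by
    have hN : CP fun y : Eu n => 1 + ‖y‖ := (CP.const 1).add CP.norm
    calc _ ≤ ∫ y, |l y * ((U y ^ 2 + V y ^ 2) - (F y ^ 2 + G y ^ 2))| ∂(gm n) :=
          abs_integral_le_integral_abs
      _ ≤ ∫ y, (2 * n) * ((1 + ‖y‖) * ((U y ^ 2 + V y ^ 2) - (F y ^ 2 + G y ^ 2))) ∂(gm n) := by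
          refine CP.integral_mono (hlc.mul (hw'.sub hw)).abs
            ((hN.mul (hw'.sub hw)).const_mul _) fun y => ?_
          rw [abs_mul, abs_of_nonneg (sub_nonneg.2 (hwle y)), ← mul_assoc]
          exact mul_le_mul_of_nonneg_right (hc.abs_linPart_le h hω y)
            (sub_nonneg.2 (hwle y))
      _ ≤ _ := by
          rw [integral_const_mul]
          exact mul_le_mul_of_nonneg_left hc.close (by positivity)
  have t3 : |∫ y, l y * (U y ^ 2 + V y ^ 2) ∂(gm n)| ≤ 2 * n * m := by
    have e : ∀ y, l y * (U y ^ 2 + V y ^ 2) = ∑ i, (∫ z, pd i f z ∂(gm n)) *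
        (y i * U y ^ 2 + y i * V y ^ 2) := fun y => by
      simp only [hl, linPart, Finset.sum_mul]
      exact Finset.sum_congr rfl fun i _ => by ring
    have hi : ∀ i, CP fun y : Eu n => y i * U y ^ 2 + y i * V y ^ 2 := fun i =>
      ((CP.coord i).mul (hU.pow 2)).add ((CP.coord i).mul (hV.pow 2))
    simp only [e]
    rw [integral_finsetSum _ fun i _ => ((hi i).const_mul _).integrable]
    refine (Finset.abs_sum_le_sum_abs _ _).trans ?_
    have : ∀ i ∈ Finset.univ, |∫ y, (∫ z, pd i f z ∂(gm n)) *
        (y i * U y ^ 2 + y i * V y ^ 2) ∂(gm n)| ≤ 2 * m := by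
      intro i _
      rw [integral_const_mul, abs_mul, CP.integral_add ((CP.coord i).mul (hU.pow 2))
        ((CP.coord i).mul (hV.pow 2))]
      exact mul_le_mul (hc.abs_integral_pd_comb_le h hω i) (hm i) (abs_nonneg _)
        (by norm_num)
    refine (Finset.sum_le_card_nsmul _ _ _ this).trans (le_of_eq ?_)
    simp; ring
  rw [← e1, e2]
  rw [abs_le] at t1 t2 t3 ⊢
  constructor <;> linarith [t1.1, t1.2, t2.1, t2.2, t3.1, t3.2]

end Mean

section Mean

variable {n : ℕ} {K C ℓ : ℝ} {U V F G : Eu n → ℝ}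

/-- The means of the two truncations are comparable up to the deficit. -/
lemma exists_mean_sq_sub_le (n : ℕ) (K : ℝ) {c : ℝ} (hc0 : 0 < c) : ∃ μ > 0, ∃ B : ℝ, 0 ≤ B ∧
    ∀ (C ℓ : ℝ) (U V F G : Eu n → ℝ), Nrm K ℓ U V → Cut C ℓ U V F G → 0 ≤ C / ℓ → C / ℓ ≤ c / 4 →
      dls (ℓ ^ 120) U V ≤ 1 → c ≤ sq U → c ≤ sq V →
      μ ≤ ∫ z, F z ∂(gm n) ∧ μ ≤ ∫ z, G z ∂(gm n) ∧
      |(∫ z, G z ∂(gm n)) ^ 2 - (∫ z, F z ∂(gm n)) ^ 2| ≤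
        B * (Real.sqrt (deficit (comb F G)) + Real.sqrt (dls (ℓ ^ 120) U V) + C / ℓ) := by
  obtain ⟨M, hM, hmom⟩ := exists_moment_le n K
  set J3 : ℝ := |K| ^ 3 * ∫ y : Eu n, (1 + ‖y‖) ^ 3 ∂(gm n) with hJ3
  have hJ30 : 0 ≤ J3 := mul_nonneg (by positivity) (integral_nonneg fun y => by positivity)
  set J4 : ℝ := Real.sqrt (∫ y : Eu n, (1 + ‖y‖) ^ 4 ∂(gm n)) with hJ4
  have hJ40 : 0 ≤ J4 := Real.sqrt_nonneg _
  set μ : ℝ := c ^ 2 / 4 / (J3 + 1) with hμ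
  have hμ0 : 0 < μ := by positivity
  set ν : ℝ := μ * (c ^ 2 / 4) with hν
  have hν0 : 0 < ν := by positivity
  set B : ℝ := (3 * (6 * (K ^ 2 + n ^ 2) * J4) + 3 * (|K| * J4) + 2 * n + 2 * n * M) / ν with hB
  have hB0 : 0 ≤ B := by positivity
  refine ⟨μ, hμ0, B, hB0, fun C ℓ U V F G h hc hω0 hω hδ hcU hcV => ?_⟩
  have hK := h.one_le_K
  have hKabs : |K| = K := abs_of_pos (by linarith)
  have hU1 := h.sqU_le_one
  have hS2 := h.S_le_two
  have huU : 0 ≤ ue U := by rw [h.ue_eq]; linarith [dir_nonneg U, h.pot_nonneg]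
  have huV : 0 ≤ ue V := by rw [h.ueV_eq]; linarith [dir_nonneg V, h.pot_nonneg]
  have hp0 := hc.integral_F_nonneg
  have hq0 := hc.integral_G_nonneg
  have hp1 : (∫ z, F z ∂(gm n)) ^ 2 ≤ 1 :=
    (hc.cpF.integral_sq_le.trans (hc.sqF_le h)).trans h.sqU_le_one
  have hq1 : (∫ z, G z ∂(gm n)) ^ 2 ≤ 1 :=
    (hc.cpG.integral_sq_le.trans (hc.sqG_le h)).trans h.symm.sqU_le_one
  have hF2 : c / 2 ≤ sq F := by have := hc.sqF; linarith
  have hG2 : c / 2 ≤ sq G := by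
    have h1 := hc.sqG
    unfold Ss at hS2
    have h2 : C / ℓ * ue V ≤ c / 4 * 2 := mul_le_mul hω (by linarith) huV (by linarith)
    linarith
  have hF3 := integral_sq_sq_le hc.cpF hc.F_nonneg
  have hG3 := integral_sq_sq_le hc.cpG hc.G_nonneg
  have hF4 := h.integral_cube_le hc.cpF hc.F_nonneg hc.F_le
  have hG4 := h.symm.integral_cube_le hc.cpG hc.G_nonneg hc.G_le
  have hF5 := pow_le_pow_left₀ (by positivity) hF2 2
  have hG5 := pow_le_pow_left₀ (by positivity) hG2 2
  rw [← hKabs] at hF4 hG4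
  have hE1 := hc.abs_integral_comb_sq_le h (by linarith) (hmom ℓ U V h hδ)
  have hE2 := hc.abs_integral_comb_cube_le h (by linarith)
  rw [Real.sqrt_mul (by norm_num)] at hE1 hE2
  have h7 : Real.sqrt 7 ≤ 3 := by
    rw [Real.sqrt_le_left (by norm_num)]; norm_num
  set d := Real.sqrt (deficit (comb F G)) with hd
  have hd0 : 0 ≤ d := Real.sqrt_nonneg _
  set e := Real.sqrt (dls (ℓ ^ 120) U V) with he
  have he0 : 0 ≤ e := Real.sqrt_nonneg _
  set ω := C / ℓ
  set p := ∫ z, F z ∂(gm n)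
  set q := ∫ z, G z ∂(gm n)
  set A3 := ∫ y, F y ^ 3 ∂(gm n)
  set B3 := ∫ y, G y ^ 3 ∂(gm n)
  have hμp : μ ≤ p := by
    rw [hμ, div_le_iff₀ (by positivity)]
    have := mul_le_mul_of_nonneg_left (hF4.trans (by linarith : J3 ≤ J3 + 1)) hp0
    linarith
  have hμq : μ ≤ q := by
    rw [hμ, div_le_iff₀ (by positivity)]
    have := mul_le_mul_of_nonneg_left (hG4.trans (by linarith : J3 ≤ J3 + 1)) hq0
    linarith
  refine ⟨hμp, hμq, ?_⟩
  have hq1' : q ≤ 1 := le_of_sq_le_sq (by rwa [one_pow]) zero_le_one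
  have hB3n : 0 ≤ B3 := integral_nonneg fun y => pow_nonneg (hc.G_nonneg y) 3
  have hB3 : c ^ 2 / 4 ≤ B3 := by
    have := mul_le_mul_of_nonneg_right hq1' hB3n
    linarith
  have hpB : ν ≤ p * B3 := mul_le_mul hμp hB3 (by positivity) hp0
  have hd7 : Real.sqrt 7 * d ≤ 3 * d := mul_le_mul_of_nonneg_right h7 hd0
  have hE3 : |q ^ 2 * (q * A3 - p * B3)| ≤ |q * A3 - p * B3| := by
    rw [abs_mul, abs_of_nonneg (sq_nonneg q)]
    exact mul_le_of_le_one_left (abs_nonneg _) hq1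
  have hE4 : ν * |q ^ 2 - p ^ 2| ≤ |q ^ 3 * A3 - p ^ 3 * B3| + |q * A3 - p * B3| := by
    calc ν * |q ^ 2 - p ^ 2| ≤ (p * B3) * |q ^ 2 - p ^ 2| :=
          mul_le_mul_of_nonneg_right hpB (abs_nonneg _)
      _ = |(p * B3) * (q ^ 2 - p ^ 2)| := by rw [abs_mul, abs_of_nonneg (hν0.le.trans hpB)]
      _ = |(q ^ 3 * A3 - p ^ 3 * B3) - q ^ 2 * (q * A3 - p * B3)| := by congr 1; ring
      _ ≤ _ := (abs_sub _ _).trans (by linarith)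
  have hx1 : 0 ≤ 6 * (K ^ 2 + (n : ℝ) ^ 2) * J4 := by positivity
  have hx2 : 0 ≤ K * J4 := by rw [← hKabs]; positivity
  have i1 := mul_le_mul_of_nonneg_right hd7 hx1
  have i2 := mul_le_mul_of_nonneg_right hd7 hx2
  rw [hB, hKabs, div_mul_eq_mul_div, le_div_iff₀ hν0]
  have hn : (0 : ℝ) ≤ n := Nat.cast_nonneg n
  have k1 := mul_nonneg (mul_nonneg hx1 (by norm_num : (0 : ℝ) ≤ 3)) (add_nonneg he0 hω0)
  have k2 := mul_nonneg (mul_nonneg hx2 (by norm_num : (0 : ℝ) ≤ 3)) (add_nonneg he0 hω0)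
  have k3 := mul_nonneg (mul_nonneg (by norm_num : (0 : ℝ) ≤ 2) hn) (add_nonneg hd0 he0)
  have k4 := mul_nonneg (mul_nonneg (mul_nonneg (by norm_num : (0 : ℝ) ≤ 2) hn) hM)
    (add_nonneg hd0 hω0)
  linarith

/-- When both components carry mass, the frequency is almost at least one, up to its derivative. -/
lemma exists_one_sub_S_le (n : ℕ) (K : ℝ) {c : ℝ} (hc0 : 0 < c) : ∃ A : ℝ, 0 ≤ A ∧
    ∀ (ℓ : ℝ) (U V : Eu n → ℝ), Nrm K ℓ U V → c ≤ sq U → c ≤ sq V →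
      1 - Ss U V ≤ A * (dls (ℓ ^ 120) U V + 1 / ℓ) := by
  obtain ⟨C, hC, hcut⟩ := exists_cut n K
  obtain ⟨μ, hμ, B, hB, hmean⟩ := exists_mean_sq_sub_le n K hc0
  set A₀ : ℝ := (B ^ 2 + B + (B + 4) * C) / μ ^ 2 with hA₀
  have hA₀0 : 0 ≤ A₀ := by positivity
  refine ⟨1 + 4 * C / c + A₀ * (1 + C), by positivity, fun ℓ U V h hcU hcV => ?_⟩
  have hℓ0 : 0 < ℓ := one_pos.trans_le h.one_le
  have hδ0 := h.dls_nonneg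
  have hS0 := h.S_nonneg
  set δ := dls (ℓ ^ 120) U V with hδ
  set τ : ℝ := 1 / ℓ with hτ
  have hτ0 : 0 < τ := by positivity
  have x1 : 0 ≤ 4 * C / c * δ := by positivity
  have x2 : 0 ≤ A₀ * (1 + C) * (δ + τ) := by positivity
  have x3 : 0 ≤ 4 * C / c * τ := by positivity
  by_cases hδ1 : 1 < δ
  · linarith
  push Not at hδ1
  have hCτ : C / ℓ = C * τ := by rw [hτ]; ring
  by_cases hω1 : c / 4 < C / ℓ
  · have : 1 ≤ 4 * C / c * τ := by
      rw [div_mul_eq_mul_div, le_div_iff₀ hc0]; linarith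
    linarith
  push Not at hω1
  by_cases hS1 : 1 < Ss U V
  · have : 0 ≤ (1 + 4 * C / c + A₀ * (1 + C)) * (δ + τ) := by positivity
    linarith
  push Not at hS1
  obtain ⟨F, G, hc⟩ := hcut ℓ U V h
  have hω0 : 0 ≤ C / ℓ := by positivity
  obtain ⟨hμp, hμq, hpq⟩ := hmean C ℓ U V F G h hc hω0 hω1 hδ1 hcU hcV
  have hdef := hc.deficit_le h
  have hdef0 := hc.deficit_nonneg
  have hdf := h.sq_defect_add_le
  have hm := h.mass
  have hP := h.pot_nonneg
  have hue := h.ue_eq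
  have huV : 0 ≤ ue V := by rw [h.ueV_eq]; linarith [dir_nonneg V]
  have huU : 0 ≤ ue U := by rw [h.ue_eq]; linarith [dir_nonneg U]
  rw [← hδ] at hpq hdf
  have hp1 : (∫ z, F z ∂(gm n)) ^ 2 ≤ 1 :=
    (hc.cpF.integral_sq_le.trans (hc.sqF_le h)).trans h.sqU_le_one
  have hq1 : (∫ z, G z ∂(gm n)) ^ 2 ≤ 1 :=
    (hc.cpG.integral_sq_le.trans (hc.sqG_le h)).trans h.symm.sqU_le_one
  have hη : |ue U - Ss U V * sq U| ≤ Real.sqrt δ := by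
    have hU := h.hU
    have e1 : ue U - Ss U V * sq U = ∫ y, U y * (eul U y - Ss U V * U y) ∂(gm n) := by
      unfold ue sq
      rw [← integral_const_mul, ← gint_sub (by fun_prop) (by fun_prop)]
      exact integral_congr_ae (.of_forall fun y => by simp only; ring)
    rw [e1]
    refine (CP.abs_integral_mul_le hU.cp (Function.HasTemperateGrowth.cp (by fun_prop))).trans ?_
    rw [← one_mul (Real.sqrt δ)]
    exact mul_le_mul (Real.sqrt_le_one.mpr h.sqU_le_one) (Real.sqrt_le_sqrt
      (by linarith [sq_nonneg' (fun y => eul V y - Ss U V * V y)])) (Real.sqrt_nonneg _)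
      zero_le_one
  set Δ := deficit (comb F G)
  set d := Real.sqrt Δ with hd
  have hd0 : 0 ≤ d := Real.sqrt_nonneg _
  have hd2 : d ^ 2 = Δ := Real.sq_sqrt hdef0
  set e := Real.sqrt δ with he
  have he0 : 0 ≤ e := Real.sqrt_nonneg _
  have he2 : e ^ 2 = δ := Real.sq_sqrt hδ0
  have he1 : e ≤ 1 := Real.sqrt_le_one.mpr hδ1
  set p := ∫ z, F z ∂(gm n)
  set q := ∫ z, G z ∂(gm n)
  set η := ue U - Ss U V * sq U with hηd
  have hS : ue U + ue V = Ss U V := rfl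
  unfold Hs at hm
  set ω := C / ℓ with hω
  have e2 : 2 * C / ℓ = 2 * ω := by rw [hω]; ring
  rw [e2] at hdef
  have hDu : dir U = ue U - pot (ℓ ^ 120) U V := by linarith
  rw [hDu] at hdef
  have hω2 : 2 * ω * ue V ≤ 2 * ω * 1 := mul_le_mul_of_nonneg_left (by linarith) (by linarith)
  have i1 : q ^ 2 * (2 * ω) ≤ 1 * (2 * ω) := mul_le_mul_of_nonneg_right hq1 (by linarith)
  have i2 : p ^ 2 * (2 * ω * ue V) ≤ 1 * (2 * ω * 1) :=
    mul_le_mul hp1 hω2 (by positivity) zero_le_one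
  have i3 : 0 ≤ q ^ 2 * pot (ℓ ^ 120) U V := mul_nonneg (sq_nonneg q) hP
  have i4 : 0 ≤ p ^ 2 * pot (ℓ ^ 120) U V := mul_nonneg (sq_nonneg p) hP
  have hV' : ue V - sq V = -η - (1 - Ss U V) * sq V := by
    rw [hηd]; linear_combination hS - Ss U V * hm
  have hU' : ue U - sq U = η - (1 - Ss U V) * sq U := by rw [hηd]; ring
  have i5 : Δ + (1 - Ss U V) * (q ^ 2 * sq U + p ^ 2 * sq V) ≤ (q ^ 2 - p ^ 2) * η + 4 * ω := by
    have e3 : q ^ 2 * (ue U - sq U) + p ^ 2 * (ue V - sq V) =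
      (q ^ 2 - p ^ 2) * η - (1 - Ss U V) * (q ^ 2 * sq U + p ^ 2 * sq V) := by
      rw [hU', hV']; ring
    linarith
  have i6 : μ ^ 2 ≤ q ^ 2 * sq U + p ^ 2 * sq V := by
    have j1 := mul_le_mul_of_nonneg_right (pow_le_pow_left₀ hμ.le hμq 2) (sq_nonneg' U)
    have j2 := mul_le_mul_of_nonneg_right (pow_le_pow_left₀ hμ.le hμp 2) (sq_nonneg' V)
    have j3 : μ ^ 2 = μ ^ 2 * sq U + μ ^ 2 * sq V := by rw [← mul_add, hm, mul_one]
    linarith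
  have i7 : (1 - Ss U V) * μ ^ 2 ≤ (1 - Ss U V) * (q ^ 2 * sq U + p ^ 2 * sq V) :=
    mul_le_mul_of_nonneg_left i6 (by linarith)
  have i8 : (q ^ 2 - p ^ 2) * η ≤ B * (d + e + ω) * e := by
    refine (le_abs_self _).trans ?_
    rw [abs_mul]
    exact mul_le_mul hpq hη (abs_nonneg _) (by positivity)
  have i9 : B * (d + e + ω) * e ≤ Δ + B ^ 2 * δ + B * δ + B * ω := by
    have j1 : B * d * e ≤ d ^ 2 + B ^ 2 * e ^ 2 := by
      have k1 := two_mul_le_add_sq d (B * e)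
      have k2 := sq_nonneg d
      have k3 := sq_nonneg (B * e)
      linarith only [k1, k2, k3]
    have j2 : B * ω * e ≤ B * ω * 1 := mul_le_mul_of_nonneg_left he1 (by positivity)
    rw [hd2, he2] at j1
    have j3 : B * (d + e + ω) * e = B * d * e + B * e ^ 2 + B * ω * e := by ring
    rw [j3, he2]; linarith only [j1, j2]
  have hfin : (1 - Ss U V) * μ ^ 2 ≤ (B ^ 2 + B + (B + 4) * C) * (δ + τ) := by
    have y1 : ω = C * τ := hCτ
    have y2 : (1 - Ss U V) * μ ^ 2 ≤ (B ^ 2 + B) * δ + (B + 4) * (C * τ) := by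
      rw [← y1]; linarith only [i5, i7, i8, i9]
    have y3 : 0 ≤ (B ^ 2 + B) * τ := by positivity
    have y4 : 0 ≤ (B + 4) * C * δ := by positivity
    linarith only [y2, y3, y4]
  have hfin2 : 1 - Ss U V ≤ A₀ * (δ + τ) := by
    rw [hA₀, div_mul_eq_mul_div, le_div_iff₀ (by positivity)]; exact hfin
  have z1 : 0 ≤ A₀ * C * (δ + τ) := by positivity
  linarith

end Mean

/-! ### Scale dynamics beyond the segregation scale -/

/-- The decaying error rate beyond the scale `a`. -/
def decay (a r : ℝ) : ℝ := (r / a) ^ (-(1 / 60) : ℝ)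

lemma hasDerivAt_decay {a r : ℝ} (ha : 0 < a) (hr : 0 < r) :
    HasDerivAt (decay a) (-(1 / 60) * decay a r / r) r := by
  have h1 : HasDerivAt (fun r : ℝ => r / a) (1 / a) r := (hasDerivAt_id r).div_const a
  have h2 := h1.rpow_const (p := -(1 / 60)) (Or.inl (by positivity))
  refine h2.congr_deriv ?_
  rw [decay, Real.rpow_sub_one (by positivity)]
  field_simp

lemma decay_nonneg {a r : ℝ} (ha : 0 < a) (hr : 0 < r) : 0 ≤ decay a r :=
  Real.rpow_nonneg (by positivity) _

lemma decay_pos {a r : ℝ} (ha : 0 < a) (hr : 0 < r) : 0 < decay a r :=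
  Real.rpow_pos_of_pos (by positivity) _

lemma decay_le_one {a r : ℝ} (ha : 0 < a) (hr : a ≤ r) : decay a r ≤ 1 :=
  Real.rpow_le_one_of_one_le_of_nonpos (by rwa [one_le_div ha]) (by norm_num)

lemma exists_nrm_of_scale (n : ℕ) : ∃ K : ℝ, ∀ u v : Eu n → ℝ, Ent u v → ∀ x : Eu n, ∀ a : ℝ,
    0 < a → a ^ 2 * HH u v x a = 1 → ∀ r, a ≤ r → ∃ ℓ k : ℝ, 0 < k ∧ k ^ 2 * HH u v x r = 1 ∧
      r ^ 2 * HH u v x r = ℓ ^ 120 ∧ 1 ≤ ℓ ∧ 1 / ℓ ≤ decay a r ∧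
      Nrm K ℓ (fun y => k * res u x r y) (fun y => k * res v x r y) := by
  obtain ⟨K, hK⟩ := exists_nrm n
  refine ⟨K, fun u v h x a ha haH r har => ?_⟩
  have hr : 0 < r := ha.trans_le har
  have hH := h.HH_pos x hr
  have hLa : (r / a) ^ 2 ≤ r ^ 2 * HH u v x r := by
    have h1 := h.monotoneOn_HH x ha.le hr.le har
    have h2 : HH u v x a = 1 / a ^ 2 := by field_simp; linarith
    rw [h2] at h1
    calc (r / a) ^ 2 = r ^ 2 * (1 / a ^ 2) := by ring
      _ ≤ _ := mul_le_mul_of_nonneg_left h1 (sq_nonneg r)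
  have hra : 1 ≤ r / a := by rwa [one_le_div ha]
  set L := r ^ 2 * HH u v x r with hL
  have hL1 : 1 ≤ L := (one_le_pow₀ hra).trans hLa
  set ℓ := L ^ ((1 : ℝ) / 120) with hℓ
  have hℓL : L = ℓ ^ 120 := by
    rw [hℓ, ← Real.rpow_natCast, ← Real.rpow_mul (by linarith)]; norm_num
  have hℓ1 : 1 ≤ ℓ := Real.one_le_rpow hL1 (by norm_num)
  have hk : (Real.sqrt (HH u v x r))⁻¹ ^ 2 * HH u v x r = 1 := by
    rw [inv_pow, Real.sq_sqrt hH.le, inv_mul_cancel₀ hH.ne']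
  have hk0 : 0 < (Real.sqrt (HH u v x r))⁻¹ := by positivity
  refine ⟨ℓ, _, hk0, hk, hℓL, hℓ1, ?_, hK u v h x r ℓ _ hr hℓ1 hℓL hk0 hk⟩
  have h1 : (r / a) ^ ((1 : ℝ) / 60) ≤ ℓ := by
    have := Real.rpow_le_rpow (by positivity) hLa (by norm_num : (0 : ℝ) ≤ 1 / 120)
    rw [← Real.rpow_natCast, ← Real.rpow_mul (by positivity)] at this
    norm_num at this ⊢
    exact this
  rw [decay, Real.rpow_neg (by positivity), ← one_div]
  exact one_div_le_one_div_of_le (Real.rpow_pos_of_pos (by positivity) _) h1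

lemma exists_ue_ge_at (n : ℕ) : ∃ κ > 0, ∃ C : ℝ, 0 ≤ C ∧ ∀ u v : Eu n → ℝ, Ent u v →
    ∀ x : Eu n, ∀ a : ℝ, 0 < a → a ^ 2 * HH u v x a = 1 → ∀ r, a ≤ r →
      sq (res v x r) ≤ κ * HH u v x r →
        (1 - C * decay a r) * sq (res v x r) ≤ ue (res v x r) := by
  obtain ⟨K, hK⟩ := exists_nrm_of_scale n
  obtain ⟨κ, hκ, C, hC, hst⟩ := exists_ue_ge n K
  refine ⟨κ, hκ, C, hC, fun u v h x a ha haH r har hle => ?_⟩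
  have hr : 0 < r := ha.trans_le har
  obtain ⟨ℓ, k, hk, hkH, hL, hℓ1, hdec, hN⟩ := hK u v h x a ha haH r har
  have hk2 : 0 < k ^ 2 := by positivity
  have h1 := hst ℓ _ _ hN (by
    rw [sq_const_mul]
    calc k ^ 2 * sq (res v x r) ≤ k ^ 2 * (κ * HH u v x r) :=
          mul_le_mul_of_nonneg_left hle hk2.le
      _ = κ := by linear_combination κ * hkH)
  rw [sq_const_mul, ue_const_mul (hasTemperateGrowth_res h.hV x r)] at h1
  have h2 : (1 - C / ℓ) * sq (res v x r) ≤ ue (res v x r) := by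
    refine le_of_mul_le_mul_left ?_ hk2
    linarith
  refine le_trans (mul_le_mul_of_nonneg_right ?_ (sq_nonneg' _)) h2
  have h3 := mul_le_mul_of_nonneg_left hdec hC
  rw [mul_one_div] at h3
  linarith

lemma exists_one_sub_SS_le (n : ℕ) {c : ℝ} (hc : 0 < c) : ∃ A : ℝ, 0 ≤ A ∧
    ∀ u v : Eu n → ℝ, Ent u v → ∀ x : Eu n, ∀ a : ℝ, 0 < a → a ^ 2 * HH u v x a = 1 →
      ∀ r, a ≤ r → c * HH u v x r ≤ sq (res u x r) → c * HH u v x r ≤ sq (res v x r) →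
        1 - SS u v x r / HH u v x r ≤ A * (DL u v x r + decay a r) := by
  obtain ⟨K, hK⟩ := exists_nrm_of_scale n
  obtain ⟨A, hA, hst⟩ := exists_one_sub_S_le n K hc
  refine ⟨A, hA, fun u v h x a ha haH r har hu hv => ?_⟩
  have hr : 0 < r := ha.trans_le har
  obtain ⟨ℓ, k, hk, hkH, hL, hℓ1, hdec, hN⟩ := hK u v h x a ha haH r har
  have hH := h.HH_pos x hr
  have hk2 : k ^ 2 = 1 / HH u v x r := by field_simp; linarith
  have htu := hasTemperateGrowth_res h.hU x r
  have htv := hasTemperateGrowth_res h.hV x r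
  have hmass : ∀ f : Eu n → ℝ, c * HH u v x r ≤ sq f → c ≤ sq fun y => k * f y := by
    intro f hf
    rw [sq_const_mul, hk2, one_div_mul_eq_div, le_div_iff₀ hH]; exact hf
  have h1 := hst ℓ _ _ hN (hmass _ hu) (hmass _ hv)
  have e1 : Ss (fun y => k * res u x r y) (fun y => k * res v x r y) =
      SS u v x r / HH u v x r := by
    rw [Ss, ue_const_mul htu, ue_const_mul htv, SS, Ss, hk2]; ring
  have e2 : dls (ℓ ^ 120) (fun y => k * res u x r y) (fun y => k * res v x r y) =
      DL u v x r := by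
    have hck : (1 / k) * k = 1 := by field_simp
    have hβ : ℓ ^ 120 = r ^ 2 * (1 / k) ^ 2 := by
      rw [← hL]; field_simp; linarith
    rw [hN.dls_eq, e1, hβ, pot_const_mul hck, Qs, sq_eul_const_mul htu, sq_eul_const_mul htv, hk2,
      DL, dls]
    change _ = (Qs (res u x r) (res v x r) * HH u v x r - SS u v x r ^ 2 +
      pot (r ^ 2) (res u x r) (res v x r) * (HH u v x r + SS u v x r)) / HH u v x r ^ 2
    unfold Qs
    field_simp
  rw [e1, e2] at h1
  refine h1.trans (mul_le_mul_of_nonneg_left (by linarith) hA)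

lemma HH_comm {n : ℕ} (u v : Eu n → ℝ) (x : Eu n) (r : ℝ) : HH v u x r = HH u v x r :=
  add_comm _ _

/-- Beyond the segregation scale, each component keeps a fixed fraction of the mass. -/
lemma exists_mul_HH_le_sq (n : ℕ) : ∃ c : ℝ, 0 < c ∧ ∀ u v : Eu n → ℝ, Ent u v → ∀ x : Eu n,
    u x = v x → ∀ a : ℝ, 0 < a → a ^ 2 * HH u v x a = 1 → ∀ r, a ≤ r →
      c * HH u v x r ≤ sq (res v x r) := by
  obtain ⟨κ, hκ, C, hC, hst⟩ := exists_ue_ge_at n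
  obtain ⟨c, hc, hsc⟩ := exists_le_sq_at_scale n
  have hm : 0 < min κ c := lt_min hκ hc
  set C' : ℝ := 120 * (C + 1) with hC'
  have hC'0 : 0 ≤ C' := by positivity
  set φ₀ : ℝ := Real.log (min κ c) - C' with hφ₀
  refine ⟨Real.exp (φ₀ - 1), Real.exp_pos _, fun u v h x hx a ha haH R haR => ?_⟩
  have hpos : ∀ r, 0 < r → 0 < sq (res v x r) := fun r hr => (h.res x hr).symm.sqU_pos
  have hd : ∀ r, 0 < r → HasDerivAt (fun r => Real.log (sq (res v x r)) - Real.log (HH u v x r) +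
      NN u v x r - C' * decay a r) (2 * ue (res v x r) / r / sq (res v x r) -
        2 * SS u v x r / r / HH u v x r + 2 * DL u v x r / r -
        C' * (-(1 / 60) * decay a r / r)) r := fun r hr =>
    ((((hasDerivAt_sq_res h.hV x hr).log (hpos r hr).ne').sub
      ((h.hasDerivAt_HH x hr).log (h.HH_pos x hr).ne')).add (h.hasDerivAt_NN x hr)).sub
      ((hasDerivAt_decay ha hr).const_mul C')
  have key := image_le_of_deriv_right_lt_deriv_boundary' (f := fun _ => φ₀) (f' := fun _ => 0)
    (a := a) (b := R) continuousOn_const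
    (fun r _ => (hasDerivAt_const r φ₀).hasDerivWithinAt)
    (B := fun r => Real.log (sq (res v x r)) - Real.log (HH u v x r) +
      NN u v x r - C' * decay a r) ?_
    (fun r hr => (hd r (ha.trans_le hr.1)).continuousAt.continuousWithinAt)
    (fun r hr => (hd r (ha.trans_le hr.1)).hasDerivWithinAt) ?_ (Set.right_mem_Icc.2 haR)
  · have hR : 0 < R := ha.trans_le haR
    have h1 := h.NN_le_one x hR
    have h2 := mul_nonneg hC'0 (decay_nonneg ha hR)
    have hH := h.HH_pos x hR
    rw [← Real.log_le_log_iff (by positivity) (hpos R hR), Real.log_mul (Real.exp_pos _).ne' hH.ne',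
      Real.log_exp]
    linarith
  · have h1 := hsc u v h x hx a ha haH
    have hH := h.HH_pos x ha
    have h2 : min κ c * HH u v x a ≤ sq (res v x a) :=
      (mul_le_mul_of_nonneg_right (min_le_right _ _) hH.le).trans h1
    have h3 := Real.log_le_log (by positivity) h2
    rw [Real.log_mul hm.ne' hH.ne'] at h3
    have h4 : 0 ≤ NN u v x a := (h.res x ha).Ns_nonneg
    have h5 := mul_le_mul_of_nonneg_left (decay_le_one ha le_rfl) hC'0
    linarith
  · intro r hr heq
    have hr0 : 0 < r := ha.trans_le hr.1
    have hH := h.HH_pos x hr0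
    have hs := hpos r hr0
    have h1 := h.NN_le_one x hr0
    have h4 : 0 ≤ NN u v x r := (h.res x hr0).Ns_nonneg
    have h5 := mul_le_mul_of_nonneg_left (decay_le_one ha hr.1) hC'0
    have h6 : sq (res v x r) ≤ κ * HH u v x r := by
      refine le_trans ?_ (mul_le_mul_of_nonneg_right (min_le_left κ c) hH.le)
      rw [← Real.log_le_log_iff hs (by positivity), Real.log_mul hm.ne' hH.ne']
      linarith
    have h7 := hst u v h x a ha haH r hr.1 h6
    have h8 : 1 - C * decay a r ≤ ue (res v x r) / sq (res v x r) := by rwa [le_div_iff₀ hs]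
    have h9 : SS u v x r / HH u v x r = NN u v x r +
        pot (r ^ 2) (res u x r) (res v x r) / HH u v x r := by
      rw [h.SS_eq x hr0]; field_simp
    have h10 : pot (r ^ 2) (res u x r) (res v x r) / HH u v x r ≤ DL u v x r :=
      (h.res x hr0).pot_div_le_dls
    have h11 := decay_pos ha hr0
    have e : 2 * ue (res v x r) / r / sq (res v x r) -
        2 * SS u v x r / r / HH u v x r + 2 * DL u v x r / r -
        C' * (-(1 / 60) * decay a r / r) = 2 * (ue (res v x r) / sq (res v x r) -
          SS u v x r / HH u v x r + DL u v x r + (C + 1) * decay a r) / r := by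
      rw [hC']; field_simp; ring
    rw [e]
    refine div_pos (mul_pos two_pos ?_) hr0
    linarith

/-- Beyond the segregation scale the mass grows at least quadratically. -/
lemma exists_HH_ge (n : ℕ) : ∃ A : ℝ, 0 ≤ A ∧ ∀ u v : Eu n → ℝ, Ent u v → ∀ x : Eu n,
    u x = v x → ∀ a : ℝ, 0 < a → a ^ 2 * HH u v x a = 1 → ∀ r, a ≤ r →
      r ^ 2 ≤ Real.exp A * a ^ 4 * HH u v x r := by
  obtain ⟨c, hc, hmass⟩ := exists_mul_HH_le_sq n
  obtain ⟨A, hA, hst⟩ := exists_one_sub_SS_le n hc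
  refine ⟨121 * A, by positivity, fun u v h x hx a ha haH r har => ?_⟩
  have hd : ∀ r, 0 < r → HasDerivAt (fun r => Real.log (HH u v x r) - 2 * Real.log r +
      A * NN u v x r - 120 * A * decay a r) (2 * SS u v x r / r / HH u v x r - 2 * r⁻¹ +
        A * (2 * DL u v x r / r) - 120 * A * (-(1 / 60) * decay a r / r)) r := fun r hr =>
    ((((h.hasDerivAt_HH x hr).log (h.HH_pos x hr).ne').sub
      ((Real.hasDerivAt_log hr.ne').const_mul 2)).add ((h.hasDerivAt_NN x hr).const_mul A)).sub
      ((hasDerivAt_decay ha hr).const_mul (120 * A))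
  have hmono : MonotoneOn (fun r => Real.log (HH u v x r) - 2 * Real.log r +
      A * NN u v x r - 120 * A * decay a r) (Set.Ici a) := by
    refine monotoneOn_of_deriv_nonneg (convex_Ici a)
      (fun s hs => (hd s (ha.trans_le hs)).continuousAt.continuousWithinAt)
      (fun s hs => (hd s (ha.trans_le (interior_subset hs))).differentiableAt.differentiableWithinAt)
      fun s hs => ?_
    have has : a ≤ s := interior_subset hs
    have hs0 : 0 < s := ha.trans_le has
    rw [(hd s hs0).deriv]
    have hH := h.HH_pos x hs0
    have h1 := hst u v h x a ha haH s has
      (by simpa only [HH_comm u v] using hmass v u h.symm x hx.symm a ha (by rwa [HH_comm u v]) s has)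
      (hmass u v h x hx a ha haH s has)
    have e : 2 * SS u v x s / s / HH u v x s - 2 * s⁻¹ +
        A * (2 * DL u v x s / s) - 120 * A * (-(1 / 60) * decay a s / s) =
        2 * (SS u v x s / HH u v x s - 1 + A * (DL u v x s + decay a s)) / s := by
      field_simp; ring
    rw [e]
    exact div_nonneg (mul_nonneg two_pos.le (by linarith)) hs0.le
  have hr : 0 < r := ha.trans_le har
  have h1 := hmono Set.self_mem_Ici har har
  simp only at h1
  have h2 := mul_le_mul_of_nonneg_left (h.NN_le_one x hr) hA
  have h3 : 0 ≤ A * NN u v x a := mul_nonneg hA (h.res x ha).Ns_nonneg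
  have h4 := mul_le_mul_of_nonneg_left (decay_le_one ha le_rfl) (by positivity : 0 ≤ 120 * A)
  have h5 : 0 ≤ 120 * A * decay a r := mul_nonneg (by positivity) (decay_nonneg ha hr)
  have hHa := h.HH_pos x ha
  have hHr := h.HH_pos x hr
  have h6 := congrArg Real.log haH
  rw [Real.log_mul (by positivity) hHa.ne', Real.log_pow, Real.log_one] at h6
  rw [← Real.log_le_log_iff (by positivity) (by positivity), Real.log_mul (by positivity) hHr.ne',
    Real.log_mul (by positivity) (by positivity), Real.log_exp, Real.log_pow, Real.log_pow]
  push_cast at h6 ⊢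
  linarith

/-- On the set where both components agree, the segregation scale is bounded below. -/
lemma exists_inv_scale_le {n : ℕ} {u v : Eu n → ℝ} (h : Ent u v) : ∃ C : ℝ, 0 < C ∧
    ∀ x : Eu n, u x = v x → ∀ a : ℝ, 0 < a → a ^ 2 * HH u v x a = 1 → 1 / a ^ 4 ≤ C := by
  obtain ⟨A, hA, hst⟩ := exists_HH_ge n
  obtain ⟨M, hM, hg⟩ := h.growth
  have hw : CP (fun y : Eu n => (1 + ‖y‖) ^ 2) := ((CP.const 1).add CP.norm).pow 2
  have hJ : 0 < ∫ y : Eu n, (1 + ‖y‖) ^ 2 ∂(gm n) := hw.integral_pos fun y => by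
    have := norm_nonneg y; positivity
  refine ⟨Real.exp A * (M ^ 2 * ∫ y : Eu n, (1 + ‖y‖) ^ 2 ∂(gm n)), by positivity,
    fun x hx a ha haH => ?_⟩
  set R := max a (1 + ‖x‖) with hRdef
  have haR : a ≤ R := le_max_left _ _
  have hR : 0 < R := ha.trans_le haR
  have hxR : 1 + ‖x‖ ≤ R := le_max_right _ _
  have hU := hasTemperateGrowth_res h.hU x R
  have hV := hasTemperateGrowth_res h.hV x R
  have hup := CP.integral_mono ((hU.cp.pow 2).add (hV.cp.pow 2))
    (hw.const_mul (M ^ 2 * R ^ 2)) fun y => by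
      have h1 := hg (x + R • y)
      have h2 : 1 + ‖x + R • y‖ ≤ R * (1 + ‖y‖) := by
        have := norm_add_le x (R • y)
        rw [norm_smul, Real.norm_of_nonneg hR.le] at this
        linarith
      have h3 := h.posU (x + R • y)
      have h4 := h.posV (x + R • y)
      have h6 := pow_le_pow_left₀ (by positivity)
        (h1.trans (mul_le_mul_of_nonneg_left h2 hM.le)) 2
      change u (x + R • y) ^ 2 + v (x + R • y) ^ 2 ≤ _
      nlinarith [mul_pos h3 h4]
  rw [integral_const_mul] at hup
  have hup' : HH u v x R ≤ M ^ 2 * R ^ 2 * ∫ y : Eu n, (1 + ‖y‖) ^ 2 ∂(gm n) :=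
    (eq_sq_add_sq hU hV).trans_le hup
  have h1 := (hst u v h x hx a ha haH R haR).trans
    (mul_le_mul_of_nonneg_left hup' (by positivity))
  rw [div_le_iff₀ (by positivity)]
  refine le_of_mul_le_mul_right ?_ (by positivity : 0 < R ^ 2)
  linarith

lemma exists_sq_add_sq_le_on_ball {n : ℕ} {u v : Eu n → ℝ} (h : Ent u v) : ∃ C : ℝ, 0 < C ∧
    ∀ x : Eu n, u x = v x → ∀ R : ℝ, 0 < R → ∀ y ∈ ball x R,
      u y ^ 2 + v y ^ 2 ≤ C * (1 + R) ^ 2 := by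
  obtain ⟨C, hC, hscale⟩ := exists_inv_scale_le h
  obtain ⟨K, hK, hpt⟩ := exists_sq_add_sq_le n
  have he : (1 : ℝ) ≤ Real.exp 1 := Real.one_le_exp zero_le_one
  refine ⟨4 * K * (Real.exp 1 * (1 + C)), by positivity, fun x hx R hR y hy => ?_⟩
  obtain ⟨a, ha, haH⟩ := h.exists_scale x
  have h1 := hscale x hx a ha haH
  have hHa : HH u v x a = 1 / a ^ 2 := by field_simp; linarith
  have hHR : HH u v x R ≤ Real.exp 1 * (1 + C) * (1 + R) ^ 2 := by
    rcases le_total a R with haR | haR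
    · have h2 := h.HH_growth x ha haR
      rw [hHa] at h2
      calc HH u v x R ≤ Real.exp 1 * (1 / a ^ 4) * R ^ 2 := h2.trans_eq (by field_simp)
        _ ≤ _ := by gcongr <;> linarith
    · have h2 := h.monotoneOn_HH x hR.le ha.le haR
      rw [hHa] at h2
      have h3 : 1 / a ^ 2 ≤ 1 + C := by
        have e : 1 / a ^ 4 = (1 / a ^ 2) ^ 2 := by field_simp
        rw [e] at h1
        nlinarith [sq_nonneg (1 / a ^ 2 - 1), sq_nonneg (1 / a ^ 2)]
      calc HH u v x R ≤ 1 * (1 + C) * 1 := by linarith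
        _ ≤ _ := by gcongr; exact one_le_pow₀ (by linarith)
  have hz : ‖R⁻¹ • (y - x)‖ ≤ 1 := by
    rw [norm_smul, norm_inv, Real.norm_of_nonneg hR.le, inv_mul_le_one₀ hR]
    exact (mem_ball_iff_norm.1 hy).le
  have h4 := hpt u v h x R hR (R⁻¹ • (y - x))
  rw [smul_inv_smul₀ hR.ne', add_sub_cancel] at h4
  have hn := norm_nonneg (R⁻¹ • (y - x))
  calc _ ≤ _ := h4
    _ ≤ K * (Real.exp 1 * (1 + C) * (1 + R) ^ 2) * 2 ^ 2 := by
      have := h.HH_pos x hR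
      gcongr; linarith
    _ = _ := by ring

lemma measureReal_sphere_eq {n : ℕ} (d : ℝ) (x : Eu n) (r : ℝ) :
    (μH[d]).real (sphere x r) = (μH[d]).real (sphere (0 : Eu n) r) := by
  have h := (IsometryEquiv.addLeft x).hausdorffMeasure_image d (sphere (0 : Eu n) r)
  rw [IsometryEquiv.image_sphere] at h
  simp only [IsometryEquiv.addLeft_apply, add_zero] at h
  rw [measureReal_def, measureReal_def, h]

/-- Averages of a positive continuous function over a compact set are controlled by its upper
bound, whether or not the set has finite measure. -/
lemma setIntegral_le_of_compact {X : Type*} [TopologicalSpace X] [T2Space X] [MeasurableSpace X]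
    [OpensMeasurableSpace X] {μ : Measure X} {s : Set X} (hs : IsCompact s) {f : X → ℝ}
    (hf : ContinuousOn f s) (hpos : ∀ y ∈ s, 0 < f y) {M : ℝ} (hM : ∀ y ∈ s, f y ≤ M)
    (hM0 : 0 ≤ M) : ∫ y in s, f y ∂μ ≤ M * μ.real s := by
  by_cases hi : IntegrableOn f s μ
  · rcases s.eq_empty_or_nonempty with rfl | hne
    · simp
    obtain ⟨y₀, hy₀, hmin⟩ := hs.exists_isMinOn hne hf
    have hc := hpos y₀ hy₀
    have hfin : IntegrableOn (fun _ => f y₀) s μ := by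
      refine Integrable.mono hi aestronglyMeasurable_const ?_
      filter_upwards [ae_restrict_mem hs.measurableSet] with y hy
      rw [Real.norm_of_nonneg hc.le, Real.norm_of_nonneg (hpos y hy).le]
      exact hmin hy
    have hlt : μ s < ⊤ := by
      rcases (integrableOn_const_iff (by simp)).1 hfin with h | h
      · exact absurd (enorm_eq_zero.1 h) hc.ne'
      · exact h
    calc ∫ y in s, f y ∂μ ≤ ∫ _ in s, M ∂μ :=
          setIntegral_mono_on hi (integrableOn_const hlt.ne) hs.measurableSet hM
      _ = M * μ.real s := by rw [setIntegral_const, smul_eq_mul, mul_comm]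
  · rw [integral_undef hi]
    exact mul_nonneg hM0 measureReal_nonneg

lemma _root_.IsSolution.ent {n : ℕ} {u v : Eu n → ℝ} (h : IsSolution u v) {C₀ : ℝ} (hC₀ : 0 < C₀)
    (hg : ∀ x, u x + v x ≤ C₀ * (1 + ‖x‖)) : Ent u v := by
  obtain ⟨hu, hv, pu, pv, eu, ev⟩ := h
  have hpu : Poly u := ⟨C₀, 1, fun y => by
    rw [abs_of_pos (pu y), pow_one]; linarith [hg y, pv y]⟩
  have hpv : Poly v := ⟨C₀, 1, fun y => by
    rw [abs_of_pos (pv y), pow_one]; linarith [hg y, pu y]⟩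
  have h1 : ∀ y, lapl u y = u y * v y ^ 2 := fun y => by rw [← lap_eq_lapl hu, eu]
  have h2 : ∀ y, lapl v y = v y * u y ^ 2 := fun y => by rw [← lap_eq_lapl hv, ev]
  obtain ⟨tu, tv⟩ := hasTemperateGrowth_of_system hu hv hpu hpv h1 h2
  exact ⟨{ hU := tu, hV := tv, posU := pu, posV := pv, hβ := zero_lt_one
           eqU := fun y => by rw [h1, one_mul]
           eqV := fun y => by rw [h2, one_mul] }, C₀, hC₀, hg⟩

end SegregationBounds

/-- For an entire solution with linear growth there is a universal constant C > 0 such that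
for every x ∈ {u = v}: the boundary mass on ∂B₁(x) is at most C, and u + v ≤ C(1 + R)
on B_R(x) for every R > 0. -/
theorem uniform_bounds_on_free_boundary {n : ℕ} (hn : 2 ≤ n)
    (u v : EuclideanSpace ℝ (Fin n) → ℝ) (hsol : IsSolution u v)
    (C₀ : ℝ) (hC₀ : 0 < C₀) (hgrowth : ∀ x, u x + v x ≤ C₀ * (1 + ‖x‖)) :
    ∃ C : ℝ, 0 < C ∧ ∀ x : EuclideanSpace ℝ (Fin n), u x = v x →
      bdry u v x 1 ≤ C ∧
      ∀ R : ℝ, 0 < R → ∀ y ∈ ball x R, u y + v y ≤ C * (1 + R) := by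
  have h := hsol.ent hC₀ hgrowth
  obtain ⟨C, hC, hball⟩ := SegregationBounds.exists_sq_add_sq_le_on_ball h
  set m := (μH[(n : ℝ) - 1]).real (sphere (0 : EuclideanSpace ℝ (Fin n)) 1) with hm
  have hm0 : 0 ≤ m := measureReal_nonneg
  have hCm : 0 ≤ 9 * C * m := by positivity
  refine ⟨9 * C * m + (2 * C + 1), by positivity, fun x hx => ⟨?_, fun R hR y hy => ?_⟩⟩
  · have h1 := SegregationBounds.setIntegral_le_of_compact (μ := μH[(n : ℝ) - 1])
      (isCompact_sphere x 1) (f := fun y => u y ^ 2 + v y ^ 2)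
      ((h.hU.1.continuous.pow 2).add (h.hV.1.continuous.pow 2)).continuousOn
      (fun y _ => add_pos (pow_pos (h.posU y) 2) (pow_pos (h.posV y) 2))
      (M := 9 * C) (fun y hy => ?_) (by positivity)
    · rw [SegregationBounds.measureReal_sphere_eq, ← hm] at h1
      change bdry u v x 1 ≤ _ at h1
      linarith
    · have := hball x hx 2 two_pos y (sphere_subset_ball (by norm_num) hy)
      linarith
  · have h1 := hball x hx R hR y hy
    have h2 : (u y + v y) ^ 2 ≤ ((2 * C + 1) * (1 + R)) ^ 2 := by
      calc (u y + v y) ^ 2 ≤ 2 * (C * (1 + R) ^ 2) := by nlinarith [sq_nonneg (u y - v y)]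
        _ ≤ (2 * C + 1) ^ 2 * (1 + R) ^ 2 := by
          rw [← mul_assoc]
          exact mul_le_mul_of_nonneg_right (by nlinarith) (sq_nonneg _)
        _ = _ := by ring
    refine (abs_le_of_sq_le_sq' h2 (by positivity)).2.trans ?_
    exact mul_le_mul_of_nonneg_right (by linarith) (by linarith)
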